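/- Let 3/2 < p < 2 and g(u) = |u|^{p−1}u. For each ℓ > 0 let u_ℓ be the unique nonnegative weak solution on Q^∞ = (0,∞)×(0,∞) of u_t − u_{xx} = 0 with boundary flux measure μ = ℓ δ₀ (Dirac mass at t = 0) and initial measure ν = 0, taken with its representative continuous on (0,∞)×[0,∞). Let ω_s be the unique positive weak solution of the self-similar profile problem. Then for every t > 0 and x ≥ 0, lim_{ℓ→∞} u_ℓ(t,x) = U_{ω_s}(t,x) := t^{−1/(2(p−1))} ω_s(x/√t). -/

import Mathlib

open MeasureTheory Real Set Filter Topology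

noncomputable def Kw (η : ℝ) : ℝ := Real.exp (η ^ 2 / 4)

/-- An element of the weighted Sobolev space `H¹_K(ℝ₊)`, represented by its
(absolutely) continuous representative on `[0,∞)` together with its
distributional derivative, both square integrable against the weight `K`. -/
structure H1K where
  toFun : ℝ → ℝ
  deriv' : ℝ → ℝ
  absCont : ∀ x : ℝ, 0 ≤ x → toFun x = toFun 0 + ∫ t in (0:ℝ)..x, deriv' t
  memL2 : Integrable (fun η => (toFun η) ^ 2 * Kw η) (volume.restrict (Ioi (0:ℝ)))
  derivMemL2 : Integrable (fun η => (deriv' η) ^ 2 * Kw η) (volume.restrict (Ioi (0:ℝ)))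

/-- `ω` is a weak solution of the self-similar profile problem
`−ω'' − (η/2)ω' − ω/(2(p−1)) = 0` on `(0,∞)`, `−ω'(0) + |ω|^{p−1}ω(0) = 0`. -/
def IsWeakProfile (p : ℝ) (ω : H1K) : Prop :=
  ∀ ζ : H1K,
    (∫ η in Ioi (0:ℝ),
        (ω.deriv' η * ζ.deriv' η - ω.toFun η * ζ.toFun η / (2 * (p - 1))) * Kw η)
      + |ω.toFun 0| ^ (p - 1) * ω.toFun 0 * ζ.toFun 0 = 0

/-- The class `𝕏(Q^∞)` of test functions. -/
def IsTestFunInf (ζ : ℝ → ℝ → ℝ) : Prop :=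
  ContDiff ℝ 2 (fun q : ℝ × ℝ => ζ q.1 q.2) ∧
  HasCompactSupport (fun q : ℝ × ℝ => ζ q.1 q.2) ∧
  ∀ t : ℝ, deriv (ζ t) 0 = 0

/-- `u` is a weak solution on `Q^∞ = (0,∞)×(0,∞)` of `u_t − u_{xx} = 0` with
boundary flux measure `μ = ℓ δ₀` (for `g(u) = |u|^{p−1}u`) and initial
measure `ν = 0`. -/
def IsWeakSolDelta (p ℓ : ℝ) (u : ℝ → ℝ → ℝ) : Prop :=
  LocallyIntegrableOn (fun q : ℝ × ℝ => u q.1 q.2) (Ici 0 ×ˢ Ici 0) volume ∧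
  LocallyIntegrableOn (fun t => u t 0) (Ioi 0) volume ∧
  LocallyIntegrableOn (fun t => |u t 0| ^ (p - 1) * u t 0) (Ioi 0) volume ∧
  ∀ ζ : ℝ → ℝ → ℝ, IsTestFunInf ζ →
    -(∫ t in Ioi (0:ℝ), ∫ x in Ioi (0:ℝ),
        (deriv (fun s => ζ s x) t + deriv (deriv (ζ t)) x) * u t x)
      + (∫ t in Ioi (0:ℝ), |u t 0| ^ (p - 1) * u t 0 * ζ t 0)
    = ℓ * ζ 0 0



/-- Boundary-kernel of the half-line heat equation. -/
noncomputable def EE (τ x : ℝ) : ℝ := (√π)⁻¹ * τ ^ (-(1/2) : ℝ) * Real.exp (-x ^ 2 / (4 * τ))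

/-- Renormalised Volterra representation on the boundary. -/
def VProp (p : ℝ) (b L : ℝ → ℝ) : Prop := ∀ t : ℝ, 0 < t →
  Tendsto (fun s => L s * t ^ (-(1/2) : ℝ) - ∫ r in s..t, (t - r) ^ (-(1/2) : ℝ) * b r ^ p)
    (𝓝[>] 0) (𝓝 (√π * b t))

lemma ii_kern (s t : ℝ) : IntervalIntegrable (fun r => (t - r) ^ (-(1/2) : ℝ)) volume s t := by
  have h := (intervalIntegral.intervalIntegrable_rpow' (a := t - s) (b := 0) (r := -(1/2))
    (by norm_num)).comp_sub_left t
  simpa using h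

lemma int_kern (s t : ℝ) :
    ∫ r in s..t, (t - r) ^ (-(1/2) : ℝ) = 2 * (t - s) ^ (1/2 : ℝ) := by
  rw [intervalIntegral.integral_comp_sub_left (fun r => r ^ (-(1/2) : ℝ)),
    integral_rpow (Or.inl (by norm_num))]
  norm_num
  ring

lemma ii_kern_mul {s t : ℝ} (hs : 0 < s) (hst : s ≤ t) {f : ℝ → ℝ} (hf : ContinuousOn f (Ioi 0)) :
    IntervalIntegrable (fun r => (t - r) ^ (-(1/2) : ℝ) * f r) volume s t := by
  apply (ii_kern s t).mul_continuousOn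
  apply hf.mono
  rw [uIcc_of_le hst]
  intro x hx
  exact lt_of_lt_of_le hs hx.1

lemma pow_sub_le {p x y : ℝ} (hp : 1 ≤ p) (hx : 0 ≤ x) (hy : x ≤ y) :
    y ^ p - x ^ p ≤ p * y ^ (p - 1) * (y - x) := by
  rcases eq_or_lt_of_le (hx.trans hy) with h | h
  · have : x = 0 := by linarith
    subst this; rw [← h]; simp
  · have h1 := one_add_mul_self_le_rpow_one_add (s := x / y - 1)
      (by have := div_nonneg hx h.le; linarith) hp
    have h2 : (1 + (x / y - 1)) ^ p = x ^ p / y ^ p := by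
      rw [← Real.div_rpow hx h.le]; congr 1; ring
    rw [h2, le_div_iff₀ (by positivity)] at h1
    have h3 : y ^ p = y ^ (p - 1) * y := by
      rw [Real.rpow_sub_one h.ne']; field_simp
    have h4 : (1 + p * (x / y - 1)) * y ^ p = y ^ p + p * y ^ (p-1) * (x - y) := by
      rw [h3]; field_simp
    nlinarith

lemma kern_ratio {r t t0 : ℝ} (hr : 0 ≤ r) (hrt : r < t) (h : t ≤ t0) :
    t0 ^ (1/2:ℝ) * (t0 - r) ^ (-(1/2):ℝ) ≤ t ^ (1/2:ℝ) * (t - r) ^ (-(1/2):ℝ) := by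
  have h1 : 0 < t - r := by linarith
  have h2 : 0 < t0 - r := by linarith
  rw [Real.rpow_neg h1.le, Real.rpow_neg h2.le, ← div_eq_mul_inv, ← div_eq_mul_inv,
    ← Real.div_rpow (by linarith) h1.le, ← Real.div_rpow (by linarith) h2.le]
  apply Real.rpow_le_rpow (div_nonneg (by linarith) h2.le) _ (by norm_num)
  rw [div_le_div_iff₀ h2 h1]
  nlinarith

lemma half_mul_neg_half {t : ℝ} (ht : 0 < t) : t ^ (1/2:ℝ) * t ^ (-(1/2):ℝ) = 1 := by
  rw [← Real.rpow_add ht]; norm_num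

/-- The key inequality. -/
lemma key_ineq {p : ℝ} (hp : 0 ≤ p) {b1 b2 L1 L2 : ℝ → ℝ} (hV1 : VProp p b1 L1) (hV2 : VProp p b2 L2)
    (hc1 : ContinuousOn b1 (Ioi 0)) (hc2 : ContinuousOn b2 (Ioi 0))
    (hn1 : ∀ t, 0 < t → 0 ≤ b1 t) {t t0 : ℝ} (ht : 0 < t) (htt : t < t0)
    (hlt : ∀ r, 0 < r → r < t → b1 r ≤ b2 r) :
    √π * (t ^ (1/2:ℝ) * (b2 t - b1 t)) - √π * (t0 ^ (1/2:ℝ) * (b2 t0 - b1 t0)) ≤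
      t0 ^ (1/2:ℝ) * ∫ r in t..t0, (t0 - r) ^ (-(1/2) : ℝ) * (b2 r ^ p - b1 r ^ p) := by
  have ht0 : 0 < t0 := ht.trans htt
  have hcp : ∀ b : ℝ → ℝ, ContinuousOn b (Ioi 0) → ContinuousOn (fun r => b r ^ p) (Ioi 0) :=
    fun b hb => hb.rpow_const (fun x _ => Or.inr hp)
  have T := (((hV2 t ht).sub (hV1 t ht)).const_mul (t ^ (1/2:ℝ))).sub
    (((hV2 t0 ht0).sub (hV1 t0 ht0)).const_mul (t0 ^ (1/2:ℝ)))
  have key : ∀ᶠ s in 𝓝[>] (0:ℝ), t ^ (1 / 2 : ℝ) *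
          ((L2 s * t ^ (-(1 / 2) : ℝ) - ∫ (r : ℝ) in s..t, (t - r) ^ (-(1 / 2) : ℝ) * b2 r ^ p) -
            (L1 s * t ^ (-(1 / 2) : ℝ) - ∫ (r : ℝ) in s..t, (t - r) ^ (-(1 / 2) : ℝ) * b1 r ^ p)) -
        t0 ^ (1 / 2 : ℝ) *
          ((L2 s * t0 ^ (-(1 / 2) : ℝ) - ∫ (r : ℝ) in s..t0, (t0 - r) ^ (-(1 / 2) : ℝ) * b2 r ^ p) -
            (L1 s * t0 ^ (-(1 / 2) : ℝ) - ∫ (r : ℝ) in s..t0, (t0 - r) ^ (-(1 / 2) : ℝ) * b1 r ^ p))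
      ≤ t0 ^ (1/2:ℝ) * ∫ r in t..t0, (t0 - r) ^ (-(1/2) : ℝ) * (b2 r ^ p - b1 r ^ p) := by
    have hev : ∀ᶠ s in 𝓝[>] (0:ℝ), s ∈ Ioo 0 t := Ioo_mem_nhdsGT ht
    filter_upwards [hev] with s hs
    obtain ⟨hs, hst⟩ := hs
    have e1 : (∫ (r : ℝ) in s..t, (t - r) ^ (-(1 / 2) : ℝ) * b2 r ^ p) -
        (∫ (r : ℝ) in s..t, (t - r) ^ (-(1 / 2) : ℝ) * b1 r ^ p) =
        ∫ r in s..t, (t - r) ^ (-(1/2) : ℝ) * (b2 r ^ p - b1 r ^ p) := by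
      rw [← intervalIntegral.integral_sub (ii_kern_mul hs hst.le (hcp b2 hc2))
        (ii_kern_mul hs hst.le (hcp b1 hc1))]
      congr 1; ext r; ring
    have e2 : (∫ (r : ℝ) in s..t0, (t0 - r) ^ (-(1 / 2) : ℝ) * b2 r ^ p) -
        (∫ (r : ℝ) in s..t0, (t0 - r) ^ (-(1 / 2) : ℝ) * b1 r ^ p) =
        ∫ r in s..t0, (t0 - r) ^ (-(1/2) : ℝ) * (b2 r ^ p - b1 r ^ p) := by
      rw [← intervalIntegral.integral_sub (ii_kern_mul hs (hst.trans htt).le (hcp b2 hc2))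
        (ii_kern_mul hs (hst.trans htt).le (hcp b1 hc1))]
      congr 1; ext r; ring
    have hcd : ContinuousOn (fun r => b2 r ^ p - b1 r ^ p) (Ioi 0) := (hcp b2 hc2).sub (hcp b1 hc1)
    have i0 := ii_kern_mul hs (hst.trans htt).le hcd
    have i1 : IntervalIntegrable (fun r => (t0 - r) ^ (-(1/2) : ℝ) * (b2 r ^ p - b1 r ^ p))
        volume s t := i0.mono_set (by
          rw [uIcc_of_le hst.le, uIcc_of_le (hst.trans htt).le]
          exact Icc_subset_Icc le_rfl htt.le)
    have i2 : IntervalIntegrable (fun r => (t0 - r) ^ (-(1/2) : ℝ) * (b2 r ^ p - b1 r ^ p))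
        volume t t0 := ii_kern_mul ht htt.le hcd
    have i3 := ii_kern_mul hs hst.le hcd
    have e3 := intervalIntegral.integral_add_adjacent_intervals i1 i2
    have e4 : t0 ^ (1/2:ℝ) * (∫ r in s..t, (t0 - r) ^ (-(1/2) : ℝ) * (b2 r ^ p - b1 r ^ p)) ≤
        t ^ (1/2:ℝ) * (∫ r in s..t, (t - r) ^ (-(1/2) : ℝ) * (b2 r ^ p - b1 r ^ p)) := by
      rw [← intervalIntegral.integral_const_mul, ← intervalIntegral.integral_const_mul]
      apply intervalIntegral.integral_mono_on_of_le_Ioo hst.le (i1.const_mul _) (i3.const_mul _)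
      intro r hr
      have hr0 : 0 < r := hs.trans hr.1
      have h5 : 0 ≤ b2 r ^ p - b1 r ^ p := by
        have := Real.rpow_le_rpow (hn1 r hr0) (hlt r hr0 hr.2) hp
        linarith
      have := mul_le_mul_of_nonneg_right (kern_ratio hr0.le hr.2 htt.le) h5
      simpa [mul_assoc] using this
    have m1 := half_mul_neg_half ht
    have m2 := half_mul_neg_half ht0
    have : t ^ (1 / 2 : ℝ) *
          ((L2 s * t ^ (-(1 / 2) : ℝ) - ∫ (r : ℝ) in s..t, (t - r) ^ (-(1 / 2) : ℝ) * b2 r ^ p) -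
            (L1 s * t ^ (-(1 / 2) : ℝ) - ∫ (r : ℝ) in s..t, (t - r) ^ (-(1 / 2) : ℝ) * b1 r ^ p)) -
        t0 ^ (1 / 2 : ℝ) *
          ((L2 s * t0 ^ (-(1 / 2) : ℝ) - ∫ (r : ℝ) in s..t0, (t0 - r) ^ (-(1 / 2) : ℝ) * b2 r ^ p) -
            (L1 s * t0 ^ (-(1 / 2) : ℝ) - ∫ (r : ℝ) in s..t0, (t0 - r) ^ (-(1 / 2) : ℝ) * b1 r ^ p))
        = t0 ^ (1/2:ℝ) * (∫ r in s..t0, (t0 - r) ^ (-(1/2) : ℝ) * (b2 r ^ p - b1 r ^ p))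
          - t ^ (1/2:ℝ) * (∫ r in s..t, (t - r) ^ (-(1/2) : ℝ) * (b2 r ^ p - b1 r ^ p)) := by
      rw [← e1, ← e2]
      linear_combination (L2 s - L1 s) * m1 - (L2 s - L1 s) * m2
    rw [this, ← e3, mul_add]
    linarith
  have := le_of_tendsto T key
  refine le_trans (le_of_eq ?_) this
  ring

/-- Comparison principle for the renormalised Volterra equation. -/
lemma comparison {p : ℝ} (hp : 1 ≤ p) {b1 b2 L1 L2 : ℝ → ℝ} (hV1 : VProp p b1 L1)
    (hV2 : VProp p b2 L2)
    (hc1 : ContinuousOn b1 (Ioi 0)) (hc2 : ContinuousOn b2 (Ioi 0))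
    (hn1 : ∀ t, 0 < t → 0 ≤ b1 t) {τ : ℝ} (hτ : 0 < τ) (h0 : ∀ t, 0 < t → t < τ → b1 t < b2 t) :
    ∀ t, 0 < t → b1 t < b2 t := by
  by_contra hcon
  push Not at hcon
  obtain ⟨t1, ht1, hb1⟩ := hcon
  set A : Set ℝ := {t | 0 < t ∧ b2 t ≤ b1 t} with hA
  have hAne : A.Nonempty := ⟨t1, ht1, hb1⟩
  have hlb : ∀ t ∈ A, τ ≤ t := by
    intro t ht
    by_contra h
    push Not at h
    have := h0 t ht.1 h
    linarith [ht.2]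
  have hAbdd : BddBelow A := ⟨τ, hlb⟩
  set t0 := sInf A with ht0def
  have ht0τ : τ ≤ t0 := le_csInf hAne hlb
  have ht0 : 0 < t0 := hτ.trans_le ht0τ
  have hbefore : ∀ r, 0 < r → r < t0 → b1 r < b2 r := by
    intro r hr hrt
    by_contra h
    push Not at h
    exact absurd (csInf_le hAbdd (show r ∈ A from ⟨hr, h⟩)) (not_le.mpr hrt)
  have hat : b2 t0 ≤ b1 t0 := by
    have hmem : t0 ∈ closure A := csInf_mem_closure hAne hAbdd
    rw [mem_closure_iff_seq_limit] at hmem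
    obtain ⟨x, hx, hxl⟩ := hmem
    have c1 := (hc1.continuousAt (Ioi_mem_nhds ht0)).tendsto.comp hxl
    have c2 := (hc2.continuousAt (Ioi_mem_nhds ht0)).tendsto.comp hxl
    exact le_of_tendsto_of_tendsto' c2 c1 (fun n => (hx n).2)
  -- bound on b2
  obtain ⟨M, hM⟩ := (isCompact_Icc (a := t0/2) (b := t0)).exists_bound_of_continuousOn
    (hc2.mono (fun x hx => lt_of_lt_of_le (by linarith) hx.1))
  have hM0 : 0 ≤ M := (norm_nonneg _).trans (hM t0 ⟨by linarith, le_rfl⟩)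
  set C := p * M ^ (p - 1) with hC
  have hC0 : 0 ≤ C := by positivity
  set δ := min (t0 / 2) ((1 / (4 * (C + 1))) ^ 2) with hδ
  have hδ0 : 0 < δ := lt_min (by linarith) (by positivity)
  have hδ1 : δ ≤ t0 / 2 := min_le_left _ _
  have hδ2 : δ ^ (1/2:ℝ) ≤ 1 / (4 * (C + 1)) := by
    rw [← Real.sqrt_eq_rpow]
    exact Real.sqrt_le_iff.mpr ⟨by positivity, min_le_right _ _⟩
  obtain ⟨t, htm, htmax⟩ := (isCompact_Icc (a := t0 - δ) (b := t0)).exists_isMaxOn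
    (nonempty_Icc.mpr (by linarith)) (f := fun r => b2 r - b1 r)
    ((hc2.sub hc1).mono (fun x hx => lt_of_lt_of_le (by linarith) hx.1))
  have hwt : 0 < b2 t - b1 t := by
    have h1 : b2 (t0 - δ) - b1 (t0 - δ) ≤ b2 t - b1 t := htmax ⟨le_rfl, by linarith⟩
    have h2 := hbefore (t0 - δ) (by linarith) (by linarith)
    linarith
  have htt0 : t < t0 := by
    rcases lt_or_eq_of_le htm.2 with h | h
    · exact h
    · rw [h] at hwt; linarith
  have htpos : 0 < t := lt_of_lt_of_le (by linarith) htm.1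
  have K := key_ineq (by linarith) hV1 hV2 hc1 hc2 hn1 htpos htt0
    (fun r hr hrt => (hbefore r hr (hrt.trans htt0)).le)
  have hcd : ContinuousOn (fun r => b2 r ^ p - b1 r ^ p) (Ioi 0) :=
    (hc2.rpow_const (fun x _ => Or.inr (by linarith))).sub
      (hc1.rpow_const (fun x _ => Or.inr (by linarith)))
  have hI : ∫ r in t..t0, (t0 - r) ^ (-(1/2) : ℝ) * (b2 r ^ p - b1 r ^ p) ≤
      2 * (t0 - t) ^ (1/2:ℝ) * (C * (b2 t - b1 t)) := by
    rw [← int_kern, ← intervalIntegral.integral_mul_const]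
    apply intervalIntegral.integral_mono_on_of_le_Ioo htt0.le (ii_kern_mul htpos htt0.le hcd)
      ((ii_kern t t0).mul_const _)
    intro r hr
    apply mul_le_mul_of_nonneg_left _ (Real.rpow_nonneg (by linarith [hr.2]) _)
    have hr0 : 0 < r := htpos.trans hr.1
    have hw := hbefore r hr0 hr.2
    have h1 := pow_sub_le hp (hn1 r hr0) hw.le
    have h2 : b2 r ≤ M := (le_abs_self _).trans (hM r ⟨by linarith [htm.1, hr.1], hr.2.le⟩)
    have h3 : b2 r ^ (p - 1) ≤ M ^ (p - 1) :=
      Real.rpow_le_rpow ((hn1 r hr0).trans hw.le) h2 (by linarith)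
    have h4 : b2 r - b1 r ≤ b2 t - b1 t := htmax ⟨by linarith [htm.1, hr.1], hr.2.le⟩
    calc b2 r ^ p - b1 r ^ p ≤ p * b2 r ^ (p - 1) * (b2 r - b1 r) := h1
      _ ≤ C * (b2 t - b1 t) := by
        apply mul_le_mul _ h4 (by linarith) hC0
        exact mul_le_mul_of_nonneg_left h3 (by linarith)
  have hδ3 : (t0 - t) ^ (1/2:ℝ) ≤ 1 / (4 * (C + 1)) :=
    (Real.rpow_le_rpow (by linarith) (by linarith [htm.1]) (by norm_num)).trans hδ2
  have hs1 : t0 ^ (1/2:ℝ) ≤ √π * t ^ (1/2:ℝ) := by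
    rw [← Real.sqrt_eq_rpow, ← Real.sqrt_eq_rpow, ← Real.sqrt_mul Real.pi_pos.le]
    apply Real.sqrt_le_sqrt
    nlinarith [Real.pi_gt_three, htm.1]
  have ht0h : 0 < t0 ^ (1/2:ℝ) := by positivity
  have hneg : √π * (t0 ^ (1/2:ℝ) * (b2 t0 - b1 t0)) ≤ 0 := by
    have : t0 ^ (1/2:ℝ) * (b2 t0 - b1 t0) ≤ 0 := mul_nonpos_of_nonneg_of_nonpos ht0h.le (by linarith)
    exact mul_nonpos_of_nonneg_of_nonpos (Real.sqrt_nonneg _) this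
  have f1 : t0 ^ (1/2:ℝ) * (b2 t - b1 t) ≤ √π * (t ^ (1/2:ℝ) * (b2 t - b1 t)) := by
    rw [← mul_assoc]; exact mul_le_mul_of_nonneg_right hs1 hwt.le
  have f2 : 2 * (t0 - t) ^ (1/2:ℝ) * (C * (b2 t - b1 t)) ≤ (1/2) * (b2 t - b1 t) := by
    rw [← mul_assoc]
    apply mul_le_mul_of_nonneg_right _ hwt.le
    have : (t0 - t) ^ (1/2:ℝ) * C ≤ 1 / (4 * (C + 1)) * C := mul_le_mul_of_nonneg_right hδ3 hC0
    have h5 : 1 / (4 * (C + 1)) * C ≤ 1/4 := by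
      rw [div_mul_eq_mul_div, one_mul, div_le_div_iff₀ (by positivity) (by norm_num)]; linarith
    linarith
  have f3 := mul_le_mul_of_nonneg_left (hI.trans f2) ht0h.le
  nlinarith [mul_pos ht0h hwt]


lemma vprop_upper {p : ℝ} {b : ℝ → ℝ} {ℓ : ℝ} (hV : VProp p b (fun _ => ℓ))
    (hn : ∀ t, 0 < t → 0 ≤ b t) {t : ℝ} (ht : 0 < t) : √π * b t ≤ ℓ * t ^ (-(1/2) : ℝ) := by
  refine le_of_tendsto (hV t ht) ?_
  filter_upwards [Ioo_mem_nhdsGT ht] with s hs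
  have : 0 ≤ ∫ r in s..t, (t - r) ^ (-(1/2) : ℝ) * b r ^ p := by
    apply intervalIntegral.integral_nonneg hs.2.le
    intro r hr
    exact mul_nonneg (Real.rpow_nonneg (by linarith [hr.2]) _)
      (Real.rpow_nonneg (hn r (hs.1.trans_le hr.1)) _)
  linarith

lemma contOn_rpow_neg (α : ℝ) : ContinuousOn (fun r : ℝ => r ^ α) (Ioi 0) :=
  fun x hx => (Real.continuousAt_rpow_const x α (Or.inl (ne_of_gt hx))).continuousWithinAt

lemma kern_bound {α : ℝ} (h0 : 0 ≤ α) (h1 : α < 1) {s t : ℝ} (hs : 0 < s) (hst : s < t) :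
    ∫ r in s..t, (t - r) ^ (-(1/2) : ℝ) * r ^ (-α) ≤ (2 / (1 - α) + 4) * t ^ (1/2 - α) := by
  have ht : 0 < t := hs.trans hst
  have e1 : (t/2) ^ (-(1/2):ℝ) ≤ 2 * t ^ (-(1/2):ℝ) := by
    rw [Real.div_rpow ht.le (by norm_num), div_eq_mul_inv, mul_comm,
      Real.rpow_neg (by norm_num : (0:ℝ) ≤ 2), inv_inv]
    apply mul_le_mul_of_nonneg_right _ (by positivity)
    calc (2:ℝ) ^ (1/2:ℝ) ≤ 2 ^ (1:ℝ) := Real.rpow_le_rpow_of_exponent_le (by norm_num) (by norm_num)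
      _ = 2 := by norm_num
  have e2 : (t/2) ^ (-α) ≤ 2 * t ^ (-α) := by
    rw [Real.div_rpow ht.le (by norm_num), div_eq_mul_inv, mul_comm,
      Real.rpow_neg (by norm_num : (0:ℝ) ≤ 2), inv_inv]
    apply mul_le_mul_of_nonneg_right _ (by positivity)
    calc (2:ℝ) ^ α ≤ 2 ^ (1:ℝ) := Real.rpow_le_rpow_of_exponent_le (by norm_num) h1.le
      _ = 2 := by norm_num
  have iα : IntervalIntegrable (fun r : ℝ => r ^ (-α)) volume s t :=
    intervalIntegral.intervalIntegrable_rpow' (by linarith)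
  have step : ∫ r in s..t, (t - r) ^ (-(1/2) : ℝ) * r ^ (-α) ≤
      ∫ r in s..t, (2 * t ^ (-(1/2):ℝ) * r ^ (-α) + 2 * t ^ (-α) * (t - r) ^ (-(1/2):ℝ)) := by
    apply intervalIntegral.integral_mono_on_of_le_Ioo hst.le
      (ii_kern_mul hs hst.le (contOn_rpow_neg _))
      ((iα.const_mul _).add ((ii_kern s t).const_mul _))
    intro r hr
    have hr0 : 0 < r := hs.trans hr.1
    have hr1 : 0 < t - r := by linarith [hr.2]
    have p1 : 0 ≤ r ^ (-α) := by positivity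
    have p2 : 0 ≤ (t - r) ^ (-(1/2):ℝ) := by positivity
    have p3 : 0 ≤ t ^ (-α) := by positivity
    have p4 : 0 ≤ t ^ (-(1/2):ℝ) := by positivity
    rcases le_total r (t/2) with h | h
    · have : (t - r) ^ (-(1/2):ℝ) ≤ (t/2) ^ (-(1/2):ℝ) :=
        Real.rpow_le_rpow_of_nonpos (by linarith) (by linarith) (by norm_num)
      have := mul_le_mul_of_nonneg_right (this.trans e1) p1
      nlinarith [mul_nonneg p3 p2]
    · have : r ^ (-α) ≤ (t/2) ^ (-α) :=
        Real.rpow_le_rpow_of_nonpos (by linarith) (by linarith) (by linarith)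
      have := mul_le_mul_of_nonneg_left (this.trans e2) p2
      nlinarith [mul_nonneg p4 p1]
  refine step.trans ?_
  rw [intervalIntegral.integral_add (iα.const_mul _) ((ii_kern s t).const_mul _),
    intervalIntegral.integral_const_mul, intervalIntegral.integral_const_mul, int_kern,
    integral_rpow (Or.inl (by linarith))]
  have g1 : t ^ (1/2 - α) = t ^ (-(1/2):ℝ) * t ^ (-α + 1) := by
    rw [← Real.rpow_add ht]; congr 1; ring
  have g2 : t ^ (1/2 - α) = t ^ (-α) * t ^ (1/2:ℝ) := by
    rw [← Real.rpow_add ht]; congr 1; ring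
  have g3 : (t ^ (-α + 1) - s ^ (-α + 1)) / (-α + 1) ≤ t ^ (-α+1) / (1 - α) := by
    rw [show -α + 1 = 1 - α by ring]
    have : 0 ≤ s ^ (1 - α) := by positivity
    apply div_le_div_of_nonneg_right _ (by linarith)
    linarith
  have g4 : (t - s) ^ (1/2:ℝ) ≤ t ^ (1/2:ℝ) :=
    Real.rpow_le_rpow (by linarith) (by linarith) (by norm_num)
  have k1 := mul_le_mul_of_nonneg_left g3 (show 0 ≤ 2 * t ^ (-(1/2):ℝ) by positivity)
  have k2 := mul_le_mul_of_nonneg_left g4 (show 0 ≤ 4 * t ^ (-α) by positivity)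
  have k3 : (2 / (1 - α) + 4) * t ^ (1/2 - α) =
      2 * t ^ (-(1/2):ℝ) * (t ^ (-α+1) / (1 - α)) + 4 * t ^ (-α) * t ^ (1/2:ℝ) := by
    rw [add_mul]; nth_rewrite 1 [g1]; rw [g2]; ring
  rw [k3]
  linarith

/-- Strict monotonicity in the mass. -/
lemma vsol_mono {p : ℝ} (hp1 : 1 ≤ p) (hp2 : p < 2) {b1 b2 : ℝ → ℝ} {ℓ1 ℓ2 : ℝ}
    (hV1 : VProp p b1 (fun _ => ℓ1)) (hV2 : VProp p b2 (fun _ => ℓ2)) (hl1 : 0 < ℓ1) (hl : ℓ1 < ℓ2)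
    (hc1 : ContinuousOn b1 (Ioi 0)) (hc2 : ContinuousOn b2 (Ioi 0))
    (hn1 : ∀ t, 0 < t → 0 ≤ b1 t) (hn2 : ∀ t, 0 < t → 0 ≤ b2 t) :
    ∀ t, 0 < t → b1 t < b2 t := by
  set α := p / 2 with hα
  set C := ℓ2 ^ p * (2 / (1 - α) + 4) with hC
  have hα1 : α < 1 := by linarith
  have hl2 : 0 < ℓ2 := hl1.trans hl
  have hC0 : 0 < C := by
    have : 0 < 1 - α := by linarith
    positivity
  set τ := ((ℓ2 - ℓ1) / C) ^ (1 / (1 - α)) with hτ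
  have hd : 0 < (ℓ2 - ℓ1) / C := div_pos (by linarith) hC0
  have hτ0 : 0 < τ := by positivity
  refine comparison hp1 hV1 hV2 hc1 hc2 hn1 hτ0 ?_
  intro t ht htτ
  have hsmall : C * t ^ (1 - α) < ℓ2 - ℓ1 := by
    have : t ^ (1 - α) < τ ^ (1 - α) := Real.rpow_lt_rpow ht.le htτ (by linarith)
    rw [hτ, ← Real.rpow_mul hd.le, one_div, inv_mul_cancel₀ (by linarith), Real.rpow_one,
      lt_div_iff₀ hC0] at this
    linarith
  have T := (hV2 t ht).sub (hV1 t ht)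
  have low : (ℓ2 - ℓ1) * t ^ (-(1/2):ℝ) - C * t ^ (1/2 - α) ≤ √π * b2 t - √π * b1 t := by
    refine ge_of_tendsto T ?_
    filter_upwards [Ioo_mem_nhdsGT ht] with s hs
    have hcp2 : ContinuousOn (fun r => b2 r ^ p) (Ioi 0) :=
      hc2.rpow_const (fun x _ => Or.inr (by linarith))
    have n1 : 0 ≤ ∫ r in s..t, (t - r) ^ (-(1/2) : ℝ) * b1 r ^ p := by
      apply intervalIntegral.integral_nonneg hs.2.le
      intro r hr
      exact mul_nonneg (Real.rpow_nonneg (by linarith [hr.2]) _)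
        (Real.rpow_nonneg (hn1 r (hs.1.trans_le hr.1)) _)
    have n2 : ∫ r in s..t, (t - r) ^ (-(1/2) : ℝ) * b2 r ^ p ≤
        ∫ r in s..t, ℓ2 ^ p * ((t - r) ^ (-(1/2) : ℝ) * r ^ (-α)) := by
      apply intervalIntegral.integral_mono_on_of_le_Ioo hs.2.le (ii_kern_mul hs.1 hs.2.le hcp2)
        ((ii_kern_mul hs.1 hs.2.le (contOn_rpow_neg _)).const_mul _)
      intro r hr
      have hr0 : 0 < r := hs.1.trans hr.1
      have h1 := vprop_upper hV2 hn2 hr0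
      have h2 : 1 ≤ √π := by
        rw [Real.one_le_sqrt]; linarith [Real.pi_gt_three]
      have h3 : b2 r ≤ ℓ2 * r ^ (-(1/2):ℝ) := by nlinarith [hn2 r hr0]
      have h4 : b2 r ^ p ≤ ℓ2 ^ p * r ^ (-α) := by
        calc b2 r ^ p ≤ (ℓ2 * r ^ (-(1/2):ℝ)) ^ p := Real.rpow_le_rpow (hn2 r hr0) h3 (by linarith)
          _ = _ := by
            rw [Real.mul_rpow hl2.le (by positivity), ← Real.rpow_mul hr0.le]
            congr 2; rw [hα]; ring
      have := mul_le_mul_of_nonneg_left h4 (Real.rpow_nonneg (show 0 ≤ t - r by linarith [hr.2]) (-(1/2):ℝ))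
      linarith
    rw [intervalIntegral.integral_const_mul] at n2
    have n3 := mul_le_mul_of_nonneg_left (kern_bound (by linarith) hα1 hs.1 hs.2) (show 0 ≤ ℓ2 ^ p by positivity)
    have n4 : C * t ^ (1/2 - α) = ℓ2 ^ p * ((2 / (1 - α) + 4) * t ^ (1/2 - α)) := by rw [hC]; ring
    rw [n4]
    linarith
  have g1 : t ^ (1/2 - α) = t ^ (-(1/2):ℝ) * t ^ (1 - α) := by
    rw [← Real.rpow_add ht]; congr 1; ring
  rw [g1] at low
  have hpos : 0 < t ^ (-(1/2):ℝ) := by positivity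
  have : 0 < √π * (b2 t - b1 t) := by nlinarith
  have := (mul_pos_iff_of_pos_left (show 0 < √π by positivity)).mp this
  linarith

lemma vsol_scale {p a : ℝ} (ha : a * p = a + 1/2) {b : ℝ → ℝ} {ℓ lam : ℝ}
    (hlam : 0 < lam) (hn : ∀ t, 0 < t → 0 ≤ b t) (hV : VProp p b (fun _ => ℓ)) :
    VProp p (fun t => lam ^ a * b (lam * t)) (fun _ => lam ^ (a - 1/2) * ℓ) := by
  intro t ht
  have hm : Tendsto (fun s : ℝ => lam * s) (𝓝[>] 0) (𝓝[>] 0) := by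
    apply tendsto_nhdsWithin_of_tendsto_nhds_of_eventually_within
    · have : Tendsto (fun s : ℝ => lam * s) (𝓝 0) (𝓝 (lam * 0)) := tendsto_id.const_mul lam
      rw [mul_zero] at this
      exact this.mono_left nhdsWithin_le_nhds
    · filter_upwards [self_mem_nhdsWithin] with s hs
      exact mul_pos hlam hs
  have T := ((hV (lam * t) (by positivity)).comp hm).const_mul (lam ^ a)
  have e : √π * (lam ^ a * b (lam * t)) = lam ^ a * (√π * b (lam * t)) := by ring
  rw [e]
  refine T.congr' ?_
  filter_upwards [Ioo_mem_nhdsGT ht] with s hs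
  simp only [Function.comp]
  have h1 : ∫ r in s..t, (t - r) ^ (-(1/2) : ℝ) * (lam ^ a * b (lam * r)) ^ p =
      lam ^ a * ∫ r in (lam * s)..(lam * t), (lam * t - r) ^ (-(1/2) : ℝ) * b r ^ p := by
    have := intervalIntegral.smul_integral_comp_mul_left
      (fun r => (lam * t - r) ^ (-(1/2) : ℝ) * b r ^ p) lam (a := s) (b := t)
    rw [← this, smul_eq_mul, ← mul_assoc, ← intervalIntegral.integral_const_mul]
    apply intervalIntegral.integral_congr
    intro r hr
    rw [uIcc_of_le hs.2.le] at hr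
    have hr0 : 0 < r := hs.1.trans_le hr.1
    simp only
    rw [Real.mul_rpow (by positivity) (hn _ (by positivity)), ← Real.rpow_mul hlam.le, ha,
      ← mul_sub, Real.mul_rpow hlam.le (by linarith [hr.2])]
    have : lam ^ (a + 1/2) = lam ^ a * lam * lam ^ (-(1/2):ℝ) := by
      nth_rewrite 3 [← Real.rpow_one lam]
      rw [← Real.rpow_add hlam, ← Real.rpow_add hlam]; congr 1; ring
    rw [this]; ring
  rw [h1, Real.mul_rpow hlam.le ht.le, Real.rpow_sub hlam, Real.rpow_neg hlam.le]
  ring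


/-- Renormalised representation on the half-line. -/
def RepP (p : ℝ) (u : ℝ → ℝ → ℝ) (L : ℝ → ℝ) : Prop := ∀ t x : ℝ, 0 < t → 0 ≤ x →
  Tendsto (fun s => L s * EE t x - ∫ r in s..t, EE (t - r) x * (u r 0) ^ p) (𝓝[>] 0) (𝓝 (u t x))

lemma EE_zero (t : ℝ) : EE t 0 = (√π)⁻¹ * t ^ (-(1/2):ℝ) := by simp [EE]

lemma RepP.vprop {p : ℝ} {u : ℝ → ℝ → ℝ} {L : ℝ → ℝ} (h : RepP p u L) :
    VProp p (fun t => u t 0) L := by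
  intro t ht
  have T := (h t 0 ht le_rfl).const_mul √π
  refine T.congr ?_
  intro s
  have hpi : √π ≠ 0 := by positivity
  have : ∫ r in s..t, EE (t - r) 0 * (u r 0) ^ p =
      (√π)⁻¹ * ∫ r in s..t, (t - r) ^ (-(1/2):ℝ) * (u r 0) ^ p := by
    rw [← intervalIntegral.integral_const_mul]
    congr 1; ext r; rw [EE_zero]; ring
  rw [this, EE_zero]
  field_simp

lemma adm_int {κ : ℝ → ℝ} {T C δ q : ℝ} (hT : 0 ≤ T) (hδ : 0 < δ) (hq0 : 0 ≤ q) (hq : q < 2)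
    (hκ : IntervalIntegrable κ volume 0 T)
    (hb : ∀ r, 0 < r → r < δ → |κ r| ≤ C * r) :
    IntervalIntegrable (fun r => κ r * r ^ (-q)) volume 0 T := by
  rw [intervalIntegrable_iff_integrableOn_Ioc_of_le hT] at hκ ⊢
  have hg : IntervalIntegrable (fun r : ℝ => |C| * r ^ (1 - q) + δ ^ (-q) * |κ r|) volume 0 T := by
    apply IntervalIntegrable.add
    · exact (intervalIntegral.intervalIntegrable_rpow' (by linarith)).const_mul _
    · apply IntervalIntegrable.const_mul
      rw [intervalIntegrable_iff_integrableOn_Ioc_of_le hT]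
      exact hκ.abs
  rw [intervalIntegrable_iff_integrableOn_Ioc_of_le hT] at hg
  refine Integrable.mono' hg ?_ ?_
  · apply hκ.aestronglyMeasurable.mul
    exact (Measurable.pow_const measurable_id (-q)).aestronglyMeasurable
  · rw [ae_restrict_iff' measurableSet_Ioc]
    refine ae_of_all _ ?_
    intro r hr
    have hr0 : 0 < r := hr.1
    have p1 : 0 ≤ r ^ (-q) := by positivity
    have p2 : 0 ≤ |C| * r ^ (1 - q) := by positivity
    have p3 : 0 ≤ δ ^ (-q) * |κ r| := by positivity
    rw [Real.norm_eq_abs, abs_mul, abs_of_nonneg p1]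
    rcases lt_or_ge r δ with h | h
    · have h1 := hb r hr0 h
      have h2 : C * r ≤ |C| * r := mul_le_mul_of_nonneg_right (le_abs_self C) hr0.le
      have h3 := mul_le_mul_of_nonneg_right (h1.trans h2) p1
      have h4 : |C| * r * r ^ (-q) = |C| * r ^ (1 - q) := by
        rw [show 1 - q = 1 + -q by ring, Real.rpow_add hr0, Real.rpow_one]; ring
      linarith
    · have h1 : r ^ (-q) ≤ δ ^ (-q) := Real.rpow_le_rpow_of_nonpos hδ h (by linarith)
      have := mul_le_mul_of_nonneg_left h1 (abs_nonneg (κ r))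
      linarith

section
variable {κ : ℝ → ℝ} {T p a c : ℝ}

lemma adm_dom {b : ℝ → ℝ} (hp : 0 ≤ p) (hc : 0 ≤ c)
    (hn : ∀ t, 0 < t → 0 ≤ b t) (hle : ∀ t, 0 < t → b t ≤ c * t ^ (-a)) {r : ℝ} (hr : 0 < r) :
    ‖κ r * b r ^ p‖ ≤ c ^ p * ‖κ r * r ^ (-(a * p))‖ := by
  rw [norm_mul, norm_mul, Real.norm_of_nonneg (Real.rpow_nonneg (hn r hr) p),
    Real.norm_of_nonneg (Real.rpow_nonneg hr.le _)]
  have : b r ^ p ≤ c ^ p * r ^ (-(a * p)) := by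
    calc b r ^ p ≤ (c * r ^ (-a)) ^ p := Real.rpow_le_rpow (hn r hr) (hle r hr) hp
      _ = _ := by
        rw [Real.mul_rpow hc (by positivity), ← Real.rpow_mul hr.le]; congr 2; ring
  have := mul_le_mul_of_nonneg_left this (norm_nonneg (κ r))
  linarith

lemma adm_ii {b : ℝ → ℝ} (hT : 0 ≤ T) (hp : 0 ≤ p) (hc : 0 ≤ c)
    (hκ0 : IntervalIntegrable κ volume 0 T)
    (hκ : IntervalIntegrable (fun r => κ r * r ^ (-(a * p))) volume 0 T)
    (hcb : ContinuousOn b (Ioi 0))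
    (hn : ∀ t, 0 < t → 0 ≤ b t) (hle : ∀ t, 0 < t → b t ≤ c * t ^ (-a)) :
    IntervalIntegrable (fun r => κ r * b r ^ p) volume 0 T := by
  have hg := hκ.norm.const_mul (c ^ p)
  rw [intervalIntegrable_iff_integrableOn_Ioc_of_le hT] at hg hκ0 ⊢
  refine Integrable.mono' hg ?_ ?_
  · apply hκ0.aestronglyMeasurable.mul
    have : ContinuousOn (fun r => b r ^ p) (Ioc 0 T) :=
      (hcb.rpow_const (fun x _ => Or.inr hp)).mono (fun x hx => hx.1)
    exact this.aestronglyMeasurable measurableSet_Ioc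
  · rw [ae_restrict_iff' measurableSet_Ioc]
    exact ae_of_all _ (fun r hr => adm_dom hp hc hn hle hr.1)

lemma adm_tendsto {f : ℝ → ℝ} (hT : 0 < T) (hf : IntervalIntegrable f volume 0 T) :
    Tendsto (fun s => ∫ r in s..T, f r) (𝓝[>] 0) (𝓝 (∫ r in (0:ℝ)..T, f r)) := by
  have h1 : IntegrableOn f (uIcc 0 T) := by
    rw [uIcc_of_le hT.le, integrableOn_Icc_iff_integrableOn_Ioc,
      ← intervalIntegrable_iff_integrableOn_Ioc_of_le hT.le]
    exact hf
  have h2 := intervalIntegral.continuousOn_primitive_interval_left h1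
  have h3 := (h2 0 left_mem_uIcc).tendsto
  refine h3.mono_left ?_
  rw [uIcc_of_le hT.le]
  rw [← nhdsWithin_Ioo_eq_nhdsGT hT]
  exact nhdsWithin_mono _ Ioo_subset_Icc_self

lemma adm_dct {b : ℝ → ℝ → ℝ} {β : ℝ → ℝ} (hT : 0 ≤ T) (hp : 0 ≤ p) (hc : 0 ≤ c)
    (hκ0 : IntervalIntegrable κ volume 0 T)
    (hκ : IntervalIntegrable (fun r => κ r * r ^ (-(a * p))) volume 0 T)
    (hcb : ∀ ℓ, 0 < ℓ → ContinuousOn (b ℓ) (Ioi 0))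
    (hn : ∀ ℓ, 0 < ℓ → ∀ t, 0 < t → 0 ≤ b ℓ t)
    (hle : ∀ ℓ, 0 < ℓ → ∀ t, 0 < t → b ℓ t ≤ c * t ^ (-a))
    (hlim : ∀ t, 0 < t → Tendsto (fun ℓ => b ℓ t) atTop (𝓝 (β t))) :
    Tendsto (fun ℓ => ∫ r in (0:ℝ)..T, κ r * b ℓ r ^ p) atTop
      (𝓝 (∫ r in (0:ℝ)..T, κ r * β r ^ p)) := by
  apply intervalIntegral.tendsto_integral_filter_of_dominated_convergence
    (fun r => c ^ p * ‖κ r * r ^ (-(a * p))‖)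
  · filter_upwards [eventually_gt_atTop 0] with ℓ hℓ
    have := adm_ii hT hp hc hκ0 hκ (hcb ℓ hℓ) (hn ℓ hℓ) (hle ℓ hℓ)
    exact this.def'.aestronglyMeasurable
  · filter_upwards [eventually_gt_atTop 0] with ℓ hℓ
    refine ae_of_all _ ?_
    intro r hr
    rw [uIoc_of_le hT] at hr
    exact adm_dom hp hc (hn ℓ hℓ) (hle ℓ hℓ) hr.1
  · exact hκ.norm.const_mul (c ^ p)
  · refine ae_of_all _ ?_
    intro r hr
    rw [uIoc_of_le hT] at hr
    exact ((hlim r hr.1).rpow_const (Or.inr hp)).const_mul _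
end

/-- difference kernel at `x = 0` between the times `1` and `4` -/
noncomputable def kap (r : ℝ) : ℝ :=
  2 * (4 - r) ^ (-(1/2):ℝ) - (if r < 1 then (1 - r) ^ (-(1/2):ℝ) else 0)

lemma ii_kern' (s t T : ℝ) : IntervalIntegrable (fun r => (t - r) ^ (-(1/2) : ℝ)) volume s T := by
  have h := (intervalIntegral.intervalIntegrable_rpow' (a := t - s) (b := t - T) (r := -(1/2))
    (by norm_num)).comp_sub_left t
  simpa using h

lemma ite_ii : IntervalIntegrable (fun r : ℝ => if r < 1 then (1 - r) ^ (-(1/2):ℝ) else 0)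
    volume 0 4 := by
  have : (fun r : ℝ => if r < 1 then (1 - r) ^ (-(1/2):ℝ) else 0) =
      indicator (Iio 1) (fun r => (1 - r) ^ (-(1/2):ℝ)) := by
    ext r; simp [indicator]
  rw [this, intervalIntegrable_iff_integrableOn_Ioc_of_le (by norm_num)]
  apply IntegrableOn.indicator _ measurableSet_Iio
  rw [← intervalIntegrable_iff_integrableOn_Ioc_of_le (by norm_num)]
  exact ii_kern' 0 1 4

lemma kap_ii : IntervalIntegrable kap volume 0 4 :=
  ((ii_kern' 0 4 4).const_mul 2).sub ite_ii

lemma inv_sqrt_bd {y : ℝ} (h0 : 0 ≤ y) (h1 : y ≤ 1/2) :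
    1 ≤ (1 - y) ^ (-(1/2):ℝ) ∧ (1 - y) ^ (-(1/2):ℝ) ≤ 1 + 2 * y := by
  have hy : 0 < 1 - y := by linarith
  constructor
  · exact Real.one_le_rpow_of_pos_of_le_one_of_nonpos hy (by linarith) (by norm_num)
  · calc (1 - y) ^ (-(1/2):ℝ) ≤ (1 - y) ^ (-1:ℝ) :=
        Real.rpow_le_rpow_of_exponent_ge hy (by linarith) (by norm_num)
      _ = (1 - y)⁻¹ := Real.rpow_neg_one _
      _ ≤ 1 + 2 * y := by
        rw [inv_le_iff_one_le_mul₀ hy]; nlinarith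

lemma kap_bd : ∀ r, 0 < r → r < (1/2:ℝ) → |kap r| ≤ 4 * r := by
  intro r h0 h1
  have hr1 : r < 1 := by linarith
  simp only [kap, hr1, if_true]
  have a1 := inv_sqrt_bd h0.le h1.le
  have a2 := inv_sqrt_bd (y := r / 4) (by linarith) (by linarith)
  have e : 2 * (4 - r) ^ (-(1/2):ℝ) = (1 - r/4) ^ (-(1/2):ℝ) := by
    rw [show 4 - r = 4 * (1 - r/4) by ring, Real.mul_rpow (by norm_num) (by linarith)]
    have : (4:ℝ) ^ (-(1/2):ℝ) = 1/2 := by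
      rw [show (4:ℝ) = 2 ^ (2:ℝ) by norm_num, ← Real.rpow_mul (by norm_num)]
      norm_num
    rw [this]; ring
  rw [e, abs_le]
  constructor <;> linarith [a1.1, a1.2, a2.1, a2.2]

lemma four_half : (4:ℝ) ^ (1/2:ℝ) = 2 := by
  rw [show (4:ℝ) = 2 ^ (2:ℝ) by norm_num, ← Real.rpow_mul (by norm_num)]; norm_num

lemma kap_identity {p a c : ℝ} (hp : 0 ≤ p) (hc : 0 ≤ c) (ha : 0 ≤ a * p) (ha2 : a * p < 2)
    {b L : ℝ → ℝ} (hV : VProp p b L)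
    (hcb : ContinuousOn b (Ioi 0))
    (hn : ∀ t, 0 < t → 0 ≤ b t) (hle : ∀ t, 0 < t → b t ≤ c * t ^ (-a)) :
    √π * (b 1 - 2 * b 4) = ∫ r in (0:ℝ)..4, kap r * b r ^ p := by
  have hk := adm_int (by norm_num) (by norm_num) ha ha2 kap_ii kap_bd
  have hi := adm_ii (by norm_num) hp hc kap_ii hk hcb hn hle
  have T1 := adm_tendsto (by norm_num) hi
  have T2 := (hV 1 one_pos).sub ((hV 4 (by norm_num)).const_mul 2)
  have hcp : ContinuousOn (fun r => b r ^ p) (Ioi 0) := hcb.rpow_const (fun x _ => Or.inr hp)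
  have key : ∀ᶠ s in 𝓝[>] (0:ℝ), (L s * 1 ^ (-(1/2) : ℝ) - ∫ r in s..1, (1 - r) ^ (-(1/2) : ℝ) * b r ^ p)
      - 2 * (L s * 4 ^ (-(1/2) : ℝ) - ∫ r in s..4, (4 - r) ^ (-(1/2) : ℝ) * b r ^ p)
      = ∫ r in s..4, kap r * b r ^ p := by
    filter_upwards [Ioo_mem_nhdsGT one_pos] with s hs
    have i4 := ii_kern_mul hs.1 (show s ≤ 4 by linarith [hs.2]) hcp
    have i1 := ii_kern_mul hs.1 hs.2.le hcp
    have j1 : IntervalIntegrable (fun r => (if r < 1 then (1 - r) ^ (-(1/2):ℝ) else 0) * b r ^ p)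
        volume s 4 := by
      have : IntervalIntegrable (fun r : ℝ => if r < 1 then (1 - r) ^ (-(1/2):ℝ) else 0)
        volume s 4 := ite_ii.mono_set (by
          rw [uIcc_of_le (by linarith [hs.2]), uIcc_of_le (by norm_num)]
          exact Icc_subset_Icc hs.1.le le_rfl)
      apply this.mul_continuousOn
      apply hcp.mono
      rw [uIcc_of_le (by linarith [hs.2])]
      exact fun x hx => hs.1.trans_le hx.1
    have e1 : ∫ r in s..4, (if r < 1 then (1 - r) ^ (-(1/2):ℝ) else 0) * b r ^ p
        = ∫ r in s..1, (1 - r) ^ (-(1/2) : ℝ) * b r ^ p := by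
      have s1 : uIcc s 1 ⊆ uIcc s 4 := by
        rw [uIcc_of_le hs.2.le, uIcc_of_le (by linarith [hs.2])]
        exact Icc_subset_Icc le_rfl (by norm_num)
      have s2 : uIcc 1 4 ⊆ uIcc s 4 := by
        rw [uIcc_of_le (by norm_num), uIcc_of_le (by linarith [hs.2])]
        exact Icc_subset_Icc hs.2.le le_rfl
      rw [← intervalIntegral.integral_add_adjacent_intervals (j1.mono_set s1) (j1.mono_set s2)]
      have z : ∫ r in (1:ℝ)..4, (if r < 1 then (1 - r) ^ (-(1/2):ℝ) else 0) * b r ^ p = 0 := by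
        rw [intervalIntegral.integral_congr (g := fun _ => (0:ℝ))]
        · simp
        · intro r hr
          rw [uIcc_of_le (by norm_num)] at hr
          simp only
          rw [if_neg (not_lt.mpr hr.1), zero_mul]
      rw [z, add_zero]
      apply intervalIntegral.integral_congr_ae
      have : ∀ᵐ r : ℝ ∂volume, r ≠ 1 := by
        simp [ae_iff, measure_singleton]
      filter_upwards [this] with r hr1 hr
      rw [uIoc_of_le hs.2.le] at hr
      rw [if_pos (lt_of_le_of_ne hr.2 hr1)]
    have e2 : ∫ r in s..4, kap r * b r ^ p = 2 * (∫ r in s..4, (4 - r) ^ (-(1/2) : ℝ) * b r ^ p)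
        - ∫ r in s..4, (if r < 1 then (1 - r) ^ (-(1/2):ℝ) else 0) * b r ^ p := by
      rw [← intervalIntegral.integral_const_mul, ← intervalIntegral.integral_sub (i4.const_mul 2) j1]
      congr 1; ext r; rw [kap]; ring
    rw [e2, e1]
    have := half_mul_neg_half (show (0:ℝ) < 4 by norm_num)
    rw [four_half] at this
    rw [Real.one_rpow]
    linear_combination (- L s) * this
  have T3 := T2.congr' key
  have := tendsto_nhds_unique T3 T1
  linarith


section
variable {p a c : ℝ} {b : ℝ → ℝ → ℝ}

lemma bl_lt (hp : 1 ≤ p) (ha : 1/2 < a) (hc : 0 < c) {L f : ℝ → ℝ} {ℓ : ℝ} (hℓ : 0 < ℓ)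
    (hV : VProp p f (fun _ => ℓ)) (hcb : ContinuousOn f (Ioi 0)) (hn : ∀ t, 0 < t → 0 ≤ f t)
    (hB : VProp p (fun t => c * t ^ (-a)) L) : ∀ t, 0 < t → f t < c * t ^ (-a) := by
  have hpi : 0 < √π := by positivity
  refine comparison hp hV hB hcb ((contOn_rpow_neg (-a)).const_smul c) hn
    (τ := (c * √π / ℓ) ^ (1 / (a - 1/2))) (by positivity) ?_
  intro t ht htτ
  have h1 := vprop_upper hV hn ht
  have h2 : t ^ (a - 1/2) < c * √π / ℓ := by
    calc t ^ (a - 1/2) < ((c * √π / ℓ) ^ (1 / (a - 1/2))) ^ (a - 1/2) :=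
          Real.rpow_lt_rpow ht.le htτ (by linarith)
      _ = _ := by
        rw [← Real.rpow_mul (by positivity), one_div_mul_cancel (by linarith), Real.rpow_one]
  have h3 : ℓ * t ^ (a - 1/2) < c * √π := by
    rw [lt_div_iff₀ hℓ] at h2; linarith
  have h4 : t ^ (-(1/2):ℝ) = t ^ (a - 1/2) * t ^ (-a) := by
    rw [← Real.rpow_add ht]; congr 1; ring
  have h5 : 0 < t ^ (-a) := by positivity
  have h6 : √π * f t < √π * (c * t ^ (-a)) := by
    rw [h4] at h1
    nlinarith
  exact lt_of_mul_lt_mul_left h6 hpi.le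

lemma bl_lim (hp : 1 ≤ p) (hp2 : p < 2)
    (hV : ∀ ℓ, 0 < ℓ → VProp p (b ℓ) (fun _ => ℓ))
    (hcb : ∀ ℓ, 0 < ℓ → ContinuousOn (b ℓ) (Ioi 0))
    (hn : ∀ ℓ, 0 < ℓ → ∀ t, 0 < t → 0 ≤ b ℓ t)
    (hle : ∀ ℓ, 0 < ℓ → ∀ t, 0 < t → b ℓ t ≤ c * t ^ (-a)) :
    ∃ β : ℝ → ℝ, ∀ t, 0 < t → Tendsto (fun ℓ => b ℓ t) atTop (𝓝 (β t)) := by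
  refine ⟨fun t => ⨆ ℓ, b (max ℓ 1) t, ?_⟩
  intro t ht
  have hm : Monotone (fun ℓ => b (max ℓ 1) t) := by
    intro x y hxy
    have h1 : max x 1 ≤ max y 1 := max_le_max_right 1 hxy
    have hx : 0 < max x 1 := by positivity
    have hy : 0 < max y 1 := by positivity
    rcases h1.lt_or_eq with h | h
    · exact (vsol_mono hp hp2 (hV _ hx) (hV _ hy) hx h (hcb _ hx) (hcb _ hy) (hn _ hx) (hn _ hy) t ht).le
    · simp only [h]; exact le_rfl
  have hbd : BddAbove (range (fun ℓ => b (max ℓ 1) t)) := by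
    refine ⟨c * t ^ (-a), ?_⟩
    rintro _ ⟨x, rfl⟩
    exact hle _ (by positivity) t ht
  refine (tendsto_atTop_ciSup hm hbd).congr' ?_
  filter_upwards [eventually_ge_atTop 1] with x hx
  rw [max_eq_left hx]

lemma beta_scale (hp : 1 ≤ p) (hp2 : p < 2) (ha : a * p = a + 1/2)
    (hV : ∀ ℓ, 0 < ℓ → VProp p (b ℓ) (fun _ => ℓ))
    (hcb : ∀ ℓ, 0 < ℓ → ContinuousOn (b ℓ) (Ioi 0))
    (hn : ∀ ℓ, 0 < ℓ → ∀ t, 0 < t → 0 ≤ b ℓ t) {β : ℝ → ℝ}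
    (hlim : ∀ t, 0 < t → Tendsto (fun ℓ => b ℓ t) atTop (𝓝 (β t))) {lam : ℝ} (hlam : 0 < lam) :
    β lam = β 1 * lam ^ (-a) := by
  have T1 : Tendsto (fun ℓ => lam ^ a * b ℓ lam) atTop (𝓝 (lam ^ a * β lam)) :=
    (hlim lam hlam).const_mul _
  set m := lam ^ (a - 1/2) with hm
  have hm0 : 0 < m := by positivity
  have T2 : Tendsto (fun ℓ => b (m / 2 * ℓ) 1) atTop (𝓝 (β 1)) :=
    (hlim 1 one_pos).comp (tendsto_id.const_mul_atTop (by positivity))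
  have T3 : Tendsto (fun ℓ => b (m * 2 * ℓ) 1) atTop (𝓝 (β 1)) :=
    (hlim 1 one_pos).comp (tendsto_id.const_mul_atTop (by positivity))
  have hcs : ∀ ℓ, 0 < ℓ → ContinuousOn (fun t => lam ^ a * b ℓ (lam * t)) (Ioi 0) := by
    intro ℓ hℓ
    refine ContinuousOn.mul continuousOn_const ((hcb ℓ hℓ).comp (by fun_prop) ?_)
    intro t ht; exact mul_pos hlam ht
  have hns : ∀ ℓ, 0 < ℓ → ∀ t, 0 < t → 0 ≤ lam ^ a * b ℓ (lam * t) := by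
    intro ℓ hℓ t ht
    exact mul_nonneg (by positivity) (hn ℓ hℓ _ (mul_pos hlam ht))
  have T4 : Tendsto (fun ℓ => lam ^ a * b ℓ lam) atTop (𝓝 (β 1)) := by
    refine tendsto_of_tendsto_of_tendsto_of_le_of_le' T2 T3 ?_ ?_
    · filter_upwards [eventually_gt_atTop 0] with ℓ hℓ
      have h := mul_pos hm0 hℓ
      have := vsol_mono hp hp2 (hV (m / 2 * ℓ) (by positivity)) (vsol_scale ha hlam (hn ℓ hℓ) (hV ℓ hℓ))
        (by positivity) (by linarith) (hcb _ (by positivity)) (hcs ℓ hℓ) (hn _ (by positivity))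
        (hns ℓ hℓ) 1 one_pos
      simpa using this.le
    · filter_upwards [eventually_gt_atTop 0] with ℓ hℓ
      have h := mul_pos hm0 hℓ
      have := vsol_mono hp hp2 (vsol_scale ha hlam (hn ℓ hℓ) (hV ℓ hℓ)) (hV (m * 2 * ℓ) (by positivity))
        (by positivity) (by linarith) (hcs ℓ hℓ) (hcb _ (by positivity)) (hns ℓ hℓ)
        (hn _ (by positivity)) 1 one_pos
      simpa using this.le
  have := tendsto_nhds_unique T1 T4
  rw [← this, Real.rpow_neg hlam.le]
  field_simp

lemma beta_eq (hp : 1 < p) (hp2 : p < 2) (ha : a * p = a + 1/2) (ha1 : 1/2 < a) (ha2 : a < 1)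
    (hc : 0 < c) {L : ℝ → ℝ}
    (hV : ∀ ℓ, 0 < ℓ → VProp p (b ℓ) (fun _ => ℓ))
    (hcb : ∀ ℓ, 0 < ℓ → ContinuousOn (b ℓ) (Ioi 0))
    (hn : ∀ ℓ, 0 < ℓ → ∀ t, 0 < t → 0 ≤ b ℓ t)
    (hB : VProp p (fun t => c * t ^ (-a)) L) :
    (∀ ℓ, 0 < ℓ → ∀ t, 0 < t → b ℓ t ≤ c * t ^ (-a)) ∧
    ∀ t, 0 < t → Tendsto (fun ℓ => b ℓ t) atTop (𝓝 (c * t ^ (-a))) := by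
  have hle : ∀ ℓ, 0 < ℓ → ∀ t, 0 < t → b ℓ t ≤ c * t ^ (-a) := fun ℓ hℓ t ht =>
    (bl_lt hp.le ha1 hc hℓ (hV ℓ hℓ) (hcb ℓ hℓ) (hn ℓ hℓ) hB t ht).le
  refine ⟨hle, ?_⟩
  obtain ⟨β, hlim⟩ := bl_lim hp.le hp2 hV hcb hn hle
  have hs : ∀ t, 0 < t → β t = β 1 * t ^ (-a) := fun t ht =>
    beta_scale hp.le hp2 ha hV hcb hn hlim ht
  set d := β 1 with hd
  have hd0 : 0 < d := by
    have h1 : b 2 1 ≤ d := by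
      refine ge_of_tendsto (hlim 1 one_pos) ?_
      filter_upwards [eventually_gt_atTop 2] with ℓ hℓ
      exact (vsol_mono hp.le hp2 (hV 2 two_pos) (hV ℓ (by linarith)) two_pos hℓ (hcb _ two_pos)
        (hcb _ (by linarith)) (hn _ two_pos) (hn _ (by linarith)) 1 one_pos).le
    have h2 := vsol_mono hp.le hp2 (hV 1 one_pos) (hV 2 two_pos) one_pos one_lt_two (hcb _ one_pos)
        (hcb _ two_pos) (hn _ one_pos) (hn _ two_pos) 1 one_pos
    linarith [hn 1 one_pos 1 one_pos]
  have hp0 : 0 ≤ p := by linarith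
  have hap0 : 0 ≤ a * p := by rw [ha]; linarith
  have hap2 : a * p < 2 := by rw [ha]; linarith
  have hk := adm_int (by norm_num) (by norm_num) hap0 hap2 kap_ii kap_bd
  have T1 := adm_dct (by norm_num) hp0 hc.le kap_ii hk hcb hn hle hlim
  have T2 : Tendsto (fun ℓ => √π * (b ℓ 1 - 2 * b ℓ 4)) atTop (𝓝 (√π * (β 1 - 2 * β 4))) :=
    ((hlim 1 one_pos).sub ((hlim 4 (by norm_num)).const_mul 2)).const_mul _
  have T3 : Tendsto (fun ℓ => √π * (b ℓ 1 - 2 * b ℓ 4)) atTop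
      (𝓝 (∫ r in (0:ℝ)..4, kap r * β r ^ p)) := by
    refine T1.congr' ?_
    filter_upwards [eventually_gt_atTop 0] with ℓ hℓ
    exact (kap_identity hp0 hc.le hap0 hap2 (hV ℓ hℓ) (hcb ℓ hℓ) (hn ℓ hℓ) (hle ℓ hℓ)).symm
  have E1 := tendsto_nhds_unique T2 T3
  have E2 := kap_identity hp0 hc.le hap0 hap2 hB ((contOn_rpow_neg (-a)).const_smul c)
    (fun t ht => by positivity) (fun t ht => le_rfl)
  have gen : ∀ e : ℝ, 0 < e → ∫ r in (0:ℝ)..4, kap r * (e * r ^ (-a)) ^ p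
      = e ^ p * ∫ r in (0:ℝ)..4, kap r * r ^ (-(a * p)) := by
    intro e he
    rw [← intervalIntegral.integral_const_mul]
    apply intervalIntegral.integral_congr
    intro r hr
    rw [uIcc_of_le (by norm_num)] at hr
    simp only
    rw [Real.mul_rpow he.le (Real.rpow_nonneg hr.1 _), ← Real.rpow_mul hr.1]
    rw [show -a * p = -(a * p) by ring]; ring
  have E1' : ∫ r in (0:ℝ)..4, kap r * β r ^ p = d ^ p * ∫ r in (0:ℝ)..4, kap r * r ^ (-(a * p)) := by
    rw [← gen d hd0]
    apply intervalIntegral.integral_congr_ae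
    refine ae_of_all _ ?_
    intro r hr
    rw [uIoc_of_le (by norm_num)] at hr
    rw [hs r hr.1]
  rw [E1', hs 4 (by norm_num)] at E1
  rw [gen c hc, Real.one_rpow] at E2
  set J := ∫ r in (0:ℝ)..4, kap r * r ^ (-(a * p))
  set q := √π * (1 - 2 * 4 ^ (-a)) with hq
  have hq0 : 0 < q := by
    have : (4:ℝ) ^ (-a) < 4 ^ (-(1/2):ℝ) := Real.rpow_lt_rpow_of_exponent_lt (by norm_num) (by linarith)
    have h2 := half_mul_neg_half (show (0:ℝ) < 4 by norm_num)
    rw [four_half] at h2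
    have : 0 < 1 - 2 * (4:ℝ) ^ (-a) := by linarith
    positivity
  have F1 : d * q = d ^ p * J := by rw [← E1, hq]; ring
  have F2 : c * q = c ^ p * J := by rw [← E2, hq]; ring
  have g : ∀ e : ℝ, 0 < e → e * q = e ^ p * J → q = e ^ (p - 1) * J := by
    intro e he h
    have : e ^ p = e * e ^ (p - 1) := by
      rw [← Real.rpow_one_add' he.le (by linarith)]; congr 1; ring
    rw [this] at h
    apply mul_left_cancel₀ he.ne'
    linarith
  have G1 := g d hd0 F1
  have G2 := g c hc F2
  have hJ : 0 < J := by
    by_contra h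
    push Not at h
    have : c ^ (p-1) * J ≤ 0 := mul_nonpos_of_nonneg_of_nonpos (by positivity) h
    linarith
  have H : d ^ (p - 1) = c ^ (p - 1) := by
    apply mul_right_cancel₀ hJ.ne'; linarith
  have hdc : d = c := (Real.rpow_left_inj hd0.le hc.le (by linarith)).1 H
  intro t ht
  have := hlim t ht
  rwa [hs t ht, hdc] at this
end

lemma EE_factor (t x : ℝ) : EE t x = EE t 0 * Real.exp (-x ^ 2 / (4 * t)) := by
  rw [EE_zero, EE]

/-- renormalised kernel -/
noncomputable def GG (t x r : ℝ) : ℝ := Real.exp (-x ^ 2 / (4 * t)) * EE (t - r) 0 - EE (t - r) x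

lemma EE_meas (x : ℝ) : Measurable (fun r => EE r x) := by
  unfold EE; fun_prop

lemma EE_ii (t x : ℝ) {T : ℝ} (hT : 0 ≤ T) (hTt : T ≤ t) :
    IntervalIntegrable (fun r => EE (t - r) x) volume 0 T := by
  have h := (ii_kern' 0 t T).const_mul (√π)⁻¹
  rw [intervalIntegrable_iff_integrableOn_Ioc_of_le hT] at h ⊢
  refine Integrable.mono' h ((EE_meas x).comp (measurable_const.sub measurable_id)).aestronglyMeasurable ?_
  rw [ae_restrict_iff' measurableSet_Ioc]
  refine ae_of_all _ ?_
  intro r hr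
  have hr' : 0 ≤ t - r := by linarith [hr.2]
  have : 0 ≤ EE (t - r) x := by unfold EE; positivity
  rw [Real.norm_of_nonneg this]
  unfold EE
  apply mul_le_of_le_one_right (by positivity)
  rw [Real.exp_le_one_iff]
  apply div_nonpos_of_nonpos_of_nonneg <;> nlinarith [sq_nonneg x]

lemma GG_ii {t : ℝ} (ht : 0 < t) (x : ℝ) : IntervalIntegrable (GG t x) volume 0 t :=
  ((EE_ii t 0 ht.le le_rfl).const_mul _).sub (EE_ii t x ht.le le_rfl)

lemma GG_bd {t : ℝ} (ht : 0 < t) (x : ℝ) :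
    ∃ C, ∀ r, 0 < r → r < t / 2 → |GG t x r| ≤ C * r := by
  refine ⟨(√π)⁻¹ * (t/2) ^ (-(1/2):ℝ) * (x ^ 2 / (2 * t ^ 2)), ?_⟩
  intro r h0 h1
  have htr : t / 2 < t - r := by linarith
  have e : GG t x r = (√π)⁻¹ * (t - r) ^ (-(1/2):ℝ) *
      (Real.exp (-x ^ 2 / (4 * t)) - Real.exp (-x ^ 2 / (4 * (t - r)))) := by
    unfold GG; rw [EE_zero, EE]; ring
  have hle : -x ^ 2 / (4 * (t - r)) ≤ -x ^ 2 / (4 * t) := by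
    rw [div_le_div_iff₀ (by linarith) (by linarith)]; nlinarith [sq_nonneg x, mul_nonneg (sq_nonneg x) h0.le]
  have h2 : 0 ≤ Real.exp (-x ^ 2 / (4 * t)) - Real.exp (-x ^ 2 / (4 * (t - r))) := by
    linarith [Real.exp_le_exp.2 hle]
  have h3 : Real.exp (-x ^ 2 / (4 * t)) - Real.exp (-x ^ 2 / (4 * (t - r))) ≤ x ^ 2 / (2 * t ^ 2) * r := by
    set A := -x ^ 2 / (4 * t) with hA
    set B := -x ^ 2 / (4 * (t - r)) with hB
    have hA0 : A ≤ 0 := by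
      apply div_nonpos_of_nonpos_of_nonneg <;> nlinarith [sq_nonneg x]
    have i1 := Real.add_one_le_exp (B - A)
    have i2 : Real.exp B = Real.exp A * Real.exp (B - A) := by rw [← Real.exp_add]; congr 1; ring
    have i3 : Real.exp A ≤ 1 := Real.exp_le_one_iff.2 hA0
    have i4 : A - B ≤ x ^ 2 / (2 * t ^ 2) * r := by
      have : A - B = x ^ 2 * r / (4 * t * (t - r)) := by
        rw [hA, hB]; have : t - r ≠ 0 := by linarith
        field_simp; ring
      rw [this, div_mul_eq_mul_div]
      apply div_le_div_of_nonneg_left (by positivity) (by positivity)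
      nlinarith
    have i5 : Real.exp A - Real.exp B ≤ Real.exp A * (A - B) := by
      rw [i2]; nlinarith [Real.exp_pos A]
    have i6 : Real.exp A * (A - B) ≤ 1 * (A - B) := mul_le_mul_of_nonneg_right i3 (by linarith)
    linarith
  have h4 : (t - r) ^ (-(1/2):ℝ) ≤ (t / 2) ^ (-(1/2):ℝ) :=
    Real.rpow_le_rpow_of_nonpos (by linarith) htr.le (by norm_num)
  have h5 : 0 < (t - r) ^ (-(1/2):ℝ) := Real.rpow_pos_of_pos (by linarith) _
  rw [e, abs_of_nonneg (by positivity), mul_assoc, mul_assoc, mul_assoc]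
  gcongr

lemma GG_identity {p a c : ℝ} (hp : 0 ≤ p) (hc : 0 ≤ c) (ha : 0 ≤ a * p) (ha2 : a * p < 2)
    {u : ℝ → ℝ → ℝ} {L : ℝ → ℝ} (hV : RepP p u L)
    (hcb : ContinuousOn (fun t => u t 0) (Ioi 0))
    (hn : ∀ t, 0 < t → 0 ≤ u t 0) (hle : ∀ t, 0 < t → u t 0 ≤ c * t ^ (-a)) {t x : ℝ} (ht : 0 < t)
    (hx : 0 ≤ x) :
    u t x - Real.exp (-x ^ 2 / (4 * t)) * u t 0 = ∫ r in (0:ℝ)..t, GG t x r * (u r 0) ^ p := by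
  obtain ⟨C, hC⟩ := GG_bd ht x
  have hk := adm_int ht.le (half_pos ht) ha ha2 (GG_ii ht x) hC
  have hi := adm_ii ht.le hp hc (GG_ii ht x) hk hcb hn hle
  have T1 := adm_tendsto ht hi
  have T2 := (hV t x ht hx).sub ((hV t 0 ht le_rfl).const_mul (Real.exp (-x ^ 2 / (4 * t))))
  refine tendsto_nhds_unique (T2.congr' ?_) T1
  filter_upwards [Ioo_mem_nhdsGT ht] with s hs
  have hcp : ContinuousOn (fun r => (u r 0) ^ p) (Ioi 0) := hcb.rpow_const (fun x _ => Or.inr hp)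
  have ii : ∀ y, IntervalIntegrable (fun r => EE (t - r) y * (u r 0) ^ p) volume s t := by
    intro y
    have : IntervalIntegrable (fun r => EE (t - r) y) volume s t := (EE_ii t y ht.le le_rfl).mono_set (by
          rw [uIcc_of_le hs.2.le, uIcc_of_le ht.le]
          exact Icc_subset_Icc hs.1.le le_rfl)
    apply this.mul_continuousOn
    apply hcp.mono
    rw [uIcc_of_le hs.2.le]
    exact fun x hx => hs.1.trans_le hx.1
  have e2 : ∫ r in s..t, GG t x r * (u r 0) ^ p =
      Real.exp (-x ^ 2 / (4 * t)) * (∫ r in s..t, EE (t - r) 0 * (u r 0) ^ p)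
        - ∫ r in s..t, EE (t - r) x * (u r 0) ^ p := by
    rw [← intervalIntegral.integral_const_mul, ← intervalIntegral.integral_sub ((ii 0).const_mul _) (ii x)]
    congr 1; ext r; rw [GG]; ring
  rw [e2, EE_factor t x]
  ring

theorem assemble {p a c : ℝ} (hp : 1 < p) (hp2 : p < 2) (ha : a * p = a + 1/2) (ha1 : 1/2 < a)
    (ha2 : a < 1) (hc : 0 < c) {u : ℝ → ℝ → ℝ → ℝ} {U : ℝ → ℝ → ℝ} {L : ℝ → ℝ}
    (hu : ∀ ℓ, 0 < ℓ → RepP p (u ℓ) (fun _ => ℓ))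
    (hcb : ∀ ℓ, 0 < ℓ → ContinuousOn (fun t => u ℓ t 0) (Ioi 0))
    (hn : ∀ ℓ, 0 < ℓ → ∀ t, 0 < t → 0 ≤ u ℓ t 0)
    (hU : RepP p U L) (hUb : ∀ t, 0 < t → U t 0 = c * t ^ (-a)) :
    ∀ t x : ℝ, 0 < t → 0 ≤ x → Tendsto (fun ℓ => u ℓ t x) atTop (𝓝 (U t x)) := by
  have hB : VProp p (fun t => c * t ^ (-a)) L := by
    intro t ht
    have := hU.vprop t ht
    simp only [hUb t ht] at this
    refine this.congr' ?_
    filter_upwards [Ioo_mem_nhdsGT ht] with s hs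
    congr 1
    apply intervalIntegral.integral_congr
    intro r hr
    rw [uIcc_of_le hs.2.le] at hr
    simp only
    rw [hUb r (hs.1.trans_le hr.1)]
  obtain ⟨hle, hlim⟩ := beta_eq (b := fun ℓ t => u ℓ t 0) hp hp2 ha ha1 ha2 hc
    (fun ℓ hℓ => (hu ℓ hℓ).vprop) hcb hn hB
  intro t x ht hx
  have hp0 : 0 ≤ p := by linarith
  have hap0 : 0 ≤ a * p := by rw [ha]; linarith
  have hap2 : a * p < 2 := by rw [ha]; linarith
  obtain ⟨C, hC⟩ := GG_bd ht x
  have hk := adm_int ht.le (half_pos ht) hap0 hap2 (GG_ii ht x) hC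
  have T1 := adm_dct (b := fun ℓ t => u ℓ t 0) (β := fun t => U t 0) ht.le hp0 hc.le (GG_ii ht x) hk hcb hn hle
    (fun t ht => by rw [hUb t ht]; exact hlim t ht)
  have hcU : ContinuousOn (fun t => U t 0) (Ioi 0) := by
    have : ContinuousOn (fun t : ℝ => c * t ^ (-a)) (Ioi 0) := (contOn_rpow_neg (-a)).const_smul c
    exact this.congr (fun t ht => hUb t ht)
  have EU := GG_identity hp0 hc.le hap0 hap2 hU hcU
    (fun t ht => by rw [hUb t ht]; positivity) (fun t ht => (hUb t ht).le) ht hx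
  have T2 := T1.add ((hlim t ht).const_mul (Real.exp (-x ^ 2 / (4 * t))))
  rw [← hUb t ht, ← EU] at T2
  have : U t x - Real.exp (-x ^ 2 / (4 * t)) * U t 0 + Real.exp (-x ^ 2 / (4 * t)) * U t 0 = U t x := by ring
  rw [this] at T2
  refine T2.congr' ?_
  filter_upwards [eventually_gt_atTop 0] with ℓ hℓ
  have := GG_identity hp0 hc.le hap0 hap2 (hu ℓ hℓ) (hcb ℓ hℓ) (hn ℓ hℓ) (hle ℓ hℓ) ht hx
  linarith


lemma Kw_pos (η : ℝ) : 0 < Kw η := Real.exp_pos _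
lemma Kw_one_le (η : ℝ) : 1 ≤ Kw η := Real.one_le_exp (by positivity)
lemma Kw_cont : Continuous Kw := by unfold Kw; fun_prop
lemma Kw_deriv (η : ℝ) : HasDerivAt Kw (η / 2 * Kw η) η := by
  have : HasDerivAt (fun η : ℝ => η ^ 2 / 4) (2 * η / 4) η := by
    simpa using (hasDerivAt_pow 2 η).div_const 4
  have := this.exp
  unfold Kw
  convert this using 1; ring

lemma h1k_ii (ω : H1K) (hpos : 0 < ω.toFun 0) : ∀ R, 0 ≤ R → IntervalIntegrable ω.deriv' volume 0 R := by
  intro R hR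
  by_contra h
  have hc : ∀ x, R ≤ x → ω.toFun x = ω.toFun 0 := by
    intro x hx
    rw [ω.absCont x (hR.trans hx), intervalIntegral.integral_undef, add_zero]
    intro h2
    apply h
    apply h2.mono_set
    rw [uIcc_of_le hR, uIcc_of_le (hR.trans hx)]
    exact Icc_subset_Icc le_rfl hx
  have h1 : IntegrableOn (fun η => (ω.toFun η) ^ 2 * Kw η) (Ioi R) :=
    IntegrableOn.mono_set ω.memL2 (Ioi_subset_Ioi hR)
  have h2 : IntegrableOn (fun η => (ω.toFun 0) ^ 2) (Ioi R) := by
    refine Integrable.mono' h1 (by fun_prop) ?_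
    rw [ae_restrict_iff' measurableSet_Ioi]
    refine ae_of_all _ ?_
    intro η hη
    rw [hc η (le_of_lt hη), Real.norm_of_nonneg (by positivity)]
    exact le_mul_of_one_le_right (by positivity) (Kw_one_le η)
  rw [integrableOn_const_iff] at h2
  rcases h2 with h2 | h2
  · rw [enorm_eq_zero] at h2; exact (pow_ne_zero 2 hpos.ne') h2
  · simp at h2

lemma h1k_cont (ω : H1K) (hpos : 0 < ω.toFun 0) : Continuous (fun η => ω.toFun (max η 0)) := by
  have h1 : ContinuousOn ω.toFun (Ici 0) := by
    intro x hx
    have hx0 : (0:ℝ) ≤ x := hx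
    have hc := intervalIntegral.continuousOn_primitive_interval' (h1k_ii ω hpos (x+1) (by linarith))
      left_mem_uIcc
    rw [uIcc_of_le (by linarith)] at hc
    have h2 : ContinuousWithinAt (fun b => ω.toFun 0 + ∫ t in (0:ℝ)..b, ω.deriv' t) (Icc 0 (x+1)) x :=
      continuousWithinAt_const.add (hc x ⟨hx0, by linarith⟩)
    have h3 : ContinuousWithinAt ω.toFun (Icc 0 (x+1)) x :=
      h2.congr (fun y hy => ω.absCont y hy.1) (ω.absCont x hx0)
    refine h3.mono_of_mem_nhdsWithin ?_
    have := inter_mem_nhdsWithin (Ici (0:ℝ)) (Iic_mem_nhds (show x < x+1 by linarith))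
    rwa [Ici_inter_Iic] at this
  rw [← continuousOn_univ]
  exact h1.comp (by fun_prop) (fun x _ => le_max_right x 0)

lemma contII {f : ℝ → ℝ} (hf : Continuous f) (a b : ℝ) : IntervalIntegrable f volume a b :=
  hf.intervalIntegrable a b

lemma profile_deriv {p : ℝ} (ω : H1K) (hω : IsWeakProfile p ω) (hpos : 0 < ω.toFun 0) :
    ∀ᵐ η : ℝ ∂volume, η ∈ Ioi (0:ℝ) → ω.deriv' η * Kw η +
      (1 / (2 * (p - 1))) * (∫ y in (0:ℝ)..η, ω.toFun (max y 0) * Kw y)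
        - |ω.toFun 0| ^ (p - 1) * ω.toFun 0 = 0 := by
  set a := 1 / (2 * (p - 1)) with ha
  set d := |ω.toFun 0| ^ (p - 1) * ω.toFun 0 with hd
  set w : ℝ → ℝ := fun η => ω.toFun (max η 0) with hw
  have hwc : Continuous w := h1k_cont ω hpos
  set V : ℝ → ℝ := fun η => ∫ y in (0:ℝ)..η, w y * Kw y with hV
  have hVd : ∀ η, HasDerivAt V (w η * Kw η) η := fun η =>
    (hwc.mul Kw_cont).integral_hasStrictDerivAt 0 η |>.hasDerivAt
  have hVc : Continuous V := continuous_iff_continuousAt.2 (fun η => (hVd η).continuousAt)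
  have iiD : ∀ R, 0 ≤ R → IntervalIntegrable (fun η => ω.deriv' η * Kw η) volume 0 R := fun R hR =>
    (h1k_ii ω hpos R hR).mul_continuousOn Kw_cont.continuousOn
  apply isOpen_Ioi.ae_eq_zero_of_integral_contDiff_smul_eq_zero
  · intro x hx
    have hx0 : (0:ℝ) < x := hx
    refine ⟨Ioc 0 (x+1), ?_, ?_⟩
    · have := inter_mem_nhdsWithin (Ioi (0:ℝ)) (Iic_mem_nhds (show x < x+1 by linarith))
      rwa [Ioi_inter_Iic] at this
    · rw [← intervalIntegrable_iff_integrableOn_Ioc_of_le (by linarith)]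
      exact ((iiD (x+1) (by linarith)).add ((contII hVc 0 (x+1)).const_mul a)).sub (contII continuous_const _ _)
  · intro g hg hgc hgs
    obtain ⟨R, hR, hgR⟩ := hgc.exists_pos_le_norm
    have hgz : ∀ x, R ≤ x → g x = 0 := fun x hx => hgR x (by rw [Real.norm_of_nonneg (by linarith)]; exact hx)
    have hg0 : ∀ x, x ≤ 0 → g x = 0 := fun x hx => by
      by_contra h
      exact absurd (hgs (subset_tsupport g h)) (by simpa using hx)
    have gc : Continuous g := hg.continuous
    set A := ∫ y in (0:ℝ)..R, g y with hA
    set ψ : ℝ → ℝ := fun η => -A + ∫ y in (0:ℝ)..η, g y with hψ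
    have hψd : ∀ η, HasDerivAt ψ (g η) η := fun η =>
      (gc.integral_hasStrictDerivAt 0 η).hasDerivAt.const_add _
    have hψc : Continuous ψ := continuous_iff_continuousAt.2 (fun η => (hψd η).continuousAt)
    have hψ0 : ψ 0 = -A := by simp [hψ]
    have hψR : ∀ η, R ≤ η → ψ η = 0 := by
      intro η hη
      have : ∫ y in R..η, g y = 0 := by
        rw [intervalIntegral.integral_congr (g := fun _ => (0:ℝ))]
        · simp
        · intro r hr
          rw [uIcc_of_le hη] at hr
          exact hgz r hr.1
      simp only [hψ]
      rw [← intervalIntegral.integral_add_adjacent_intervals (contII gc 0 R) (contII gc R η), this]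
      simp [hA]
    have hintg : ∀ f : ℝ → ℝ, Continuous f → (∀ η, R ≤ η → f η = 0) → IntegrableOn f (Ioi 0) := by
      intro f hf h0
      refine IntegrableOn.of_forall_sdiff_eq_zero (s := Icc 0 R) (hf.integrableOn_Icc) measurableSet_Ioi ?_
      intro x hx
      apply h0
      by_contra h
      exact hx.2 ⟨le_of_lt hx.1, (not_le.1 h).le⟩
    let ζ : H1K := ⟨ψ, g, fun x _ => by simp [hψ],
      hintg _ ((hψc.pow 2).mul Kw_cont) (fun η hη => by simp [hψR η hη]),
      hintg _ ((gc.pow 2).mul Kw_cont) (fun η hη => by simp [hgz η hη])⟩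
    have key := hω ζ
    change (∫ η in Ioi (0:ℝ), (ω.deriv' η * g η - ω.toFun η * ψ η / (2 * (p - 1))) * Kw η)
      + |ω.toFun 0| ^ (p - 1) * ω.toFun 0 * ψ 0 = 0 at key
    rw [setIntegral_eq_of_subset_of_forall_sdiff_eq_zero (s := Ioc 0 R) measurableSet_Ioi
      (fun x hx => hx.1) (fun x hx => by
        have : R ≤ x := by
          by_contra h; exact hx.2 ⟨hx.1, (not_le.1 h).le⟩
        rw [hgz x this, hψR x this]; simp), ← intervalIntegral.integral_of_le hR.le, ← hd] at key
    have e1 : ∫ η in (0:ℝ)..R, (ω.deriv' η * g η - ω.toFun η * ψ η / (2 * (p - 1))) * Kw η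
        = (∫ η in (0:ℝ)..R, (ω.deriv' η * Kw η) * g η) - a * ∫ η in (0:ℝ)..R, (w η * Kw η) * ψ η := by
      rw [← intervalIntegral.integral_const_mul, ← intervalIntegral.integral_sub]
      · apply intervalIntegral.integral_congr
        intro r hr
        rw [uIcc_of_le hR.le] at hr
        simp only [hw, max_eq_left hr.1, ha]
        ring
      · exact (iiD R hR.le).mul_continuousOn gc.continuousOn
      · exact (contII ((hwc.mul Kw_cont).mul hψc) _ _).const_mul a
    have e2 : ∫ η in (0:ℝ)..R, (w η * Kw η) * ψ η = - ∫ η in (0:ℝ)..R, V η * g η := by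
      have := intervalIntegral.integral_mul_deriv_eq_deriv_mul (a := 0) (b := R) (u := V) (v := ψ)
        (u' := fun η => w η * Kw η) (v' := g)
        (fun x _ => hVd x) (fun x _ => hψd x) (contII (hwc.mul Kw_cont) _ _) (contII gc _ _)
      have hV0 : V 0 = 0 := by simp [hV]
      rw [hψR R le_rfl, hV0] at this
      linarith
    have e3 : ∫ x, g x • (ω.deriv' x * Kw x + a * V x - d) =
       (∫ η in (0:ℝ)..R, (ω.deriv' η * Kw η) * g η) + a * (∫ η in (0:ℝ)..R, V η * g η) - d * A := by
      rw [← setIntegral_eq_integral_of_forall_compl_eq_zero (s := Ioc 0 R),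
        ← intervalIntegral.integral_of_le hR.le, hA, ← intervalIntegral.integral_const_mul,
        ← intervalIntegral.integral_const_mul, ← intervalIntegral.integral_add,
        ← intervalIntegral.integral_sub]
      · congr 1; ext x; simp only [smul_eq_mul]; ring
      · exact ((iiD R hR.le).mul_continuousOn gc.continuousOn).add ((contII (hVc.mul gc) _ _).const_mul a)
      · exact (contII gc _ _).const_mul d
      · exact ((iiD R hR.le).mul_continuousOn gc.continuousOn)
      · exact ((contII (hVc.mul gc) _ _).const_mul a)
      · intro x hx
        have : g x = 0 := by
          by_cases h : x ≤ 0
          · exact hg0 x h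
          · apply hgz; by_contra h2; exact hx ⟨not_le.1 h, (not_le.1 h2).le⟩
        simp [this]
    rw [e3]
    rw [e1, e2, hψ0] at key
    linarith

lemma profile_classical {p : ℝ} (hp : 1 < p) (ω : H1K) (hω : IsWeakProfile p ω)
    (hpos : 0 < ω.toFun 0) : ∃ W W1 : ℝ → ℝ, (∀ η, 0 ≤ η → W η = ω.toFun η) ∧
      (∀ η, HasDerivAt W (W1 η) η) ∧
      (∀ η, 0 ≤ η → HasDerivAt W1 (-(η/2) * W1 η - 1 / (2 * (p - 1)) * W η) η) ∧
      W1 0 = ω.toFun 0 ^ p ∧ Continuous W1 ∧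
      ∃ M, 0 ≤ M ∧ (∀ η, 0 ≤ η → |W η| ≤ M) ∧ (∀ η, 0 ≤ η → |W1 η| ≤ M * (1 + η)) ∧
        IntegrableOn (fun η => (1 + η) * W η) (Ioi 0) := by
  have hD := profile_deriv ω hω hpos
  set a := 1 / (2 * (p - 1)) with ha
  have ha0 : 0 < a := by
    have : 0 < p - 1 := by linarith
    positivity
  have hd : |ω.toFun 0| ^ (p - 1) * ω.toFun 0 = ω.toFun 0 ^ p := by
    rw [abs_of_pos hpos, ← Real.rpow_add_one hpos.ne']; congr 1; ring
  rw [hd] at hD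
  set d := ω.toFun 0 ^ p
  have hd0 : 0 < d := by positivity
  set w : ℝ → ℝ := fun η => ω.toFun (max η 0) with hw
  have hwc : Continuous w := h1k_cont ω hpos
  set V : ℝ → ℝ := fun η => ∫ y in (0:ℝ)..η, w y * Kw y with hV
  have hVd : ∀ η, HasDerivAt V (w η * Kw η) η := fun η =>
    (hwc.mul Kw_cont).integral_hasStrictDerivAt 0 η |>.hasDerivAt
  have hVc : Continuous V := continuous_iff_continuousAt.2 (fun η => (hVd η).continuousAt)
  set W1 : ℝ → ℝ := fun η => (Kw η)⁻¹ * (d - a * V η) with hW1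
  have hW1c : Continuous W1 := (Kw_cont.inv₀ (fun η => (Kw_pos η).ne')).mul (by fun_prop)
  set W : ℝ → ℝ := fun η => ω.toFun 0 + ∫ y in (0:ℝ)..η, W1 y with hW
  have hWd : ∀ η, HasDerivAt W (W1 η) η := fun η =>
    (hW1c.integral_hasStrictDerivAt 0 η).hasDerivAt.const_add _
  have hWc : Continuous W := continuous_iff_continuousAt.2 (fun η => (hWd η).continuousAt)
  have hDe : ∀ᵐ η : ℝ ∂volume, η ∈ Ioi (0:ℝ) → ω.deriv' η = W1 η := by
    filter_upwards [hD] with η h hη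
    have := h hη
    simp only [hW1]
    field_simp [(Kw_pos η).ne']
    linarith
  have hWe : ∀ η, 0 ≤ η → W η = ω.toFun η := by
    intro η hη
    rw [ω.absCont η hη, hW]
    simp only
    congr 1
    apply intervalIntegral.integral_congr_ae
    filter_upwards [hDe] with x hx hx2
    rw [uIoc_of_le hη] at hx2
    exact (hx hx2.1).symm
  have hwW : ∀ η, 0 ≤ η → w η = W η := fun η hη => by rw [hWe η hη]; simp [hw, max_eq_left hη]
  have iW : IntegrableOn (fun η => W η ^ 2 * Kw η) (Ioi 0) :=
    (integrableOn_congr_fun (fun η hη => by rw [hWe η (le_of_lt hη)]) measurableSet_Ioi).2 ω.memL2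
  have iW1 : IntegrableOn (fun η => W1 η ^ 2 * Kw η) (Ioi 0) := by
    refine Integrable.congr ω.derivMemL2 ?_
    rw [EventuallyEq, ae_restrict_iff' measurableSet_Ioi]
    filter_upwards [hDe] with x hx hx2
    rw [hx hx2]
  set I := (∫ η in Ioi (0:ℝ), W η ^ 2 * Kw η) + ∫ η in Ioi (0:ℝ), W1 η ^ 2 * Kw η with hI
  have hbW : ∀ η, 0 ≤ η → W η ^ 2 ≤ ω.toFun 0 ^ 2 + I := by
    intro η hη
    have h1 : ∫ y in (0:ℝ)..η, 2 * W y * W1 y = W η ^ 2 - W 0 ^ 2 := by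
      apply intervalIntegral.integral_eq_sub_of_hasDerivAt (f := fun y => W y ^ 2)
      · intro x _
        have := (hWd x).fun_pow 2
        refine this.congr_deriv ?_; norm_num
      · exact contII (by fun_prop) _ _
    have h2 : ∫ y in (0:ℝ)..η, 2 * W y * W1 y ≤ I := by
      rw [hI, ← integral_add iW iW1, intervalIntegral.integral_of_le hη]
      calc ∫ y in Ioc 0 η, 2 * W y * W1 y ≤ ∫ y in Ioc 0 η, (W y ^ 2 * Kw y + W1 y ^ 2 * Kw y) := by
            apply setIntegral_mono
            · exact (by fun_prop : Continuous (fun y => 2 * W y * W1 y)).integrableOn_Ioc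
            · exact (((hWc.pow 2).mul Kw_cont).add ((hW1c.pow 2).mul Kw_cont)).integrableOn_Ioc
            · intro y
              have k := Kw_one_le y
              have : 0 ≤ W y ^ 2 := sq_nonneg _
              have : 0 ≤ W1 y ^ 2 := sq_nonneg _
              simp only
              nlinarith [sq_nonneg (W y - W1 y)]
        _ ≤ _ := by
            apply setIntegral_mono_set (iW.add iW1)
            · refine ae_of_all _ ?_
              intro y
              have := Kw_pos y
              have h5 : 0 ≤ W y ^ 2 * Kw y := by positivity
              have h6 : 0 ≤ W1 y ^ 2 * Kw y := by positivity
              exact add_nonneg h5 h6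
            · exact (Ioc_subset_Ioi_self).eventuallyLE
    have h0 : W 0 = ω.toFun 0 := hWe 0 le_rfl
    rw [h0] at h1
    linarith
  set M0 := √(ω.toFun 0 ^ 2 + I) with hM0
  have hbW' : ∀ η, 0 ≤ η → |W η| ≤ M0 := fun η hη => Real.abs_le_sqrt (hbW η hη)
  have hM00 : 0 ≤ M0 := Real.sqrt_nonneg _
  have hVb : ∀ η, 0 ≤ η → |V η| ≤ M0 * Kw η * η := by
    intro η hη
    have := intervalIntegral.norm_integral_le_of_norm_le_const (a := 0) (b := η)
      (f := fun y => w y * Kw y) (C := M0 * Kw η) (by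
        intro y hy
        rw [uIoc_of_le hη] at hy
        rw [norm_mul, Real.norm_eq_abs, Real.norm_of_nonneg (Kw_pos y).le, hwW y hy.1.le]
        apply mul_le_mul (hbW' y hy.1.le) _ (Kw_pos y).le hM00
        unfold Kw
        rw [Real.exp_le_exp]
        have := hy.1; have := hy.2
        nlinarith)
    rw [Real.norm_eq_abs] at this
    simpa [abs_of_nonneg hη] using this
  refine ⟨W, W1, hWe, hWd, ?_, ?_, hW1c, M0 + d + a * M0, by positivity, ?_, ?_, ?_⟩
  · intro η hη
    have h1 : HasDerivAt W1 _ η := ((Kw_deriv η).inv (Kw_pos η).ne').mul (((hVd η).const_mul a).const_sub d)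
    convert h1 using 1
    simp only [Pi.inv_apply, hW1]
    rw [← hwW η hη]
    have := (Kw_pos η).ne'
    field_simp
    ring
  · simp [hW1, hV, Kw]
  · intro η hη
    have := hbW' η hη
    have : 0 ≤ a * M0 := by positivity
    linarith
  · intro η hη
    have hk := Kw_pos η
    have h1 := hVb η hη
    simp only [hW1]
    rw [abs_mul, abs_of_pos (inv_pos.2 hk)]
    have h2 : |d - a * V η| ≤ Kw η * (d + a * M0 * η) := by
      have : |d - a * V η| ≤ |d| + |a * V η| := abs_sub _ _
      rw [abs_of_pos hd0, abs_mul, abs_of_pos ha0] at this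
      have h3 := mul_le_mul_of_nonneg_left h1 ha0.le
      have h4 : d ≤ Kw η * d := le_mul_of_one_le_left hd0.le (Kw_one_le η)
      nlinarith
    calc (Kw η)⁻¹ * |d - a * V η| ≤ (Kw η)⁻¹ * (Kw η * (d + a * M0 * η)) := by gcongr
      _ = d + a * M0 * η := by field_simp
      _ ≤ _ := by
        have : 0 ≤ a * M0 := by positivity
        have : 0 ≤ M0 * (1+η) := by positivity
        have : 0 ≤ d * η := by positivity
        nlinarith
  · have hg : IntegrableOn (fun η : ℝ => W η ^ 2 * Kw η + (1 + η) ^ 2 * Real.exp (-(1/4) * η ^ 2)) (Ioi 0) := by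
      apply iW.add
      have i0 := (integrable_exp_neg_mul_sq (b := 1/4) (by norm_num)).integrableOn (s := Ioi 0)
      have i1 := (integrable_mul_exp_neg_mul_sq (b := 1/4) (by norm_num)).integrableOn (s := Ioi 0)
      have i2 := (integrable_rpow_mul_exp_neg_mul_sq (b := 1/4) (by norm_num) (s := 2) (by norm_num)).integrableOn (s := Ioi 0)
      refine ((i0.add (i1.const_mul 2)).add i2).congr_fun ?_ measurableSet_Ioi
      intro η hη
      simp only [Pi.add_apply, Real.rpow_two]
      ring
    refine Integrable.mono' hg (by fun_prop) ?_
    rw [ae_restrict_iff' measurableSet_Ioi]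
    refine ae_of_all _ ?_
    intro η hη
    have hη0 : (0:ℝ) < η := hη
    rw [Real.norm_eq_abs, abs_le]
    have e : Kw η * Real.exp (-(1/4) * η ^ 2) = 1 := by
      unfold Kw; rw [← Real.exp_add]; simp; ring
    set k := Kw η
    have hk : 0 < k := Kw_pos η
    set e' := Real.exp (-(1/4) * η ^ 2)
    have he : e' = k⁻¹ := by field_simp; linarith
    rw [he]
    have h2 : W η ^ 2 * k + (1 + η) ^ 2 * k⁻¹ = (W η * k)^2 * k⁻¹ + (1+η)^2 * k⁻¹ := by field_simp
    rw [h2]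
    have hk' : 0 < k⁻¹ := by positivity
    have h3 : (1 + η) * W η = (1+η) * (W η * k) * k⁻¹ := by field_simp
    rw [h3]
    constructor <;> nlinarith [mul_nonneg hk'.le (sq_nonneg (W η * k - (1+η))), mul_nonneg hk'.le (sq_nonneg (W η * k + (1+η))), mul_nonneg hk'.le (sq_nonneg (W η * k)), mul_nonneg hk'.le (sq_nonneg (1 + η))]


/-- unnormalised heat kernel -/
noncomputable def Gam (τ z : ℝ) : ℝ := τ ^ (-(1/2) : ℝ) * Real.exp (-z ^ 2 / (4 * τ))

lemma EE_Gam (τ z : ℝ) : EE τ z = (√π)⁻¹ * Gam τ z := by unfold EE Gam; ring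

lemma Gam_pos {τ : ℝ} (h : 0 < τ) (z : ℝ) : 0 < Gam τ z := by unfold Gam; positivity

lemma Gam_neg (τ z : ℝ) : Gam τ (-z) = Gam τ z := by unfold Gam; ring_nf

lemma Gam_dtau {τ : ℝ} (h : 0 < τ) (z : ℝ) :
    HasDerivAt (fun τ => Gam τ z) ((z ^ 2 / (4 * τ ^ 2) - 1 / (2 * τ)) * Gam τ z) τ := by
  have h1 : HasDerivAt (fun τ : ℝ => τ ^ (-(1/2) : ℝ)) (-(1/2) * τ ^ (-(1/2) - 1 : ℝ)) τ :=
    Real.hasDerivAt_rpow_const (Or.inl h.ne')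
  have h2 : HasDerivAt (fun τ : ℝ => -z ^ 2 / (4 * τ)) (z ^ 2 / (4 * τ ^ 2)) τ := by
    have := ((hasDerivAt_id τ).const_mul 4).fun_inv (by simp; exact h.ne') |>.const_mul (-z ^ 2)
    simp only [id] at this
    have e : (fun y : ℝ => -z ^ 2 * (4 * y)⁻¹) = fun τ => -z ^ 2 / (4 * τ) := by
      ext y; rw [div_eq_mul_inv]
    rw [e] at this
    refine this.congr_deriv ?_
    field_simp
  have h3 := h1.fun_mul h2.exp
  unfold Gam
  refine h3.congr_deriv ?_
  rw [Real.rpow_sub_one h.ne']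
  field_simp
  ring

lemma Gam_dz {τ : ℝ} (h : 0 < τ) (z : ℝ) :
    HasDerivAt (fun z => Gam τ z) (-z / (2 * τ) * Gam τ z) z := by
  have h2 : HasDerivAt (fun z : ℝ => -z ^ 2 / (4 * τ)) (-(2 * z) / (4 * τ)) z := by
    have := ((hasDerivAt_pow 2 z).fun_neg).div_const (4 * τ)
    simpa using this
  have h3 := h2.exp.const_mul (τ ^ (-(1/2) : ℝ))
  unfold Gam
  refine h3.congr_deriv ?_
  field_simp
  ring

lemma Gam_bd {m t τ : ℝ} (hm : 0 < m) (h1 : m ≤ τ) (h2 : τ ≤ t) (z : ℝ) :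
    Gam τ z ≤ m ^ (-(1/2):ℝ) * Real.exp (-z ^ 2 / (8 * t)) ∧
    |(z ^ 2 / (4 * τ ^ 2) - 1 / (2 * τ)) * Gam τ z| ≤ 3 / m * (m ^ (-(1/2):ℝ) * Real.exp (-z ^ 2 / (8 * t))) := by
  have hτ : 0 < τ := by linarith
  have ht : 0 < t := by linarith
  set q := z ^ 2 / (8 * τ) with hq
  have hq0 : 0 ≤ q := by positivity
  have e1 : Real.exp (-z ^ 2 / (4 * τ)) = Real.exp (-q) * Real.exp (-q) := by
    rw [← Real.exp_add, hq]; congr 1; field_simp; ring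
  have e2 : Real.exp (-q) ≤ Real.exp (-z ^ 2 / (8 * t)) := by
    rw [Real.exp_le_exp, hq, neg_div]
    apply neg_le_neg
    apply div_le_div_of_nonneg_left (by positivity) (by positivity) (by linarith)
  have e3 : τ ^ (-(1/2):ℝ) ≤ m ^ (-(1/2):ℝ) := Real.rpow_le_rpow_of_nonpos hm h1 (by norm_num)
  have e4 : Real.exp (-q) ≤ 1 := Real.exp_le_one_iff.2 (by linarith)
  have e5 : q * Real.exp (-q) ≤ 1 := by
    have := Real.add_one_le_exp q
    have h := Real.exp_pos (-q)
    have : Real.exp q * Real.exp (-q) = 1 := by rw [← Real.exp_add]; simp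
    nlinarith
  have hE : 0 < Real.exp (-q) := Real.exp_pos _
  have g : Gam τ z = τ ^ (-(1/2):ℝ) * Real.exp (-q) * Real.exp (-q) := by
    unfold Gam; rw [e1]; ring
  have base : τ ^ (-(1/2):ℝ) * Real.exp (-q) ≤ m ^ (-(1/2):ℝ) * Real.exp (-z ^ 2 / (8 * t)) := by
    gcongr
  have base0 : 0 ≤ τ ^ (-(1/2):ℝ) * Real.exp (-q) := by positivity
  constructor
  · rw [g]
    calc τ ^ (-(1/2):ℝ) * Real.exp (-q) * Real.exp (-q) ≤ τ ^ (-(1/2):ℝ) * Real.exp (-q) * 1 := by gcongr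
      _ ≤ _ := by rw [mul_one]; exact base
  · have r : (z ^ 2 / (4 * τ ^ 2) - 1 / (2 * τ)) * Gam τ z
        = ((2 * (q * Real.exp (-q)) - Real.exp (-q) / 2) * τ⁻¹) * (τ ^ (-(1/2):ℝ) * Real.exp (-q)) := by
      rw [g, hq]; field_simp; ring
    rw [r, abs_mul, abs_of_nonneg base0]
    apply mul_le_mul _ base base0 (by positivity)
    rw [abs_mul, abs_of_pos (inv_pos.2 hτ), div_eq_mul_inv]
    apply mul_le_mul _ (inv_anti₀ hm h1) (by positivity) (by norm_num)
    have : 0 ≤ q * Real.exp (-q) := by positivity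
    rw [abs_le]; constructor <;> linarith

/-- envelope -/
noncomputable def Env (t y : ℝ) : ℝ := (1 + y) ^ 2 * Real.exp (-(1 / (16 * t)) * y ^ 2)

lemma Env_int {t : ℝ} (ht : 0 < t) : IntegrableOn (Env t) (Ioi 0) := by
  have hb : 0 < 1 / (16 * t) := by positivity
  have i0 := (integrable_exp_neg_mul_sq hb).integrableOn (s := Ioi 0)
  have i1 := (integrable_mul_exp_neg_mul_sq hb).integrableOn (s := Ioi 0)
  have i2 := (integrable_rpow_mul_exp_neg_mul_sq hb (s := 2) (by norm_num)).integrableOn (s := Ioi 0)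
  refine ((i0.add (i1.const_mul 2)).add i2).congr_fun ?_ measurableSet_Ioi
  intro η hη
  simp only [Pi.add_apply, Real.rpow_two, Env]
  ring

lemma Env_tendsto {t : ℝ} (ht : 0 < t) : Tendsto (Env t) atTop (𝓝 0) := by
  have hb : 0 < 1 / (16 * t) := by positivity
  have h := fun s => (rpow_mul_exp_neg_mul_sq_isLittleO_exp_neg hb s).trans_tendsto
    (Real.tendsto_exp_atBot.comp (tendsto_id.const_mul_atTop_of_neg (show (-(1/2):ℝ) < 0 by norm_num)))
  have := ((h 0).add ((h 1).const_mul 2)).add (h 2)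
  simp only [mul_zero, add_zero] at this
  refine this.congr ?_
  intro y
  simp only [Env, Real.rpow_zero, Real.rpow_one, Real.rpow_two]
  ring

lemma exp_env {t : ℝ} (ht : 0 < t) (x y : ℝ) :
    Real.exp (-(x - y) ^ 2 / (8 * t)) ≤ Real.exp (x ^ 2 / (8 * t)) * Real.exp (-(1 / (16 * t)) * y ^ 2) := by
  rw [← Real.exp_add, Real.exp_le_exp]
  have : x ^ 2 / (8 * t) + -(1 / (16 * t)) * y ^ 2 - (-(x - y) ^ 2 / (8 * t))
      = (2 * x - y) ^ 2 / (16 * t) := by field_simp; ring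
  have h2 : 0 ≤ (2 * x - y) ^ 2 / (16 * t) := by positivity
  linarith

/-- The self-similar function and its derivatives. -/
noncomputable def UU (W : ℝ → ℝ) (α s y : ℝ) : ℝ := s ^ (-α) * W (y * s ^ (-(1/2):ℝ))

section
variable {W W1 W2 : ℝ → ℝ} {a : ℝ}

lemma UU_dy {s y α : ℝ} (hs : 0 < s) (h : HasDerivAt W (W1 (y * s ^ (-(1/2):ℝ))) (y * s ^ (-(1/2):ℝ))) :
    HasDerivAt (fun y => UU W α s y) (UU W1 (α + 1/2) s y) y := by
  unfold UU
  have h1 : HasDerivAt (fun y : ℝ => y * s ^ (-(1/2):ℝ)) (s ^ (-(1/2):ℝ)) y := by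
    simpa using (hasDerivAt_id y).mul_const (s ^ (-(1/2):ℝ))
  have h2 := (HasDerivAt.comp y h h1).const_mul (s ^ (-α))
  refine h2.congr_deriv ?_
  rw [show -(α + 1/2) = -α + -(1/2) by ring, Real.rpow_add hs]
  ring

lemma UU_ds {s y : ℝ} (hs : 0 < s) (h : HasDerivAt W (W1 (y * s ^ (-(1/2):ℝ))) (y * s ^ (-(1/2):ℝ)))
    (h2 : ∀ η, W2 η = -(η/2) * W1 η - a * W η) :
    HasDerivAt (fun s => UU W a s y) (UU W2 (a + 1) s y) s := by
  unfold UU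
  have h1 : HasDerivAt (fun s : ℝ => y * s ^ (-(1/2):ℝ)) (y * (-(1/2) * s ^ (-(1/2) - 1 : ℝ))) s :=
    (Real.hasDerivAt_rpow_const (Or.inl hs.ne')).const_mul y
  have h3 : HasDerivAt (fun s : ℝ => s ^ (-a)) (-a * s ^ (-a-1)) s :=
    Real.hasDerivAt_rpow_const (Or.inl hs.ne')
  have h4 := h3.fun_mul (HasDerivAt.comp s h h1)
  refine h4.congr_deriv ?_
  rw [h2, show -(a + 1) = -a - 1 by ring, Real.rpow_sub_one hs.ne', Real.rpow_sub_one hs.ne']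
  simp only [Function.comp]
  field_simp
  ring

lemma UU_bd {α M s s1 y : ℝ} (hM : 0 ≤ M) (hα : 0 ≤ α) (hs1 : 0 < s1) (hs : s1 ≤ s) (hy : 0 ≤ y)
    (hW : ∀ η, 0 ≤ η → |W η| ≤ M * (1 + η) ^ 2) :
    |UU W α s y| ≤ s1 ^ (-α) * (M * (1 + s1 ^ (-(1/2):ℝ)) ^ 2) * (1 + y) ^ 2 := by
  have hs0 : 0 < s := by linarith
  unfold UU
  rw [abs_mul, abs_of_pos (by positivity), mul_assoc]
  have e1 : s ^ (-α) ≤ s1 ^ (-α) := Real.rpow_le_rpow_of_nonpos hs1 hs (by linarith)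
  have e2 : s ^ (-(1/2):ℝ) ≤ s1 ^ (-(1/2):ℝ) := Real.rpow_le_rpow_of_nonpos hs1 hs (by norm_num)
  apply mul_le_mul e1 _ (abs_nonneg _) (by positivity)
  refine (hW _ (by positivity)).trans ?_
  rw [mul_assoc, ← mul_pow]
  gcongr
  have : 0 < s1 ^ (-(1/2):ℝ) := by positivity
  have : y * s ^ (-(1/2):ℝ) ≤ y * s1 ^ (-(1/2):ℝ) := by gcongr
  nlinarith

lemma J_deriv {M : ℝ} (ha : 0 ≤ a) (hM : 0 ≤ M) (hW : ∀ η, HasDerivAt W (W1 η) η)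
    (hW1 : ∀ η, 0 ≤ η → HasDerivAt W1 (W2 η) η) (hW1c : Continuous W1)
    (h2 : ∀ η, W2 η = -(η/2) * W1 η - a * W η)
    (b0 : ∀ η, 0 ≤ η → |W η| ≤ M) (b1 : ∀ η, 0 ≤ η → |W1 η| ≤ M * (1 + η))
    {t x s0 : ℝ} (hs0 : 0 < s0) (hst : s0 < t) :
    HasDerivAt (fun s => ∫ y in Ioi (0:ℝ), Gam (t - s) (x - y) * UU W a s y)
      (-(Gam (t - s0) x * UU W1 (a + 1/2) s0 0) + x / (2 * (t - s0)) * Gam (t - s0) x * UU W a s0 0) s0 := by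
  have hWc : Continuous W := continuous_iff_continuousAt.2 (fun η => (hW η).continuousAt)
  have hW2c : Continuous W2 := by
    have : W2 = fun η => -(η/2) * W1 η - a * W η := funext h2
    rw [this]; fun_prop
  set M' := M * (1 + a) with hM'
  have hM'0 : 0 ≤ M' := by positivity
  have c0 : ∀ η, 0 ≤ η → |W η| ≤ M' * (1 + η) ^ 2 := by
    intro η hη
    refine (b0 η hη).trans ?_
    rw [hM', mul_assoc]
    apply le_mul_of_one_le_right hM
    have : 1 ≤ (1 + η) ^ 2 := by nlinarith
    nlinarith
  have c1 : ∀ η, 0 ≤ η → |W1 η| ≤ M' * (1 + η) ^ 2 := by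
    intro η hη
    refine (b1 η hη).trans ?_
    rw [hM', mul_assoc]
    apply mul_le_mul_of_nonneg_left _ hM
    have h5 : 1 + η ≤ (1 + η) ^ 2 := by nlinarith
    have : 0 ≤ a * (1 + η) ^ 2 := by positivity
    linarith
  have c2 : ∀ η, 0 ≤ η → |W2 η| ≤ M' * (1 + η) ^ 2 := by
    intro η hη
    rw [h2]
    have i1 : |-(η/2) * W1 η - a * W η| ≤ |-(η/2) * W1 η| + |a * W η| := abs_sub _ _
    rw [abs_mul, abs_mul, abs_neg, abs_of_nonneg (by linarith : 0 ≤ η/2), abs_of_nonneg ha] at i1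
    have i2 := mul_le_mul_of_nonneg_left (b1 η hη) (by linarith : 0 ≤ η/2)
    have i3 := mul_le_mul_of_nonneg_left (b0 η hη) ha
    have i4 : η / 2 * (M * (1 + η)) ≤ M * (1 + η) ^ 2 := by
      have : η / 2 * (1 + η) ≤ (1 + η) ^ 2 := by nlinarith
      have := mul_le_mul_of_nonneg_left this hM
      linarith
    have i5 : a * M ≤ M * a * (1 + η) ^ 2 := by
      rw [mul_comm a M]
      exact le_mul_of_one_le_right (by positivity) (by nlinarith)
    rw [hM']; linarith
  obtain ⟨s1, hs1, hs1'⟩ := exists_between hs0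
  obtain ⟨s2, hs2, hs2'⟩ := exists_between hst
  set m := t - s2 with hm
  have hm0 : 0 < m := by linarith
  have ht : 0 < t := by linarith
  set F' : ℝ → ℝ → ℝ := fun s y => -(((x - y) ^ 2 / (4 * (t - s) ^ 2) - 1 / (2 * (t - s))) * Gam (t - s) (x - y)) * UU W a s y
      + Gam (t - s) (x - y) * UU W2 (a + 1) s y with hF'
  set CG := m ^ (-(1/2):ℝ) * Real.exp (x ^ 2 / (8 * t)) with hCG
  set CU : ℝ → ℝ := fun α => s1 ^ (-α) * (M' * (1 + s1 ^ (-(1/2):ℝ)) ^ 2) with hCU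
  have hCU0 : ∀ α, 0 ≤ CU α := fun α => by positivity
  have gb : ∀ s ∈ Ioo s1 s2, ∀ y, Gam (t - s) (x - y) ≤ CG * Real.exp (-(1 / (16 * t)) * y ^ 2) ∧
      |((x - y) ^ 2 / (4 * (t - s) ^ 2) - 1 / (2 * (t - s))) * Gam (t - s) (x - y)| ≤
        3 / m * (CG * Real.exp (-(1 / (16 * t)) * y ^ 2)) := by
    intro s hs y
    have h := Gam_bd hm0 (show m ≤ t - s by linarith [hs.2]) (show t - s ≤ t by linarith [hs.1]) (x - y)
    have e := exp_env ht x y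
    have e' : m ^ (-(1/2):ℝ) * Real.exp (-(x - y) ^ 2 / (8 * t)) ≤ CG * Real.exp (-(1 / (16 * t)) * y ^ 2) := by
      rw [hCG, mul_assoc]; gcongr
    exact ⟨h.1.trans e', h.2.trans (by gcongr)⟩
  have hs0m : s0 ∈ Ioo s1 s2 := ⟨hs1', hs2⟩
  have measG : ∀ s, s < t → Continuous (fun y => Gam (t - s) (x - y)) := by
    intro s hs; unfold Gam; fun_prop
  have cU : ∀ (f : ℝ → ℝ) (α s : ℝ), Continuous f → Continuous (fun y => UU f α s y) := by
    intro f α s hf; unfold UU; fun_prop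
  have bF : ∀ s ∈ Ioo s1 s2, ∀ y, 0 < y → ‖Gam (t - s) (x - y) * UU W a s y‖ ≤ CG * CU a * Env t y := by
    intro s hs y hy
    rw [norm_mul, Real.norm_eq_abs, Real.norm_eq_abs, abs_of_pos (Gam_pos (by linarith [hs.2]) _)]
    have := mul_le_mul (gb s hs y).1 (UU_bd hM'0 ha hs1 hs.1.le hy.le c0) (abs_nonneg _) (by positivity)
    refine this.trans (le_of_eq ?_)
    simp only [Env, hCU]; ring
  have bF' : ∀ s ∈ Ioo s1 s2, ∀ y, 0 < y → ‖F' s y‖ ≤ (3 / m * CG * CU a + CG * CU (a+1)) * Env t y := by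
    intro s hs y hy
    simp only [hF']
    refine (norm_add_le _ _).trans ?_
    rw [norm_mul, norm_mul, norm_neg, Real.norm_eq_abs, Real.norm_eq_abs, Real.norm_eq_abs, Real.norm_eq_abs,
      abs_of_pos (Gam_pos (show 0 < t - s by linarith [hs.2]) (x - y))]
    have k1 := mul_le_mul (gb s hs y).2 (UU_bd hM'0 ha hs1 hs.1.le hy.le c0) (abs_nonneg _) (by positivity)
    have k2 := mul_le_mul (gb s hs y).1 (UU_bd (α := a + 1) hM'0 (by linarith) hs1 hs.1.le hy.le c2) (abs_nonneg _) (by positivity)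
    refine (add_le_add k1 k2).trans (le_of_eq ?_)
    simp only [Env, hCU]; ring
  have cF' : ∀ s, s < t → Continuous (F' s) := by
    intro s hs
    have hG := measG s hs
    have h1 := cU W a s hWc
    have h2 := cU W2 (a+1) s hW2c
    simp only [hF']
    fun_prop
  have D := hasDerivAt_integral_of_dominated_loc_of_deriv_le (μ := volume.restrict (Ioi (0:ℝ)))
    (F := fun s y => Gam (t - s) (x - y) * UU W a s y) (F' := F') (x₀ := s0) (s := Ioo s1 s2)
    (bound := fun y => (3 / m * CG * CU a + CG * CU (a+1)) * Env t y)
    (Ioo_mem_nhds hs1' hs2)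
    (by
      filter_upwards [Ioo_mem_nhds hs1' hs2] with s hs
      exact ((measG s (by linarith [hs.2])).mul (cU W a s hWc)).aestronglyMeasurable)
    (by
      refine Integrable.mono' ((Env_int ht).const_mul (CG * CU a))
        ((measG s0 hst).mul (cU W a s0 hWc)).aestronglyMeasurable ?_
      rw [ae_restrict_iff' measurableSet_Ioi]
      exact ae_of_all _ (fun y hy => bF s0 hs0m y hy))
    ((cF' s0 hst).aestronglyMeasurable)
    (by
      rw [ae_restrict_iff' measurableSet_Ioi]
      exact ae_of_all _ (fun y hy s hs => bF' s hs y hy))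
    ((Env_int ht).const_mul _)
    (by
      refine ae_of_all _ ?_
      intro y s hs
      have k1 : HasDerivAt (fun s => Gam (t - s) (x - y))
          (-(((x - y) ^ 2 / (4 * (t - s) ^ 2) - 1 / (2 * (t - s))) * Gam (t - s) (x - y))) s := by
        have := HasDerivAt.comp_const_sub t s (Gam_dtau (show 0 < t - s by linarith [hs.2]) (x - y))
        exact this
      exact k1.mul (UU_ds (hs1.trans hs.1) (hW _) h2))
  obtain ⟨hI, hD⟩ := D
  refine hD.congr_deriv ?_
  -- now the space integral
  set f : ℝ → ℝ := fun y => Gam (t - s0) (x - y) * UU W1 (a + 1/2) s0 y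
      - ((x - y) / (2 * (t - s0)) * Gam (t - s0) (x - y)) * UU W a s0 y with hf
  have hτ : 0 < t - s0 := by linarith
  have fd : ∀ y, 0 ≤ y → HasDerivAt f (F' s0 y) y := by
    intro y hy
    have g1 : HasDerivAt (fun y => Gam (t - s0) (x - y)) ((x - y) / (2 * (t - s0)) * Gam (t - s0) (x - y)) y := by
      have := HasDerivAt.comp_const_sub x y (Gam_dz hτ (x - y))
      refine this.congr_deriv ?_
      ring
    have g2 : HasDerivAt (fun y : ℝ => (x - y) / (2 * (t - s0))) (-1 / (2 * (t - s0))) y := by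
      simpa using ((hasDerivAt_id y).const_sub x).div_const (2 * (t - s0))
    have u1 : HasDerivAt (fun y => UU W a s0 y) (UU W1 (a + 1/2) s0 y) y := UU_dy hs0 (hW _)
    have u2 : HasDerivAt (fun y => UU W1 (a + 1/2) s0 y) (UU W2 (a + 1/2 + 1/2) s0 y) y :=
      UU_dy hs0 (hW1 _ (by positivity))
    have := (g1.fun_mul u2).fun_sub ((g2.fun_mul g1).fun_mul u1)
    refine this.congr_deriv ?_
    rw [show a + 1/2 + 1/2 = a + 1 by ring]
    simp only [hF']
    field_simp
    ring
  have fb : ∀ y, 0 ≤ y → ‖f y‖ ≤ (CG * CU (a+1/2) + (1 + |x|) / (2 * m) * CG * (s1 ^ (-a) * M)) * Env t y := by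
    intro y hy
    have hG := (gb s0 hs0m y).1
    have hG0 := Gam_pos hτ (x - y)
    simp only [hf]
    refine (norm_sub_le _ _).trans ?_
    rw [norm_mul, norm_mul, norm_mul, norm_div, Real.norm_eq_abs, Real.norm_eq_abs, Real.norm_eq_abs, Real.norm_eq_abs, Real.norm_eq_abs,
      abs_of_pos hG0, abs_of_pos (show 0 < 2 * (t - s0) by linarith)]
    have k1 := mul_le_mul hG (UU_bd (α := a + 1/2) hM'0 (by linarith) hs1 hs1'.le hy c1) (abs_nonneg _) (by positivity)
    have k2 : |UU W a s0 y| ≤ s1 ^ (-a) * M := by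
      unfold UU
      rw [abs_mul, abs_of_pos (by positivity)]
      exact mul_le_mul (Real.rpow_le_rpow_of_nonpos hs1 hs1'.le (by linarith)) (b0 _ (by positivity)) (abs_nonneg _) (by positivity)
    have k3 : |x - y| / (2 * (t - s0)) ≤ (1 + |x|) / (2 * m) * (1 + y) ^ 2 := by
      rw [div_mul_eq_mul_div]
      apply div_le_div₀ (by positivity) _ (by positivity) (by linarith)
      have : |x - y| ≤ |x| + |y| := abs_sub _ _
      rw [abs_of_nonneg hy] at this
      have : (1 + |x|) * (1 + y) ≤ (1 + |x|) * (1 + y) ^ 2 := by gcongr; nlinarith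
      nlinarith [abs_nonneg x, mul_nonneg (abs_nonneg x) hy]
    have k4 := mul_le_mul (mul_le_mul k3 hG hG0.le (by positivity)) k2 (abs_nonneg _) (by positivity)
    refine (add_le_add k1 k4).trans (le_of_eq ?_)
    simp only [Env, hCU]; ring
  have ft : Tendsto f atTop (𝓝 0) := by
    refine squeeze_zero_norm' ?_ (by have h9 := (Env_tendsto ht).const_mul (CG * CU (a+1/2) + (1 + |x|) / (2 * m) * CG * (s1 ^ (-a) * M)); rw [mul_zero] at h9; exact h9)
    filter_upwards [eventually_ge_atTop 0] with y hy
    exact fb y hy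
  have := integral_Ioi_of_hasDerivAt_of_tendsto (fd 0 le_rfl).continuousAt.continuousWithinAt
    (fun y hy => fd y (le_of_lt hy)) hI ft
  rw [this]
  simp only [hf]
  rw [sub_zero]; ring
end


lemma Gam_lip {t : ℝ} (ht : 0 < t) : ∃ C, 0 ≤ C ∧ ∀ s, 0 < s → s < t / 2 → ∀ x y : ℝ,
    |Gam (t - s) (x - y) - Gam t x| ≤ C * (|y| + s) := by
  set m := t / 2 with hm
  have hm0 : 0 < m := by positivity
  set B := m ^ (-(1/2):ℝ) with hB
  have hB0 : 0 < B := by positivity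
  have bd : ∀ τ, m ≤ τ → τ ≤ t → ∀ z, Gam τ z ≤ B ∧ |(z ^ 2 / (4 * τ ^ 2) - 1 / (2 * τ)) * Gam τ z| ≤ 3 / m * B := by
    intro τ h1 h2 z
    have h := Gam_bd hm0 h1 h2 z
    have : Real.exp (-z ^ 2 / (8 * t)) ≤ 1 := by
      rw [Real.exp_le_one_iff]
      apply div_nonpos_of_nonpos_of_nonneg <;> nlinarith [sq_nonneg z]
    have h3 : B * Real.exp (-z ^ 2 / (8 * t)) ≤ B := mul_le_of_le_one_right hB0.le this
    exact ⟨h.1.trans h3, h.2.trans (by gcongr)⟩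
  set C := 3 / m * B + (1 / (2 * m) + 1/4) * B with hC
  have hC0 : 0 ≤ C := by positivity
  have bz : ∀ τ, m ≤ τ → τ ≤ t → ∀ z, |-z / (2 * τ) * Gam τ z| ≤ C := by
    intro τ h1 h2 z
    have hτ : 0 < τ := by linarith
    obtain ⟨k1, k2⟩ := bd τ h1 h2 z
    have hG := Gam_pos hτ z
    rw [abs_mul, abs_of_pos hG, abs_div, abs_neg, abs_of_pos (show 0 < 2 * τ by linarith)]
    have k3 := (abs_le.1 k2).2
    have k4 : |z| / (2 * τ) ≤ z ^ 2 / (4 * τ ^ 2) + 1/4 := by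
      have : z ^ 2 / (4 * τ ^ 2) = (|z| / (2 * τ)) ^ 2 := by
        rw [div_pow, sq_abs]; ring
      rw [this]; nlinarith [sq_nonneg (|z| / (2 * τ) - 1/2)]
    have k5 : 1 / (2 * τ) ≤ 1 / (2 * m) := by
      apply one_div_le_one_div_of_le <;> linarith
    have k6 := mul_le_mul_of_nonneg_right k4 hG.le
    have k7 : (1 / (2 * τ) + 1/4) * Gam τ z ≤ (1 / (2 * m) + 1/4) * B := by
      apply mul_le_mul (by linarith) k1 hG.le (by positivity)
    rw [hC]; linarith
  have hCB : 3 / m * B ≤ C := by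
    have : 0 ≤ (1 / (2 * m) + 1/4) * B := by positivity
    linarith
  refine ⟨C, hC0, ?_⟩
  intro s hs hs2 x y
  have h1 : |Gam (t - s) (x - y) - Gam (t - s) x| ≤ C * |y| := by
    have := Convex.norm_image_sub_le_of_norm_hasDerivWithin_le (𝕜 := ℝ) (s := univ) (x := x) (y := x - y)
      (f := fun z => Gam (t - s) z) (f' := fun z => -z / (2 * (t - s)) * Gam (t - s) z) (C := C)
      (fun z _ => (Gam_dz (by linarith) z).hasDerivWithinAt)
      (fun z _ => bz (t - s) (by linarith) (by linarith) z) convex_univ (mem_univ _) (mem_univ _)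
    simpa using this
  have h2 : |Gam (t - s) x - Gam t x| ≤ C * s := by
    have := Convex.norm_image_sub_le_of_norm_hasDerivWithin_le (𝕜 := ℝ) (s := Icc m t) (x := t) (y := t - s)
      (f := fun τ => Gam τ x) (f' := fun τ => (x ^ 2 / (4 * τ ^ 2) - 1 / (2 * τ)) * Gam τ x) (C := C)
      (fun τ hτ => (Gam_dtau (by linarith [hτ.1]) x).hasDerivWithinAt)
      (fun τ hτ => (bd τ hτ.1 hτ.2 x).2.trans hCB) (convex_Icc _ _) ⟨by linarith, le_rfl⟩ ⟨by linarith, by linarith⟩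
    simpa [abs_of_pos hs] using this
  calc |Gam (t - s) (x - y) - Gam t x| = |(Gam (t - s) (x - y) - Gam (t - s) x) + (Gam (t - s) x - Gam t x)| := by ring_nf
    _ ≤ _ := abs_add_le _ _
    _ ≤ _ := by linarith

section
variable {W W1 W2 : ℝ → ℝ} {a : ℝ}

/-- behaviour as `s → 0` -/
lemma J_zero (hWc : Continuous W) (ha1 : a < 1)
    (hi : IntegrableOn (fun η => (1 + η) * W η) (Ioi 0)) {t : ℝ} (ht : 0 < t) (x : ℝ) :
    Tendsto (fun s => (∫ y in Ioi (0:ℝ), Gam (t - s) (x - y) * UU W a s y)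
      - Gam t x * (s ^ (1/2 - a) * ∫ η in Ioi (0:ℝ), W η)) (𝓝[>] 0) (𝓝 0) := by
  obtain ⟨C, hC, hl⟩ := Gam_lip ht
  have hi0 : IntegrableOn W (Ioi 0) := by
    refine Integrable.mono hi hWc.aestronglyMeasurable ?_
    rw [ae_restrict_iff' measurableSet_Ioi]
    refine ae_of_all _ (fun η hη => ?_)
    have hη0 : (0:ℝ) < η := hη
    rw [norm_mul]
    apply le_mul_of_one_le_left (norm_nonneg _)
    rw [Real.norm_of_nonneg (by linarith)]; linarith
  set I := ∫ η in Ioi (0:ℝ), ‖(1 + η) * W η‖ with hI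
  have hI0 : 0 ≤ I := integral_nonneg (fun _ => norm_nonneg _)
  have T : Tendsto (fun s : ℝ => C * I * s ^ (1 - a)) (𝓝[>] 0) (𝓝 0) := by
    have h1 : Tendsto (fun s : ℝ => s ^ (1 - a)) (𝓝[>] 0) (𝓝 0) := by
      have := (Real.continuousAt_rpow_const 0 (1 - a) (Or.inr (by linarith))).tendsto
      rw [Real.zero_rpow (by linarith)] at this
      exact this.mono_left nhdsWithin_le_nhds
    simpa using h1.const_mul (C * I)
  refine squeeze_zero_norm' ?_ T
  have hmin : 0 < min 1 (t/2) := by positivity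
  filter_upwards [Ioo_mem_nhdsGT hmin] with s hs
  have hs0 : 0 < s := hs.1
  have hs1 : s < 1 := hs.2.trans_le (min_le_left _ _)
  have hs2 : s < t / 2 := hs.2.trans_le (min_le_right _ _)
  set b := s ^ (-(1/2):ℝ) with hb
  have hb0 : 0 < b := by positivity
  have hbs : b⁻¹ = s ^ (1/2:ℝ) := by rw [hb, ← Real.rpow_neg hs0.le]; norm_num
  have e1 : ∫ y in Ioi (0:ℝ), Gam (t - s) (x - y) * UU W a s y
      = s ^ (1/2 - a) * ∫ η in Ioi (0:ℝ), Gam (t - s) (x - b⁻¹ * η) * W η := by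
    have := integral_comp_mul_right_Ioi (fun η => s ^ (-a) * (Gam (t - s) (x - b⁻¹ * η) * W η)) 0 hb0
    rw [zero_mul, smul_eq_mul] at this
    rw [show (1/2 - a) = 1/2 + -a by ring, Real.rpow_add hs0, mul_assoc, ← hbs, ← integral_const_mul, ← this]
    congr 1; ext y
    have hy : b⁻¹ * (y * b) = y := by field_simp
    rw [UU, ← hb, hy]
    ring
  have cG : Continuous (fun η => Gam (t - s) (x - b⁻¹ * η)) := by unfold Gam; fun_prop
  have bd : ∀ η, 0 < η → |Gam (t - s) (x - b⁻¹ * η) - Gam t x| ≤ C * s ^ (1/2:ℝ) * (1 + η) := by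
    intro η hη
    refine (hl s hs0 hs2 x (b⁻¹ * η)).trans ?_
    rw [hbs, abs_of_nonneg (by positivity)]
    have : s ≤ s ^ (1/2:ℝ) := by
      have := Real.rpow_le_rpow_of_exponent_ge hs0 hs1.le (show (1/2:ℝ) ≤ 1 by norm_num)
      rwa [Real.rpow_one] at this
    have := mul_le_mul_of_nonneg_left this hC
    linarith
  have iG : IntegrableOn (fun η => (Gam (t - s) (x - b⁻¹ * η) - Gam t x) * W η) (Ioi 0) := by
    refine Integrable.mono' (hi.norm.const_mul (C * s ^ (1/2:ℝ))) ((cG.sub continuous_const).mul hWc).aestronglyMeasurable ?_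
    rw [ae_restrict_iff' measurableSet_Ioi]
    refine ae_of_all _ (fun η hη => ?_)
    have hη0 : (0:ℝ) < η := hη
    rw [norm_mul, norm_mul, Real.norm_of_nonneg (by linarith : 0 ≤ 1 + η), ← mul_assoc]
    exact mul_le_mul_of_nonneg_right (bd η hη) (norm_nonneg _)
  have e2 : ∫ η in Ioi (0:ℝ), Gam (t - s) (x - b⁻¹ * η) * W η =
      (∫ η in Ioi (0:ℝ), (Gam (t - s) (x - b⁻¹ * η) - Gam t x) * W η) + Gam t x * ∫ η in Ioi (0:ℝ), W η := by
    rw [← integral_const_mul, ← integral_add iG (hi0.const_mul _)]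
    congr 1; ext η; ring
  have e3 : ‖∫ η in Ioi (0:ℝ), (Gam (t - s) (x - b⁻¹ * η) - Gam t x) * W η‖ ≤ C * s ^ (1/2:ℝ) * I := by
    rw [hI, ← integral_const_mul]
    apply norm_integral_le_of_norm_le (hi.norm.const_mul _)
    rw [ae_restrict_iff' measurableSet_Ioi]
    refine ae_of_all _ (fun η hη => ?_)
    have hη0 : (0:ℝ) < η := hη
    rw [norm_mul, norm_mul, Real.norm_of_nonneg (by linarith : 0 ≤ 1 + η), ← mul_assoc]
    exact mul_le_mul_of_nonneg_right (bd η hη) (norm_nonneg _)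
  rw [e1, e2]
  have : s ^ (1/2 - a) * ((∫ η in Ioi (0:ℝ), (Gam (t - s) (x - b⁻¹ * η) - Gam t x) * W η) + Gam t x * ∫ η in Ioi (0:ℝ), W η)
      - Gam t x * (s ^ (1/2 - a) * ∫ η in Ioi (0:ℝ), W η) =
      s ^ (1/2 - a) * ∫ η in Ioi (0:ℝ), (Gam (t - s) (x - b⁻¹ * η) - Gam t x) * W η := by ring
  rw [this, norm_mul, Real.norm_of_nonneg (by positivity)]
  calc s ^ (1/2 - a) * ‖∫ η in Ioi (0:ℝ), (Gam (t - s) (x - b⁻¹ * η) - Gam t x) * W η‖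
      ≤ s ^ (1/2 - a) * (C * s ^ (1/2:ℝ) * I) := by gcongr
    _ = C * I * (s ^ (1/2 - a) * s ^ (1/2:ℝ)) := by ring
    _ = _ := by rw [← Real.rpow_add hs0]; congr 2; ring

lemma Gam_int {τ : ℝ} (hτ : 0 < τ) (x : ℝ) : Integrable (fun y => Gam τ (x - y)) := by
  have h : Integrable (fun y => Gam τ y) := by
    have := (integrable_exp_neg_mul_sq (b := 1 / (4 * τ)) (by positivity)).const_mul (τ ^ (-(1/2):ℝ))
    refine this.congr (ae_of_all _ (fun y => ?_))
    simp only [Gam]; congr 2; ring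
  exact h.comp_sub_left x

lemma Gam_sub {τ : ℝ} (hτ : 0 < τ) (x : ℝ) (V : ℝ → ℝ) :
    ∫ y, Gam τ (x - y) * V y = ∫ z, Real.exp (-(1/4) * z ^ 2) * V (x - √τ * z) := by
  have h1 := integral_sub_left_eq_self (fun y => Gam τ (x - y) * V y) volume x
  rw [← h1]
  simp only [sub_sub_cancel]
  have h2 := Measure.integral_comp_mul_left (fun z => Gam τ z * V (x - z)) (√τ)
  have hs : 0 < √τ := Real.sqrt_pos.2 hτ
  rw [abs_of_pos (inv_pos.2 hs), smul_eq_mul] at h2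
  have h3 : ∫ z, Gam τ z * V (x - z) = √τ * ∫ z, Gam τ (√τ * z) * V (x - √τ * z) := by
    rw [h2]; field_simp
  rw [h3, ← integral_const_mul]
  congr 1; ext z
  have : √τ * Gam τ (√τ * z) = Real.exp (-(1/4) * z ^ 2) := by
    unfold Gam
    rw [Real.sqrt_eq_rpow, ← mul_assoc, half_mul_neg_half hτ, one_mul, ← Real.sqrt_eq_rpow, mul_pow, Real.sq_sqrt hτ.le]
    congr 1; field_simp
  rw [← this]; ring

/-- behaviour as `s → t` -/
lemma J_end {M : ℝ} (ha : 0 ≤ a) (hM : 0 ≤ M) (hWc : Continuous W) (b0 : ∀ η, 0 ≤ η → |W η| ≤ M)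
    {t x : ℝ} (ht : 0 < t) (hx : 0 ≤ x) :
    Tendsto (fun s => (∫ y in Ioi (0:ℝ), Gam (t - s) (x - y) * UU W a s y)
      + ∫ y in Ioi (0:ℝ), Gam (t - s) (-x - y) * UU W a s y) (𝓝[<] t) (𝓝 (2 * √π * UU W a t x)) := by
  have cUU : ∀ s, Continuous (fun y => UU W a s |y|) := by
    intro s; unfold UU; fun_prop
  have bUU : ∀ s, t / 2 < s → ∀ y, abs (UU W a s (abs y)) ≤ (t/2) ^ (-a) * M := by
    intro s hs y
    have hs0 : 0 < s := by linarith
    unfold UU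
    rw [abs_mul, abs_of_pos (by positivity)]
    exact mul_le_mul (Real.rpow_le_rpow_of_nonpos (by positivity) hs.le (by linarith)) (b0 _ (by positivity)) (abs_nonneg _) (by positivity)
  have key : ∀ s, t / 2 < s → s < t → (∫ y in Ioi (0:ℝ), Gam (t - s) (x - y) * UU W a s y)
      + (∫ y in Ioi (0:ℝ), Gam (t - s) (-x - y) * UU W a s y)
      = ∫ z, Real.exp (-(1/4) * z ^ 2) * UU W a s |x - √(t - s) * z| := by
    intro s hs hst
    have hτ : 0 < t - s := by linarith
    rw [← Gam_sub hτ x (fun y => UU W a s |y|)]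
    have hintg : Integrable (fun y => Gam (t - s) (x - y) * UU W a s |y|) := by
      refine (Gam_int hτ x).mul_bdd (c := (t/2) ^ (-a) * M) (cUU s).aestronglyMeasurable ?_
      exact ae_of_all _ (bUU s hs)
    rw [← intervalIntegral.integral_Iic_add_Ioi (b := 0) hintg.integrableOn hintg.integrableOn, add_comm]
    congr 1
    · have := integral_comp_neg_Ioi 0 (fun y => Gam (t - s) (x - y) * UU W a s |y|)
      rw [neg_zero] at this
      rw [← this]
      apply setIntegral_congr_fun measurableSet_Ioi
      intro y hy
      have hy0 : (0:ℝ) < y := hy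
      simp only [abs_neg, abs_of_pos hy0]
      rw [← Gam_neg]; congr 2; ring
    · apply setIntegral_congr_fun measurableSet_Ioi
      intro y hy
      have hy0 : (0:ℝ) < y := hy
      simp only [abs_of_pos hy0]
  have G := integrable_exp_neg_mul_sq (b := 1/4) (by norm_num)
  have lim : Tendsto (fun s => ∫ z, Real.exp (-(1/4) * z ^ 2) * UU W a s |x - √(t - s) * z|) (𝓝[<] t)
      (𝓝 (∫ z, Real.exp (-(1/4) * z ^ 2) * UU W a t x)) := by
    apply tendsto_integral_filter_of_dominated_convergence (fun z => Real.exp (-(1/4) * z ^ 2) * ((t/2) ^ (-a) * M))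
    · refine Eventually.of_forall (fun s => ?_)
      have := cUU s
      exact Continuous.aestronglyMeasurable (by
        refine Continuous.mul (by fun_prop) ?_
        exact this.comp (by fun_prop : Continuous (fun z => x - √(t - s) * z)))
    · filter_upwards [Ioo_mem_nhdsLT (show t / 2 < t by linarith)] with s hs
      refine ae_of_all _ (fun z => ?_)
      rw [norm_mul, Real.norm_of_nonneg (Real.exp_pos _).le]
      exact mul_le_mul_of_nonneg_left (bUU s hs.1 _) (Real.exp_pos _).le
    · exact G.mul_const _
    · refine ae_of_all _ (fun z => ?_)
      apply Tendsto.const_mul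
      have c : ContinuousAt (fun s => UU W a s |x - √(t - s) * z|) t := by
        unfold UU
        have h1 : ContinuousAt (fun s : ℝ => s ^ (-a)) t := Real.continuousAt_rpow_const t _ (Or.inl ht.ne')
        have h2 : ContinuousAt (fun s : ℝ => s ^ (-(1/2):ℝ)) t := Real.continuousAt_rpow_const t _ (Or.inl ht.ne')
        have h3 : ContinuousAt (fun s : ℝ => |x - √(t - s) * z|) t := by fun_prop
        exact h1.mul (hWc.continuousAt.comp (h3.mul h2))
      have := c.tendsto
      simp only [sub_self, Real.sqrt_zero, zero_mul, sub_zero, abs_of_nonneg hx] at this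
      exact this.mono_left nhdsWithin_le_nhds
  have val : ∫ z, Real.exp (-(1/4) * z ^ 2) * UU W a t x = 2 * √π * UU W a t x := by
    rw [integral_mul_const, integral_gaussian]
    congr 1
    rw [show π / (1/4) = 2 ^ 2 * π by ring, Real.sqrt_mul (by norm_num), Real.sqrt_sq (by norm_num)]
  rw [val] at lim
  refine lim.congr' ?_
  filter_upwards [Ioo_mem_nhdsLT (show t / 2 < t by linarith)] with s hs
  exact (key s hs.1 hs.2).symm

lemma UU_rep {M p : ℝ} (hp : 0 ≤ p) (ha : 0 ≤ a) (ha1 : a < 1) (hap : a * p = a + 1/2) (hM : 0 ≤ M) (hW : ∀ η, HasDerivAt W (W1 η) η)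
    (hW1 : ∀ η, 0 ≤ η → HasDerivAt W1 (W2 η) η) (hW1c : Continuous W1)
    (h2 : ∀ η, W2 η = -(η/2) * W1 η - a * W η)
    (b0 : ∀ η, 0 ≤ η → |W η| ≤ M) (b1 : ∀ η, 0 ≤ η → |W1 η| ≤ M * (1 + η))
    (hi : IntegrableOn (fun η => (1 + η) * W η) (Ioi 0)) (hc : 0 < W 0) (hb : W1 0 = W 0 ^ p) :
    RepP p (fun t x => UU W a t x) (fun s => s ^ (1/2 - a) * ∫ η in Ioi (0:ℝ), W η) := by
  have hWc : Continuous W := continuous_iff_continuousAt.2 (fun η => (hW η).continuousAt)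
  intro t x ht hx
  set J : ℝ → ℝ → ℝ := fun x s => ∫ y in Ioi (0:ℝ), Gam (t - s) (x - y) * UU W a s y with hJ
  have hB : ∀ r, 0 < r → UU W1 (a + 1/2) r 0 = (UU W a r 0) ^ p := by
    intro r hr
    unfold UU
    rw [zero_mul, hb, Real.mul_rpow (by positivity) hc.le, ← Real.rpow_mul hr.le, ← hap]
    congr 2; ring
  have hd : ∀ s, 0 < s → s < t → HasDerivAt (fun s => J x s + J (-x) s)
      (-(2 * Gam (t - s) x * (UU W a s 0) ^ p)) s := by
    intro s hs hst
    have d1 := J_deriv (x := x) ha hM hW hW1 hW1c h2 b0 b1 hs hst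
    have d2 := J_deriv (x := -x) ha hM hW hW1 hW1c h2 b0 b1 hs hst
    refine (d1.fun_add d2).congr_deriv ?_
    rw [Gam_neg, hB s hs]; ring
  have cB : ContinuousOn (fun r => (UU W a r 0) ^ p) (Ioi 0) := by
    apply ContinuousOn.rpow_const _ (fun x _ => Or.inr hp)
    unfold UU
    simp only [zero_mul]
    exact (contOn_rpow_neg (-a)).mul continuousOn_const
  have ftc : ∀ s, 0 < s → s < t → UU W a t x = (2 * √π)⁻¹ * (J x s + J (-x) s)
      - ∫ r in s..t, EE (t - r) x * (UU W a r 0) ^ p := by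
    intro s hs hst
    have iiF : IntervalIntegrable (fun r => EE (t - r) x * (UU W a r 0) ^ p) volume s t := by
      have : IntervalIntegrable (fun r => EE (t - r) x) volume s t := (EE_ii t x ht.le le_rfl).mono_set (by
          rw [uIcc_of_le hst.le, uIcc_of_le ht.le]
          exact Icc_subset_Icc hs.le le_rfl)
      apply this.mul_continuousOn
      apply cB.mono
      rw [uIcc_of_le hst.le]
      exact fun x hx => hs.trans_le hx.1
    have e : ∀ s', s < s' → s' < t → (2 * √π)⁻¹ * (J x s' + J (-x) s') =
       (2 * √π)⁻¹ * (J x s + J (-x) s) - ∫ r in s..s', EE (t - r) x * (UU W a r 0) ^ p := by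
      intro s' h1 h2
      have cF : ContinuousOn (fun r => -(2 * Gam (t - r) x * (UU W a r 0) ^ p)) (uIcc s s') := by
        rw [uIcc_of_le h1.le]
        apply ContinuousOn.neg
        apply ContinuousOn.mul
        · apply ContinuousOn.mul continuousOn_const
          intro r hr
          have := (Gam_dtau (show 0 < t - r by linarith [hr.2]) x).continuousAt
          exact (ContinuousAt.comp (f := fun r => t - r) (g := fun τ => Gam τ x) this (by fun_prop)).continuousWithinAt
        · exact cB.mono (fun r hr => hs.trans_le hr.1)
      have f := intervalIntegral.integral_eq_sub_of_hasDerivAt (a := s) (b := s')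
        (f := fun s => J x s + J (-x) s) (f' := fun s => -(2 * Gam (t - s) x * (UU W a s 0) ^ p))
        (by
          intro r hr
          rw [uIcc_of_le h1.le] at hr
          exact hd r (hs.trans_le hr.1) (hr.2.trans_lt h2))
        cF.intervalIntegrable
      have g : ∫ r in s..s', EE (t - r) x * (UU W a r 0) ^ p
          = -(2 * √π)⁻¹ * ∫ r in s..s', -(2 * Gam (t - r) x * (UU W a r 0) ^ p) := by
        rw [← intervalIntegral.integral_const_mul]
        congr 1; ext r; rw [EE_Gam]; field_simp
      rw [g, f]; ring
    have L1 : Tendsto (fun s' => (2 * √π)⁻¹ * (J x s' + J (-x) s')) (𝓝[<] t) (𝓝 (UU W a t x)) := by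
      have := (J_end ha hM hWc b0 ht hx).const_mul (2 * √π)⁻¹
      have hpi : √π ≠ 0 := by positivity
      rwa [← mul_assoc, inv_mul_cancel₀ (by positivity), one_mul] at this
    have L2 : Tendsto (fun s' => ∫ r in s..s', EE (t - r) x * (UU W a r 0) ^ p) (𝓝[<] t)
        (𝓝 (∫ r in s..t, EE (t - r) x * (UU W a r 0) ^ p)) := by
      have h := intervalIntegral.continuousOn_primitive_interval' iiF left_mem_uIcc
      have h3 := (h t right_mem_uIcc).tendsto
      refine h3.mono_left ?_
      rw [uIcc_of_le hst.le, ← nhdsWithin_Ioo_eq_nhdsLT hst]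
      exact nhdsWithin_mono _ Ioo_subset_Icc_self
    refine tendsto_nhds_unique L1 (((tendsto_const_nhds (x := (2 * √π)⁻¹ * (J x s + J (-x) s))).sub L2).congr' ?_)
    filter_upwards [Ioo_mem_nhdsLT hst] with s' hs'
    exact (e s' hs'.1 hs'.2).symm
  have Z := ((J_zero hWc ha1 hi ht x).add (J_zero hWc ha1 hi ht (-x))).const_mul (2 * √π)⁻¹
  have Z2 := (tendsto_const_nhds (x := UU W a t x)).sub Z
  simp only [add_zero, mul_zero, sub_zero] at Z2
  refine Z2.congr' ?_
  filter_upwards [Ioo_mem_nhdsGT ht] with s hs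
  rw [ftc s hs.1 hs.2, Gam_neg, EE_Gam]
  simp only [hJ]
  have hpi : √π ≠ 0 := by positivity
  field_simp
  ring
end

/-- Part B: the self-similar solution has the renormalised representation. -/
theorem profile_rep {p : ℝ} (hp1 : 3/2 < p) (ω : H1K) (hω : IsWeakProfile p ω)
    (hpos : 0 < ω.toFun 0) :
    ∃ (U : ℝ → ℝ → ℝ) (L : ℝ → ℝ), RepP p U L ∧
      (∀ t x, 0 < t → 0 ≤ x → U t x = t ^ (-(1 / (2 * (p - 1)))) * ω.toFun (x / √t)) := by
  obtain ⟨W, W1, e0, hW, hW1, hb, hW1c, M, hM, b0, b1, hi⟩ := profile_classical (by linarith) ω hω hpos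
  set a := 1 / (2 * (p - 1)) with ha
  have hpp : 0 < p - 1 := by linarith
  have ha0 : 0 < a := by positivity
  have ha1 : a < 1 := by rw [ha, div_lt_one (by linarith)]; linarith
  have hap : a * p = a + 1/2 := by rw [ha]; field_simp; ring
  refine ⟨fun t x => UU W a t x, _, UU_rep (W2 := fun η => -(η/2) * W1 η - a * W η) (by linarith) ha0.le ha1 hap hM hW hW1 hW1c (fun _ => rfl)
    b0 b1 hi (by rw [e0 0 le_rfl]; exact hpos) (by rw [hb, e0 0 le_rfl]), ?_⟩
  intro t x ht hx
  simp only [UU]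
  rw [Real.rpow_neg ht.le (1/2), ← Real.sqrt_eq_rpow, ← div_eq_mul_inv, e0 _ (by positivity)]


lemma test_D {ζ : ℝ → ℝ → ℝ} (hz : IsTestFunInf ζ) :
    Continuous (fun q : ℝ × ℝ => deriv (fun s => ζ s q.2) q.1 + deriv (deriv (ζ q.1)) q.2) ∧
    HasCompactSupport (fun q : ℝ × ℝ => deriv (fun s => ζ s q.2) q.1 + deriv (deriv (ζ q.1)) q.2) := by
  obtain ⟨h2, hc, -⟩ := hz
  set Z := fun q : ℝ × ℝ => ζ q.1 q.2 with hZ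
  have d1 : Differentiable ℝ Z := h2.differentiable (by norm_num)
  have f1 : ContDiff ℝ 1 (fderiv ℝ Z) := h2.fderiv_right (by norm_num)
  set Y := fun q : ℝ × ℝ => fderiv ℝ Z q (0, 1) with hY
  have hY1 : ContDiff ℝ 1 Y := f1.clm_apply contDiff_const
  have dY : Differentiable ℝ Y := hY1.differentiable (by norm_num)
  have et : ∀ t x, deriv (fun s => ζ s x) t = fderiv ℝ Z (t, x) (1, 0) := by
    intro t x
    have h : HasDerivAt (fun s : ℝ => (s, x)) (1, 0) t := (hasDerivAt_id t).prodMk (hasDerivAt_const t x)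
    exact (((d1 (t, x)).hasFDerivAt).comp_hasDerivAt t h).deriv
  have ex : ∀ (V : ℝ × ℝ → ℝ), Differentiable ℝ V → ∀ t x, deriv (fun y => V (t, y)) x = fderiv ℝ V (t, x) (0, 1) := by
    intro V hV t x
    have h : HasDerivAt (fun s : ℝ => (t, s)) (0, 1) x := (hasDerivAt_const x t).prodMk (hasDerivAt_id x)
    exact (((hV (t, x)).hasFDerivAt).comp_hasDerivAt x h).deriv
  have e : (fun q : ℝ × ℝ => deriv (fun s => ζ s q.2) q.1 + deriv (deriv (ζ q.1)) q.2)
      = fun q => fderiv ℝ Z q (1, 0) + fderiv ℝ Y q (0, 1) := by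
    funext q
    rw [et]
    have : deriv (ζ q.1) = fun y => Y (q.1, y) := by
      funext y
      exact ex Z d1 q.1 y
    rw [this, ex Y dY]
  rw [e]
  have cY : HasCompactSupport Y := by
    have := hc.fderiv_apply ℝ (0, 1)
    exact this
  constructor
  · exact ((h2.continuous_fderiv (by norm_num)).clm_apply continuous_const).add
      ((hY1.continuous_fderiv (by norm_num)).clm_apply continuous_const)
  · exact (hc.fderiv_apply ℝ (1, 0)).add (cY.fderiv_apply ℝ (0, 1))

lemma weak_prod {p ℓ : ℝ} {u : ℝ → ℝ → ℝ} (h : IsWeakSolDelta p ℓ u) {ζ : ℝ → ℝ → ℝ} (hz : IsTestFunInf ζ)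
    {D : ℝ → ℝ → ℝ} (hD : ∀ t x, 0 < t → 0 < x → deriv (fun s => ζ s x) t + deriv (deriv (ζ t)) x = D t x) :
    IntegrableOn (fun q : ℝ × ℝ => D q.1 q.2 * u q.1 q.2) (Ioi 0 ×ˢ Ioi 0) ∧
    (∫ q in Ioi (0:ℝ) ×ˢ Ioi (0:ℝ), D q.1 q.2 * u q.1 q.2)
      = (∫ t in Ioi (0:ℝ), |u t 0| ^ (p - 1) * u t 0 * ζ t 0) - ℓ * ζ 0 0 := by
  obtain ⟨hu, -, -, hw⟩ := h
  obtain ⟨hc, hs⟩ := test_D hz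
  set DD := (fun q : ℝ × ℝ => deriv (fun s => ζ s q.2) q.1 + deriv (deriv (ζ q.1)) q.2) with hDD
  have hQ : MeasurableSet (Ioi (0:ℝ) ×ˢ Ioi (0:ℝ)) := measurableSet_Ioi.prod measurableSet_Ioi
  have i1 : IntegrableOn (fun q : ℝ × ℝ => DD q * u q.1 q.2) (Ici 0 ×ˢ Ici 0) := by
    have hcl : IsClosed (Ici (0:ℝ) ×ˢ Ici (0:ℝ)) := isClosed_Ici.prod isClosed_Ici
    have hK : IsCompact (tsupport DD ∩ (Ici (0:ℝ) ×ˢ Ici (0:ℝ))) := IsCompact.inter_right hs hcl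
    have i0 := hu.integrableOn_compact_subset inter_subset_right hK
    have i2 := i0.continuousOn_mul hc.continuousOn hK
    refine i2.of_forall_sdiff_eq_zero hcl.measurableSet ?_
    intro q hq
    have : q ∉ tsupport DD := fun h => hq.2 ⟨h, hq.1⟩
    rw [image_eq_zero_of_notMem_tsupport this, zero_mul]
  have i3 := i1.mono_set (prod_mono Ioi_subset_Ici_self Ioi_subset_Ici_self : Ioi (0:ℝ) ×ˢ Ioi (0:ℝ) ⊆ _)
  have ee : EqOn (fun q : ℝ × ℝ => DD q * u q.1 q.2) (fun q : ℝ × ℝ => D q.1 q.2 * u q.1 q.2) (Ioi 0 ×ˢ Ioi 0) := by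
    intro q hq
    simp only [hDD]
    rw [hD q.1 q.2 hq.1 hq.2]
  refine ⟨i3.congr_fun ee hQ, ?_⟩
  rw [← setIntegral_congr_fun hQ ee]
  have := hw ζ hz
  have fub : ∫ q in Ioi (0:ℝ) ×ˢ Ioi (0:ℝ), DD q * u q.1 q.2 = ∫ t in Ioi (0:ℝ), ∫ x in Ioi (0:ℝ),
        (deriv (fun s => ζ s x) t + deriv (deriv (ζ t)) x) * u t x := by
    rw [Measure.volume_eq_prod] at i3 ⊢
    rw [setIntegral_prod _ i3]
  rw [fub]; linarith

/-- primitive of the smooth step -/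
noncomputable def PP (y : ℝ) : ℝ := ∫ s in (0:ℝ)..y, Real.smoothTransition s

lemma PP_deriv (y : ℝ) : HasDerivAt PP (Real.smoothTransition y) y :=
  intervalIntegral.integral_hasDerivAt_right (Real.smoothTransition.continuous.intervalIntegrable _ _)
    (Real.smoothTransition.continuous.stronglyMeasurableAtFilter _ _) Real.smoothTransition.continuous.continuousAt

lemma PP_contDiff : ContDiff ℝ 2 PP := by
  rw [show (2 : WithTop ℕ∞) = 1 + 1 by norm_num, contDiff_succ_iff_deriv]
  refine ⟨fun y => (PP_deriv y).differentiableAt, by simp, ?_⟩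
  rw [show deriv PP = Real.smoothTransition from funext fun y => (PP_deriv y).deriv]
  exact Real.smoothTransition.contDiff

lemma PP_nonpos {y : ℝ} (h : y ≤ 0) : PP y = 0 := by
  unfold PP
  rw [intervalIntegral.integral_congr (g := fun _ => 0)]
  · simp
  · intro s hs
    rw [uIcc_of_ge h] at hs
    exact Real.smoothTransition.zero_of_nonpos hs.2

lemma PP_mono : Monotone PP := by
  apply monotone_of_hasDerivAt_nonneg PP_deriv
  intro y; exact Real.smoothTransition.nonneg y

lemma PP_nonneg (y : ℝ) : 0 ≤ PP y := by
  rcases le_total y 0 with h | h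
  · rw [PP_nonpos h]
  · rw [← PP_nonpos le_rfl]; exact PP_mono h

lemma PP_le {y : ℝ} (h : -1 ≤ y) : PP y ≤ y + 1 := by
  have m : Monotone (fun y => y - PP y) := by
    apply monotone_of_hasDerivAt_nonneg (fun y => (hasDerivAt_id y).sub (PP_deriv y))
    intro y; have := Real.smoothTransition.le_one y; simp only [Pi.zero_apply]; linarith
  rcases le_total y 0 with h0 | h0
  · rw [PP_nonpos h0]; linarith
  · have := m h0
    simp only [PP_nonpos le_rfl] at this
    have h2 := m (show (-1:ℝ) ≤ 0 by norm_num)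
    have hm : Monotone (fun y => y - PP y) := m
    -- y - PP y ≥ 0 - 0
    linarith

lemma PP_ge (y : ℝ) : y - 1 ≤ PP y := by
  have m : Monotone (fun y => y - PP y) := by
    apply monotone_of_hasDerivAt_nonneg (fun y => (hasDerivAt_id y).sub (PP_deriv y))
    intro y; have := Real.smoothTransition.le_one y; simp only [Pi.zero_apply]; linarith
  rcases le_total y 1 with h0 | h0
  · linarith [PP_nonneg y]
  · have hd : ∀ z ∈ Icc (1:ℝ) y, z - PP z = 1 - PP 1 := by
      have := constant_of_has_deriv_right_zero (f := fun z => z - PP z) (a := 1) (b := y)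
        (fun z _ => ((hasDerivAt_id z).sub (PP_deriv z)).continuousAt.continuousWithinAt)
        (fun z hz => by
          have := ((hasDerivAt_id z).sub (PP_deriv z)).hasDerivWithinAt (s := Ici z)
          rw [Real.smoothTransition.one_of_one_le hz.1, sub_self] at this
          exact this)
      exact this
    have := hd y ⟨h0, le_rfl⟩
    linarith [PP_nonneg 1]

lemma ST_deriv_nonneg (y : ℝ) : 0 ≤ deriv Real.smoothTransition y := Real.smoothTransition.monotone.deriv_nonneg

lemma ST_hasDeriv (y : ℝ) : HasDerivAt Real.smoothTransition (deriv Real.smoothTransition y) y :=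
  ((Real.smoothTransition.contDiff (n := 1)).differentiable (by norm_num) y).hasDerivAt

lemma ST_deriv_cont : Continuous (deriv Real.smoothTransition) :=
  (Real.smoothTransition.contDiff (n := 1)).continuous_deriv (by norm_num)

lemma ST_deriv_zero {y : ℝ} (h : y ≤ 0 ∨ 1 ≤ y) : deriv Real.smoothTransition y = 0 := by
  rcases h with h | h
  · apply IsLocalMin.deriv_eq_zero
    refine Filter.Eventually.of_forall (fun z => ?_)
    rw [Real.smoothTransition.zero_of_nonpos h]; exact Real.smoothTransition.nonneg z
  · apply IsLocalMax.deriv_eq_zero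
    refine Filter.Eventually.of_forall (fun z => ?_)
    rw [Real.smoothTransition.one_of_one_le h]; exact Real.smoothTransition.le_one z

lemma ST_deriv_bdd : ∃ C, 0 ≤ C ∧ ∀ y, deriv Real.smoothTransition y ≤ C := by
  have : HasCompactSupport (deriv Real.smoothTransition) := by
    apply HasCompactSupport.intro (isCompact_Icc (a := (0:ℝ)) (b := 1))
    intro y hy
    apply ST_deriv_zero
    by_contra hc
    push Not at hc
    exact hy ⟨hc.1.le, hc.2.le⟩
  obtain ⟨C, hC⟩ := this.exists_bound_of_continuous ST_deriv_cont
  exact ⟨C, (norm_nonneg _).trans (hC 0), fun y => (le_abs_self _).trans (hC y)⟩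


noncomputable def NN (x0 τ x : ℝ) : ℝ := Gam τ (x - x0) + Gam τ (x + x0)

noncomputable def NNx (x0 τ x : ℝ) : ℝ :=
  -(x - x0) / (2 * τ) * Gam τ (x - x0) + -(x + x0) / (2 * τ) * Gam τ (x + x0)

noncomputable def NNt (x0 τ x : ℝ) : ℝ :=
  ((x - x0) ^ 2 / (4 * τ ^ 2) - 1 / (2 * τ)) * Gam τ (x - x0) +
  ((x + x0) ^ 2 / (4 * τ ^ 2) - 1 / (2 * τ)) * Gam τ (x + x0)

lemma NN_pos {x0 τ x : ℝ} (h : 0 < τ) : 0 < NN x0 τ x := add_pos (Gam_pos h _) (Gam_pos h _)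

lemma NN_dt {x0 T t x : ℝ} (h : t < T) : HasDerivAt (fun s => NN x0 (T - s) x) (-NNt x0 (T - t) x) t := by
  have h0 : 0 < T - t := by linarith
  have hd : HasDerivAt (fun s : ℝ => T - s) (-1) t := by simpa using (hasDerivAt_id t).const_sub T
  have := ((Gam_dtau h0 (x - x0)).comp t hd).add ((Gam_dtau h0 (x + x0)).comp t hd)
  refine this.congr_deriv ?_
  unfold NNt; ring

lemma NN_dx {x0 τ x : ℝ} (h : 0 < τ) : HasDerivAt (fun y => NN x0 τ y) (NNx x0 τ x) x := by
  have := ((Gam_dz h (x - x0)).comp x ((hasDerivAt_id x).sub_const x0)).add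
    ((Gam_dz h (x + x0)).comp x ((hasDerivAt_id x).add_const x0))
  refine this.congr_deriv ?_
  unfold NNx; ring

lemma Gam_dzz {τ : ℝ} (h : 0 < τ) (z : ℝ) :
    HasDerivAt (fun z => -z / (2 * τ) * Gam τ z) ((z ^ 2 / (4 * τ ^ 2) - 1 / (2 * τ)) * Gam τ z) z := by
  have h1 : HasDerivAt (fun z : ℝ => -z / (2 * τ)) (-1 / (2 * τ)) z := ((hasDerivAt_id z).fun_neg).div_const _
  refine (h1.mul (Gam_dz h z)).congr_deriv ?_
  field_simp; ring

lemma NN_dxx {x0 τ x : ℝ} (h : 0 < τ) : HasDerivAt (fun y => NNx x0 τ y) (NNt x0 τ x) x := by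
  have := ((Gam_dzz h (x - x0)).comp x ((hasDerivAt_id x).sub_const x0)).add
    ((Gam_dzz h (x + x0)).comp x ((hasDerivAt_id x).add_const x0))
  refine this.congr_deriv ?_
  unfold NNt; ring

noncomputable def FF (x0 δ T t x : ℝ) : ℝ := δ * PP (NN x0 (T - t) x / δ - 1)

noncomputable def FD (x0 δ T t x : ℝ) : ℝ :=
  deriv Real.smoothTransition (NN x0 (T - t) x / δ - 1) / δ * NNx x0 (T - t) x ^ 2

lemma FF_dt {x0 δ T t x : ℝ} (hδ : 0 < δ) (h : t < T) : HasDerivAt (fun s => FF x0 δ T s x)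
    (-Real.smoothTransition (NN x0 (T - t) x / δ - 1) * NNt x0 (T - t) x) t := by
  have h1 := ((NN_dt (x0 := x0) (x := x) h).div_const δ).sub_const 1
  have := ((PP_deriv (NN x0 (T - t) x / δ - 1)).comp t h1).const_mul δ
  refine this.congr_deriv ?_
  field_simp

lemma FF_dx {x0 δ T t x : ℝ} (hδ : 0 < δ) (h : t < T) : HasDerivAt (fun y => FF x0 δ T t y)
    (Real.smoothTransition (NN x0 (T - t) x / δ - 1) * NNx x0 (T - t) x) x := by
  have h0 : 0 < T - t := by linarith
  have h1 := ((NN_dx (x0 := x0) (x := x) h0).div_const δ).sub_const 1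
  have := ((PP_deriv (NN x0 (T - t) x / δ - 1)).comp x h1).const_mul δ
  refine this.congr_deriv ?_
  field_simp

lemma FF_dxx {x0 δ T t x : ℝ} (h : t < T) :
    HasDerivAt (fun x => Real.smoothTransition (NN x0 (T - t) x / δ - 1) * NNx x0 (T - t) x)
    (FD x0 δ T t x + Real.smoothTransition (NN x0 (T - t) x / δ - 1) * NNt x0 (T - t) x) x := by
  have h0 : 0 < T - t := by linarith
  have h1 := ((NN_dx (x0 := x0) (x := x) h0).div_const δ).sub_const 1
  have := ((ST_hasDeriv (NN x0 (T - t) x / δ - 1)).comp x h1).mul (NN_dxx (x0 := x0) (x := x) h0)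
  refine this.congr_deriv ?_
  simp only [FD, Function.comp_apply]
  ring

lemma Gam_contDiffAt {q : ℝ × ℝ} {T c : ℝ} (h : q.1 < T) :
    ContDiffAt ℝ 2 (fun q : ℝ × ℝ => Gam (T - q.1) (q.2 + c)) q := by
  unfold Gam
  have h0 : T - q.1 ≠ 0 := by linarith
  have h1 : 4 * (T - q.1) ≠ 0 := by positivity
  have c1 : ContDiffAt ℝ 2 (fun q : ℝ × ℝ => T - q.1) q := by fun_prop
  refine (c1.rpow_const_of_ne h0).mul (ContDiffAt.exp ?_)
  exact ContDiffAt.div (by fun_prop) (by fun_prop) h1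

lemma FF_contDiffAt {x0 δ T : ℝ} {q : ℝ × ℝ} (h : q.1 < T) :
    ContDiffAt ℝ 2 (fun q : ℝ × ℝ => FF x0 δ T q.1 q.2) q := by
  unfold FF NN
  have h1 := (Gam_contDiffAt (c := -x0) h).add (Gam_contDiffAt (c := x0) h)
  simp only [← sub_eq_add_neg] at h1
  exact contDiffAt_const.mul (PP_contDiff.contDiffAt.comp q ((h1.div_const δ).sub contDiffAt_const))

lemma FF_zero {x0 δ T κ : ℝ} (hδ : 0 < δ) (hκ : 0 < κ) : ∃ R, 0 < R ∧ ∀ t x, -2 ≤ t → t ≤ T - κ → R ≤ |x| →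
    FF x0 δ T t x = 0 := by
  by_cases hT : -2 ≤ T - κ
  swap
  · exact ⟨1, one_pos, fun t x h1 h2 _ => by linarith⟩
  have hT2 : 0 < T + 2 := by linarith
  -- Gam ≤ κ^(-1/2) exp(-z^2/(8(T+2))) → 0
  have lim : Tendsto (fun y : ℝ => κ ^ (-(1/2):ℝ) * Real.exp (-y ^ 2 / (8 * (T + 2)))) atTop (𝓝 0) := by
    have h1 : Tendsto (fun y : ℝ => -y ^ 2 / (8 * (T + 2))) atTop atBot := by
      have := (tendsto_pow_atTop (α := ℝ) two_ne_zero).const_mul_atTop_of_neg (show -(1 / (8 * (T + 2))) < 0 by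
        apply neg_lt_zero.2; positivity)
      refine this.congr (fun y => ?_)
      ring
    simpa using (Real.tendsto_exp_atBot.comp h1).const_mul (κ ^ (-(1/2):ℝ))
  obtain ⟨R, hR⟩ := eventually_atTop.1 (lim.eventually (gt_mem_nhds (show 0 < δ / 2 by positivity)))
  have key : ∀ t z, -2 ≤ t → t ≤ T - κ → R ≤ |z| → Gam (T - t) z < δ / 2 := by
    intro t z h1 h2 h3
    have := hR |z| h3
    rw [sq_abs] at this
    exact (Gam_bd hκ (by linarith) (by linarith) z).1.trans_lt this
  refine ⟨|R| + |x0| + 1, by positivity, fun t x h1 h2 h3 => ?_⟩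
  have hRR := le_abs_self R
  have a1 := key t (x - x0) h1 h2 (by have := abs_sub_abs_le_abs_sub x x0; linarith)
  have a2 := key t (x + x0) h1 h2 (by have := abs_sub_abs_le_abs_sub x (-x0); rw [abs_neg, sub_neg_eq_add] at this; linarith)
  unfold FF
  rw [PP_nonpos, mul_zero]
  rw [sub_nonpos, div_le_one hδ]
  unfold NN; linarith

theorem weak_id {p ℓ : ℝ} {u : ℝ → ℝ → ℝ} (h : IsWeakSolDelta p ℓ u) {T κ δ x0 : ℝ} (hδ : 0 < δ) (hκ : 0 < κ)
    {A A1 : ℝ → ℝ} (hA : ContDiff ℝ 2 A) (hA1 : ∀ t, HasDerivAt A (A1 t) t) (hA0 : ∀ t, t ≤ -2 ∨ T - κ ≤ t → A t = 0) :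
    IntegrableOn (fun q : ℝ × ℝ => (A1 q.1 * FF x0 δ T q.1 q.2 + A q.1 * FD x0 δ T q.1 q.2) * u q.1 q.2) (Ioi 0 ×ˢ Ioi 0) ∧
    (∫ q in Ioi (0:ℝ) ×ˢ Ioi (0:ℝ), (A1 q.1 * FF x0 δ T q.1 q.2 + A q.1 * FD x0 δ T q.1 q.2) * u q.1 q.2)
      = (∫ t in Ioi (0:ℝ), |u t 0| ^ (p - 1) * u t 0 * (A t * FF x0 δ T t 0)) - ℓ * (A 0 * FF x0 δ T 0 0) := by
  have ev : ∀ t, T ≤ t → ∀ᶠ s in 𝓝 t, A s = 0 := by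
    intro t ht
    filter_upwards [lt_mem_nhds (show T - κ < t by linarith)] with s hs
    exact hA0 s (Or.inr hs.le)
  have hz : IsTestFunInf (fun t x => A t * FF x0 δ T t x) := by
    refine ⟨?_, ?_, ?_⟩
    · rw [contDiff_iff_contDiffAt]
      intro q
      rcases lt_or_ge q.1 T with hq | hq
      · exact (hA.contDiffAt.comp q contDiffAt_fst).mul (FF_contDiffAt hq)
      · have : (fun q : ℝ × ℝ => A q.1 * FF x0 δ T q.1 q.2) =ᶠ[𝓝 q] fun _ => 0 := by
          filter_upwards [continuousAt_fst.eventually (ev q.1 hq)] with r hr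
          rw [hr, zero_mul]
        exact contDiffAt_const.congr_of_eventuallyEq this
    · obtain ⟨R, hR, hR2⟩ := FF_zero (x0 := x0) (T := T) hδ hκ
      apply HasCompactSupport.intro ((isCompact_Icc (a := (-2:ℝ)) (b := T - κ)).prod (isCompact_Icc (a := -R) (b := R)))
      intro q hq
      change A q.1 * FF x0 δ T q.1 q.2 = 0
      by_cases h1 : -2 ≤ q.1
      swap
      · rw [hA0 q.1 (Or.inl (by linarith)), zero_mul]
      by_cases h2 : q.1 ≤ T - κ
      swap
      · rw [hA0 q.1 (Or.inr (by linarith)), zero_mul]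
      rw [hR2 q.1 q.2 h1 h2, mul_zero]
      by_contra hc
      push Not at hc
      rw [abs_lt] at hc
      exact hq ⟨⟨h1, h2⟩, hc.1.le, hc.2.le⟩
    · intro t
      rcases lt_or_ge t T with hq | hq
      · have := ((FF_dx (x0 := x0) (x := 0) hδ hq).const_mul (A t)).deriv
        rw [this]
        unfold NNx
        simp only [zero_sub, zero_add, Gam_neg]
        ring
      · have : A t = 0 := (ev t hq).self_of_nhds
        simp [this]
  apply weak_prod h hz (D := fun t x => A1 t * FF x0 δ T t x + A t * FD x0 δ T t x)
  intro t x ht hx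
  rcases lt_or_ge t T with hq | hq
  · have d1 := ((hA1 t).mul (FF_dt (x0 := x0) (x := x) hδ hq)).deriv
    have d2 : deriv (fun x => A t * FF x0 δ T t x) = fun x => A t * (Real.smoothTransition (NN x0 (T - t) x / δ - 1) * NNx x0 (T - t) x) := by
      funext y
      exact ((FF_dx (x0 := x0) (x := y) hδ hq).const_mul (A t)).deriv
    have d3 := ((FF_dxx (x0 := x0) (x := x) (δ := δ) hq).const_mul (A t)).deriv
    rw [d2, d3]
    have d1' : deriv (fun s => A s * FF x0 δ T s x) t = _ := d1
    rw [d1']; ring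
  · have e0 : A t = 0 := (ev t hq).self_of_nhds
    have e1 : A1 t = 0 := by
      have : A =ᶠ[𝓝 t] fun _ => 0 := ev t hq
      exact (hA1 t).unique ((hasDerivAt_const t (0:ℝ)).congr_of_eventuallyEq this)
    have e2 : deriv (fun s => A s * FF x0 δ T s x) t = 0 := by
      have : (fun s => A s * FF x0 δ T s x) =ᶠ[𝓝 t] fun _ => 0 := by
        filter_upwards [ev t hq] with s hs
        rw [hs, zero_mul]
      rw [this.deriv_eq]; simp
    have e3 : deriv (fun x => A t * FF x0 δ T t x) = fun _ => 0 := by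
      funext y; simp [e0]
    rw [e2, e3, e0, e1]; simp


noncomputable def th (T κ t : ℝ) : ℝ := Real.smoothTransition ((T - t) / κ - 1)
noncomputable def th1 (T κ t : ℝ) : ℝ := deriv Real.smoothTransition ((T - t) / κ - 1) / κ

lemma th_cd (T κ : ℝ) : ContDiff ℝ 2 (th T κ) := by
  unfold th
  exact (Real.smoothTransition.contDiff (n := 2)).comp (by fun_prop)

lemma th_deriv (T κ t : ℝ) : HasDerivAt (th T κ) (-th1 T κ t) t := by
  have h1 : HasDerivAt (fun t : ℝ => (T - t) / κ - 1) (-1 / κ) t :=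
    (((hasDerivAt_id t).const_sub T).div_const κ).sub_const 1
  refine ((ST_hasDeriv _).comp t h1).congr_deriv ?_
  unfold th1; ring

lemma th_nonneg (T κ t : ℝ) : 0 ≤ th T κ t := Real.smoothTransition.nonneg _
lemma th_le (T κ t : ℝ) : th T κ t ≤ 1 := Real.smoothTransition.le_one _
lemma th_zero {T κ t : ℝ} (hκ : 0 < κ) (h : T - κ ≤ t) : th T κ t = 0 := by
  apply Real.smoothTransition.zero_of_nonpos
  rw [sub_nonpos, div_le_one hκ]; linarith
lemma th_one {T κ t : ℝ} (hκ : 0 < κ) (h : t ≤ T - 2 * κ) : th T κ t = 1 := by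
  apply Real.smoothTransition.one_of_one_le
  rw [le_sub_iff_add_le, le_div_iff₀ hκ]; linarith
lemma th1_nonneg {T κ : ℝ} (hκ : 0 < κ) (t : ℝ) : 0 ≤ th1 T κ t := div_nonneg (ST_deriv_nonneg _) hκ.le
lemma th1_zero {T κ t : ℝ} (hκ : 0 < κ) (h : T - κ ≤ t ∨ t ≤ T - 2 * κ) : th1 T κ t = 0 := by
  unfold th1
  rw [ST_deriv_zero, zero_div]
  rcases h with h | h
  · left; rw [sub_nonpos, div_le_one hκ]; linarith
  · right; rw [le_sub_iff_add_le, le_div_iff₀ hκ]; linarith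
lemma th1_cont (T κ : ℝ) : Continuous (th1 T κ) := by
  unfold th1
  exact (ST_deriv_cont.comp (by fun_prop)).div_const κ

theorem weak_id2 {p ℓ : ℝ} {u : ℝ → ℝ → ℝ} (h : IsWeakSolDelta p ℓ u) {T κ δ : ℝ} (x0 : ℝ) (hδ : 0 < δ) (hκ : 0 < κ)
    {B B1 : ℝ → ℝ} (hB : ContDiff ℝ 2 B) (hB1 : ∀ t, HasDerivAt B (B1 t) t) :
    IntegrableOn (fun q : ℝ × ℝ => ((B1 q.1 * th T κ q.1 - B q.1 * th1 T κ q.1) * FF x0 δ T q.1 q.2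
      + B q.1 * th T κ q.1 * FD x0 δ T q.1 q.2) * u q.1 q.2) (Ioi 0 ×ˢ Ioi 0) ∧
    (∫ q in Ioi (0:ℝ) ×ˢ Ioi (0:ℝ), ((B1 q.1 * th T κ q.1 - B q.1 * th1 T κ q.1) * FF x0 δ T q.1 q.2
      + B q.1 * th T κ q.1 * FD x0 δ T q.1 q.2) * u q.1 q.2)
      = (∫ t in Ioi (0:ℝ), |u t 0| ^ (p - 1) * u t 0 * (B t * th T κ t * FF x0 δ T t 0))
        - ℓ * (B 0 * th T κ 0 * FF x0 δ T 0 0) := by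
  have hs : ContDiff ℝ 2 (fun t : ℝ => Real.smoothTransition (t + 2)) :=
    (Real.smoothTransition.contDiff (n := 2)).comp (by fun_prop)
  have hs1 : ∀ t, HasDerivAt (fun t : ℝ => Real.smoothTransition (t + 2)) (deriv Real.smoothTransition (t + 2)) t := by
    intro t
    refine ((ST_hasDeriv (t + 2)).comp t ((hasDerivAt_id t).add_const 2)).congr_deriv (mul_one _)
  have H := weak_id h (x0 := x0) (T := T) hδ hκ (hs.mul (hB.mul (th_cd T κ)))
    (fun t => (hs1 t).mul ((hB1 t).mul (th_deriv T κ t))) (by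
      rintro t (ht | ht)
      · have : Real.smoothTransition (t + 2) = 0 := Real.smoothTransition.zero_of_nonpos (by linarith)
        simp [this]
      · simp [th_zero hκ ht])
  have s1 : ∀ t : ℝ, 0 ≤ t → Real.smoothTransition (t + 2) = 1 := fun t ht =>
    Real.smoothTransition.one_of_one_le (by linarith)
  have s0 : ∀ t : ℝ, 0 ≤ t → deriv Real.smoothTransition (t + 2) = 0 := fun t ht =>
    ST_deriv_zero (Or.inr (by linarith))
  have hQ : MeasurableSet (Ioi (0:ℝ) ×ˢ Ioi (0:ℝ)) := measurableSet_Ioi.prod measurableSet_Ioi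
  obtain ⟨H1, H2⟩ := H
  have ee : EqOn (fun q : ℝ × ℝ =>
      ((deriv Real.smoothTransition (q.1 + 2) * (B * th T κ) q.1 + Real.smoothTransition (q.1 + 2) * (B1 q.1 * th T κ q.1 + B q.1 * (-th1 T κ q.1)))
        * FF x0 δ T q.1 q.2 + (Real.smoothTransition (q.1 + 2) * (B q.1 * th T κ q.1)) * FD x0 δ T q.1 q.2) * u q.1 q.2)
      (fun q : ℝ × ℝ => ((B1 q.1 * th T κ q.1 - B q.1 * th1 T κ q.1) * FF x0 δ T q.1 q.2
      + B q.1 * th T κ q.1 * FD x0 δ T q.1 q.2) * u q.1 q.2) (Ioi 0 ×ˢ Ioi 0) := by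
    intro q hq
    have h0 : (0:ℝ) < q.1 := hq.1
    simp only [s1 q.1 h0.le, s0 q.1 h0.le]; ring
  refine ⟨H1.congr_fun ee hQ, ?_⟩
  rw [← setIntegral_congr_fun hQ ee]
  refine H2.trans ?_
  congr 1
  · apply setIntegral_congr_fun measurableSet_Ioi
    intro t ht
    have h0 : (0:ℝ) < t := ht
    simp only [s1 t h0.le]; ring
  · simp only [s1 0 le_rfl]; ring

lemma FF_nonneg {x0 δ T t x : ℝ} (hδ : 0 < δ) : 0 ≤ FF x0 δ T t x := mul_nonneg hδ.le (PP_nonneg _)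

lemma FF_le {x0 δ T t x : ℝ} (hδ : 0 < δ) (h : t < T) : FF x0 δ T t x ≤ NN x0 (T - t) x := by
  unfold FF
  have h0 : 0 < NN x0 (T - t) x := NN_pos (by linarith)
  have := PP_le (y := NN x0 (T - t) x / δ - 1) (by have := div_pos h0 hδ; linarith)
  calc δ * PP (NN x0 (T - t) x / δ - 1) ≤ δ * (NN x0 (T - t) x / δ - 1 + 1) := by gcongr
    _ = _ := by field_simp; ring

lemma FF_ge {x0 δ T t x : ℝ} (hδ : 0 < δ) : NN x0 (T - t) x - 2 * δ ≤ FF x0 δ T t x := by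
  unfold FF
  have := PP_ge (NN x0 (T - t) x / δ - 1)
  calc NN x0 (T - t) x - 2 * δ = δ * (NN x0 (T - t) x / δ - 1 - 1) := by field_simp; ring
    _ ≤ _ := by gcongr

lemma FF_eq_zero {x0 δ T t x : ℝ} (hδ : 0 < δ) (h : NN x0 (T - t) x ≤ δ) : FF x0 δ T t x = 0 := by
  unfold FF
  rw [PP_nonpos, mul_zero]
  rw [sub_nonpos, div_le_one hδ]; exact h

lemma FF_cont0 {x0 δ T : ℝ} (x : ℝ) : ContinuousOn (fun t => FF x0 δ T t x) (Iio T) := by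
  intro t ht
  have h : ContinuousAt (fun q : ℝ × ℝ => FF x0 δ T q.1 q.2) (t, x) := (FF_contDiffAt (q := (t, x)) ht).continuousAt
  have h2 : ContinuousAt (fun t : ℝ => (t, x)) t := by fun_prop
  exact (ContinuousAt.comp (f := fun t : ℝ => (t, x)) (g := fun q : ℝ × ℝ => FF x0 δ T q.1 q.2) h h2).continuousWithinAt

lemma g_cont {p : ℝ} (hp : 1 < p) {u : ℝ → ℝ → ℝ}
    (hc : ContinuousOn (fun q : ℝ × ℝ => u q.1 q.2) (Ioi 0 ×ˢ Ici 0)) :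
    ContinuousOn (fun t => |u t 0| ^ (p - 1) * u t 0) (Ioi 0) := by
  have h1 : ContinuousOn (fun t => u t 0) (Ioi 0) := by
    have := hc.comp (f := fun t : ℝ => (t, (0:ℝ))) (s := Ioi 0) (by fun_prop) (fun t ht => ⟨ht, self_mem_Ici⟩)
    exact this
  exact (h1.abs.rpow_const (fun t _ => Or.inr (by linarith))).mul h1

lemma g_int1 {p ℓ : ℝ} (hp : 1 < p) {u : ℝ → ℝ → ℝ} (h : IsWeakSolDelta p ℓ u)
    (hn : ∀ t x : ℝ, 0 < t → 0 ≤ x → 0 ≤ u t x)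
    (hc : ContinuousOn (fun q : ℝ × ℝ => u q.1 q.2) (Ioi 0 ×ˢ Ici 0)) :
    IntegrableOn (fun t => |u t 0| ^ (p - 1) * u t 0) (Ioo 0 1) := by
  set g := fun t => |u t 0| ^ (p - 1) * u t 0 with hg
  have gc : ContinuousOn g (Ioi 0) := g_cont hp hc
  have g0 : ∀ t, 0 < t → 0 ≤ g t := fun t ht => mul_nonneg (by positivity) (hn t 0 ht le_rfl)
  have F1 : ∀ t, 0 < t → t < 4 → 1/2 ≤ FF 0 (1/4) 4 t 0 := by
    intro t h1 h2
    refine le_trans ?_ (FF_ge (by norm_num))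
    have : (1/2:ℝ) ≤ (4 - t) ^ (-(1/2):ℝ) := by
      have := Real.rpow_le_rpow_of_nonpos (x := 4 - t) (y := 4) (z := -(1/2)) (by linarith) (by linarith) (by norm_num)
      refine le_trans (le_of_eq ?_) this
      rw [show (4:ℝ) = 2 ^ (2:ℝ) by norm_num, ← Real.rpow_mul (by norm_num)]
      norm_num
    unfold NN Gam
    simp
    linarith
  set f := fun t => g t * (th 4 1 t * FF 0 (1/4) 4 t 0) with hf
  by_cases hi : IntegrableOn f (Ioi 0)
  · refine Integrable.mono' ((hi.mono_set Ioo_subset_Ioi_self).const_mul 2)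
      ((gc.mono Ioo_subset_Ioi_self).aestronglyMeasurable measurableSet_Ioo) ?_
    rw [ae_restrict_iff' measurableSet_Ioo]
    refine ae_of_all _ (fun t ht => ?_)
    rw [Real.norm_of_nonneg (g0 t ht.1)]
    simp only [hf]
    rw [th_one one_pos (by linarith [ht.2]), one_mul]
    nlinarith [F1 t ht.1 (by linarith [ht.2]), g0 t ht.1]
  · have key : ∀ ε : ℝ, 0 < ε → ∀ᵐ t ∂(volume.restrict (Ioi (0:ℝ))), ε < t → t < 1 → g t = 0 := by
      intro ε hε
      set B := fun t : ℝ => Real.smoothTransition (t / ε - 1) with hB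
      have cB : ContDiff ℝ 2 B := (Real.smoothTransition.contDiff (n := 2)).comp (by fun_prop)
      have dB : ∀ t, HasDerivAt B (deriv B t) t := fun t => (cB.differentiable (by norm_num) t).hasDerivAt
      have B0 : B 0 = 0 := Real.smoothTransition.zero_of_nonpos (by norm_num)
      obtain ⟨i1, e1⟩ := weak_id2 h (T := 4) (κ := 1) (δ := 1/4) 0 (by norm_num) one_pos
        (B := fun _ => 1) (B1 := fun _ => 0) contDiff_const (fun t => hasDerivAt_const t _)
      obtain ⟨i2, e2⟩ := weak_id2 h (T := 4) (κ := 1) (δ := 1/4) 0 (by norm_num) one_pos cB dB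
      obtain ⟨i3, e3⟩ := weak_id2 h (T := 4) (κ := 1) (δ := 1/4) 0 (by norm_num) one_pos
        (B := fun t => 1 + B t) (B1 := deriv B) (contDiff_const.add cB) (fun t => (dB t).const_add 1)
      have j2 : IntegrableOn (fun t => g t * (B t * th 4 1 t * FF 0 (1/4) 4 t 0)) (Ioi 0) := by
        have : IntegrableOn (fun t => g t * (B t * th 4 1 t * FF 0 (1/4) 4 t 0)) (Icc ε 3) := by
          apply ContinuousOn.integrableOn_Icc
          refine (gc.mono (fun t ht => hε.trans_le ht.1)).mul (((cB.continuous.continuousOn).mul (th_cd 4 1).continuous.continuousOn).mul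
            ((FF_cont0 0).mono (fun t ht => lt_of_le_of_lt ht.2 (by norm_num))))
        refine this.of_forall_sdiff_eq_zero measurableSet_Ioi ?_
        intro t ht
        by_cases h3 : t < ε
        · have : B t = 0 := Real.smoothTransition.zero_of_nonpos (by rw [sub_nonpos, div_le_one hε]; exact h3.le)
          simp [this]
        · have : 3 < t := by
            by_contra hc
            exact ht.2 ⟨by linarith, by linarith⟩
          simp [th_zero (T := 4) (t := t) one_pos (by linarith)]
      have z1 : ∫ t in Ioi (0:ℝ), g t * (1 * th 4 1 t * FF 0 (1/4) 4 t 0) = 0 := by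
        apply integral_undef
        simp only [one_mul]; exact hi
      have z3 : ∫ t in Ioi (0:ℝ), g t * ((1 + B t) * th 4 1 t * FF 0 (1/4) 4 t 0) = 0 := by
        apply integral_undef
        intro hcon
        apply hi
        refine (hcon.sub j2).congr (ae_of_all _ (fun t => ?_))
        simp only [hf, Pi.sub_apply]; ring
      have e4 := integral_add i1 i2
      have e5 : ∫ t in Ioi (0:ℝ), g t * (B t * th 4 1 t * FF 0 (1/4) 4 t 0) = 0 := by
        rw [e1, e2] at e4
        have e6 : (∫ t in Ioi (0:ℝ), g t * (1 * th 4 1 t * FF 0 (1/4) 4 t 0)) - ℓ * (1 * th 4 1 0 * FF 0 (1/4) 4 0 0)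
          + ((∫ t in Ioi (0:ℝ), g t * (B t * th 4 1 t * FF 0 (1/4) 4 t 0)) - ℓ * (B 0 * th 4 1 0 * FF 0 (1/4) 4 0 0))
          = (∫ t in Ioi (0:ℝ), g t * ((1 + B t) * th 4 1 t * FF 0 (1/4) 4 t 0)) - ℓ * ((1 + B 0) * th 4 1 0 * FF 0 (1/4) 4 0 0) := by
          refine e4.symm.trans (Eq.trans ?_ e3)
          congr 1; ext q; ring
        rw [z1, z3, B0] at e6
        linarith
      have nn : 0 ≤ᵐ[volume.restrict (Ioi (0:ℝ))] fun t => g t * (B t * th 4 1 t * FF 0 (1/4) 4 t 0) := by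
        rw [EventuallyLE, ae_restrict_iff' measurableSet_Ioi]
        refine ae_of_all _ (fun t ht => ?_)
        exact mul_nonneg (g0 t ht) (mul_nonneg (mul_nonneg (Real.smoothTransition.nonneg _) (th_nonneg _ _ _)) (FF_nonneg (by norm_num)))
      rw [integral_eq_zero_iff_of_nonneg_ae nn j2] at e5
      filter_upwards [e5] with t ht h1 h2
      have p1 : 0 < B t := Real.smoothTransition.pos_of_pos (by rw [sub_pos, one_lt_div hε]; exact h1)
      have p2 := F1 t (by linarith) (by linarith)
      rw [th_one one_pos (by linarith)] at ht
      simp only [Pi.zero_apply] at ht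
      rcases mul_eq_zero.1 ht with h | h
      · exact h
      · exfalso
        have : 0 < B t * 1 * FF 0 (1/4) 4 t 0 := by positivity
        exact this.ne' h
    have key2 : ∀ᵐ t ∂(volume.restrict (Ioi (0:ℝ))), ∀ n : ℕ, 1 / ((n:ℝ) + 1) < t → t < 1 → g t = 0 :=
      ae_all_iff.2 (fun n => key _ (by positivity))
    have : g =ᵐ[volume.restrict (Ioo (0:ℝ) 1)] fun _ => 0 := by
      have k3 := ae_restrict_of_ae_restrict_of_subset (Ioo_subset_Ioi_self : Ioo (0:ℝ) 1 ⊆ Ioi 0) key2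
      filter_upwards [k3, ae_restrict_mem measurableSet_Ioo] with t h1 h2
      obtain ⟨n, hn⟩ := exists_nat_one_div_lt h2.1
      exact h1 n hn h2.2
    exact (integrable_zero _ _ _).congr this.symm

lemma g_int {p ℓ : ℝ} (hp : 1 < p) {u : ℝ → ℝ → ℝ} (h : IsWeakSolDelta p ℓ u)
    (hn : ∀ t x : ℝ, 0 < t → 0 ≤ x → 0 ≤ u t x)
    (hc : ContinuousOn (fun q : ℝ × ℝ => u q.1 q.2) (Ioi 0 ×ˢ Ici 0)) (T : ℝ) :
    IntegrableOn (fun t => |u t 0| ^ (p - 1) * u t 0) (Ioc 0 T) := by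
  have h1 := g_int1 hp h hn hc
  have h2 : IntegrableOn (fun t => |u t 0| ^ (p - 1) * u t 0) (Icc (1/2) T) := by
    apply ContinuousOn.integrableOn_Icc
    exact (g_cont hp hc).mono (fun t ht => lt_of_lt_of_le (by norm_num) ht.1)
  refine (h1.union h2).mono_set ?_
  intro t ht
  by_cases h3 : t < 1
  · exact Or.inl ⟨ht.1, h3⟩
  · exact Or.inr ⟨by linarith, ht.2⟩


noncomputable def c0 : ℝ := ∫ z, Real.exp (-(1/4) * z ^ 2)

lemma c0_eq : c0 = 2 * √π := by
  unfold c0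
  rw [integral_gaussian, show π / (1/4) = 2 ^ 2 * π by ring, Real.sqrt_mul (by norm_num), Real.sqrt_sq (by norm_num)]

lemma NN_int {τ : ℝ} (hτ : 0 < τ) (x0 : ℝ) : ∫ x in Ioi (0:ℝ), NN x0 τ x = c0 := by
  have h1 := Gam_int hτ x0
  have e := Gam_sub hτ x0 (fun _ => 1)
  simp only [mul_one] at e
  unfold c0
  rw [← e, ← intervalIntegral.integral_Iic_add_Ioi (b := 0) h1.integrableOn h1.integrableOn]
  have := integral_comp_neg_Ioi 0 (fun y => Gam τ (x0 - y))
  rw [neg_zero] at this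
  have i2 : Integrable (fun y => Gam τ (y - x0)) := by
    refine h1.congr (ae_of_all _ (fun y => ?_))
    simp only
    rw [← Gam_neg]; congr 1; ring
  have i3 : Integrable (fun y => Gam τ (y + x0)) := by
    refine (Gam_int hτ (-x0)).congr (ae_of_all _ (fun y => ?_))
    simp only
    rw [← Gam_neg]; congr 1; ring
  unfold NN
  rw [← this, integral_add i2.integrableOn i3.integrableOn, add_comm]
  congr 1
  · congr 1; ext y; congr 1; ring
  · congr 1; ext y; rw [← Gam_neg]; congr 1; ring

lemma NN_meas (x0 T : ℝ) : Measurable (fun q : ℝ × ℝ => NN x0 (T - q.1) q.2) := by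
  unfold NN Gam; fun_prop

lemma NN_bd {x0 m t τ x : ℝ} (hm : 0 < m) (h1 : m ≤ τ) (h2 : τ ≤ t) :
    NN x0 τ x ≤ m ^ (-(1/2):ℝ) * (Real.exp (-(x - x0) ^ 2 / (8 * t)) + Real.exp (-(x + x0) ^ 2 / (8 * t))) := by
  have a := (Gam_bd hm h1 h2 (x - x0)).1
  have b := (Gam_bd hm h1 h2 (x + x0)).1
  unfold NN; linarith

lemma th1_int {T κ : ℝ} (hκ : 0 < κ) : Integrable (th1 T κ) := by
  apply (th1_cont T κ).integrable_of_hasCompactSupport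
  apply HasCompactSupport.intro (isCompact_Icc (a := T - 2 * κ) (b := T - κ))
  intro t ht
  apply th1_zero hκ
  by_contra hc
  push Not at hc
  exact ht ⟨hc.2.le, hc.1.le⟩

lemma th1_one {T κ : ℝ} (hκ : 0 < κ) (hT : 2 * κ ≤ T) : ∫ t in Ioi (0:ℝ), th1 T κ t = 1 := by
  have hT0 : 0 ≤ T := by linarith
  have h1 : ∫ t in Ioi (0:ℝ), th1 T κ t = ∫ t in Ioc 0 T, th1 T κ t := by
    apply setIntegral_eq_of_subset_of_forall_sdiff_eq_zero measurableSet_Ioi Ioc_subset_Ioi_self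
    intro t ht
    apply th1_zero hκ
    left
    by_contra hc
    exact ht.2 ⟨ht.1, by linarith⟩
  rw [h1, ← intervalIntegral.integral_of_le hT0]
  have := intervalIntegral.integral_eq_sub_of_hasDerivAt (a := 0) (b := T) (fun t _ => (th_deriv T κ t).neg)
    (by simpa using (th1_cont T κ).intervalIntegrable 0 T)
  simp only [neg_neg, Pi.neg_apply] at this
  rw [this, th_zero hκ (by linarith), th_one hκ (by linarith)]
  norm_num

lemma gauss_int (c t : ℝ) (ht : 0 < t) : Integrable (fun x : ℝ => Real.exp (-(x + c) ^ 2 / (8 * t))) := by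
  have h := (integrable_exp_neg_mul_sq (b := 1 / (8 * t)) (by positivity)).comp_add_right c
  refine h.congr (ae_of_all _ (fun y => ?_))
  simp only; congr 1; ring

lemma thN {T κ : ℝ} (hκ : 0 < κ) (hT : 2 * κ ≤ T) (x0 : ℝ) :
    IntegrableOn (fun q : ℝ × ℝ => th1 T κ q.1 * NN x0 (T - q.1) q.2) (Ioi 0 ×ˢ Ioi 0) ∧
    ∫ q in Ioi (0:ℝ) ×ˢ Ioi (0:ℝ), th1 T κ q.1 * NN x0 (T - q.1) q.2 = c0 := by
  have hT0 : 0 < T := by linarith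
  have hQ : MeasurableSet (Ioi (0:ℝ) ×ˢ Ioi (0:ℝ)) := measurableSet_Ioi.prod measurableSet_Ioi
  have i : IntegrableOn (fun q : ℝ × ℝ => th1 T κ q.1 * NN x0 (T - q.1) q.2) (Ioi 0 ×ˢ Ioi 0) := by
    have b := (th1_int (T := T) hκ).mul_prod (((gauss_int (-x0) T hT0).add (gauss_int x0 T hT0)).const_mul (κ ^ (-(1/2):ℝ)))
    rw [← Measure.volume_eq_prod] at b
    refine Integrable.mono' (b.integrableOn (s := Ioi 0 ×ˢ Ioi 0)) (((th1_cont T κ).measurable.comp measurable_fst).mul (NN_meas x0 T)).aestronglyMeasurable ?_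
    rw [ae_restrict_iff' hQ]
    refine ae_of_all _ (fun q hq => ?_)
    have h0 : (0:ℝ) < q.1 := hq.1
    rw [norm_mul, Real.norm_of_nonneg (th1_nonneg hκ _)]
    by_cases h1 : T - κ ≤ q.1
    · rw [th1_zero hκ (Or.inl h1)]; simp
    · refine mul_le_mul_of_nonneg_left ?_ (th1_nonneg hκ _)
      rw [Real.norm_of_nonneg (NN_pos (by linarith)).le]
      have := NN_bd (x0 := x0) (x := q.2) (t := T) (τ := T - q.1) hκ (by linarith) (by linarith)
      simpa [sub_eq_add_neg] using this
  refine ⟨i, ?_⟩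
  rw [Measure.volume_eq_prod] at i ⊢
  rw [setIntegral_prod _ i]
  have : ∫ t in Ioi (0:ℝ), ∫ x in Ioi (0:ℝ), th1 T κ t * NN x0 (T - t) x = ∫ t in Ioi (0:ℝ), th1 T κ t * c0 := by
    congr 1; ext t
    rw [integral_const_mul]
    by_cases h1 : T - κ ≤ t
    · rw [th1_zero hκ (Or.inl h1)]; simp
    · rw [NN_int (by linarith)]
  simp only at this ⊢
  rw [this, integral_mul_const, th1_one hκ hT, one_mul]

lemma gk_int {p ℓ : ℝ} (hp : 1 < p) {u : ℝ → ℝ → ℝ} (h : IsWeakSolDelta p ℓ u)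
    (hn : ∀ t x : ℝ, 0 < t → 0 ≤ x → 0 ≤ u t x)
    (hc : ContinuousOn (fun q : ℝ × ℝ => u q.1 q.2) (Ioi 0 ×ˢ Ici 0)) {T : ℝ} (hT : 0 < T) :
    IntegrableOn (fun t => |u t 0| ^ (p - 1) * u t 0 * (T - t) ^ (-(1/2):ℝ)) (Ioc 0 T) := by
  have h1 : IntegrableOn (fun t => |u t 0| ^ (p - 1) * u t 0 * (T - t) ^ (-(1/2):ℝ)) (Ioc 0 (T/2)) := by
    have a := g_int hp h hn hc (T / 2)
    rw [← integrableOn_Icc_iff_integrableOn_Ioc] at a ⊢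
    refine a.mul_continuousOn ?_ isCompact_Icc
    apply ContinuousOn.rpow_const (by fun_prop)
    intro t ht
    left; have := ht.2; linarith
  have h2 : IntegrableOn (fun t => |u t 0| ^ (p - 1) * u t 0 * (T - t) ^ (-(1/2):ℝ)) (Icc (T/2) T) := by
    have a := (intervalIntegrable_iff_integrableOn_Ioc_of_le (by linarith)).1 (ii_kern' (T/2) T T)
    rw [← integrableOn_Icc_iff_integrableOn_Ioc] at a
    refine a.continuousOn_mul ((g_cont hp hc).mono ?_) isCompact_Icc
    intro t ht
    have := ht.1
    simp only [mem_Ioi]; linarith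
  refine (h1.union h2).mono_set ?_
  intro t ht
  by_cases h3 : t ≤ T/2
  · exact Or.inl ⟨ht.1, h3⟩
  · exact Or.inr ⟨by linarith, ht.2⟩


lemma Gam_far {τ x : ℝ} (hτ : 0 < τ) (hx : 1 ≤ x) : Gam τ x ≤ 4 * √τ := by
  have hy : 0 < x ^ 2 / (4 * τ) := by positivity
  have h1 : Real.exp (-x ^ 2 / (4 * τ)) ≤ 4 * τ := by
    rw [neg_div, Real.exp_neg]
    have := Real.add_one_le_exp (x ^ 2 / (4 * τ))
    have h2 : 1 / (4 * τ) ≤ Real.exp (x ^ 2 / (4 * τ)) := by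
      have : 1 / (4 * τ) ≤ x ^ 2 / (4 * τ) := by
        apply div_le_div_of_nonneg_right _ (by positivity)
        nlinarith
      linarith
    calc (Real.exp (x ^ 2 / (4 * τ)))⁻¹ ≤ (1 / (4 * τ))⁻¹ := inv_anti₀ (by positivity) h2
      _ = _ := by simp
  unfold Gam
  calc τ ^ (-(1/2):ℝ) * Real.exp (-x ^ 2 / (4 * τ)) ≤ τ ^ (-(1/2):ℝ) * (4 * τ) := by gcongr
    _ = 4 * (τ ^ (-(1/2):ℝ) * τ ^ (1:ℝ)) := by rw [Real.rpow_one]; ring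
    _ = _ := by rw [← Real.rpow_add hτ, Real.sqrt_eq_rpow]; norm_num

lemma FD_nonneg {x0 δ T t x : ℝ} (hδ : 0 < δ) : 0 ≤ FD x0 δ T t x :=
  mul_nonneg (div_nonneg (ST_deriv_nonneg _) hδ.le) (sq_nonneg _)

lemma NN0 (τ x : ℝ) : NN 0 τ x = 2 * Gam τ x := by unfold NN; rw [sub_zero, add_zero]; ring

lemma NNat0 (x0 τ : ℝ) : NN x0 τ 0 = 2 * Gam τ x0 := by
  unfold NN; rw [zero_sub, zero_add, Gam_neg]; ring

lemma Gam_le_rpow {τ : ℝ} (hτ : 0 < τ) (x : ℝ) : Gam τ x ≤ τ ^ (-(1/2):ℝ) := by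
  unfold Gam
  apply mul_le_of_le_one_right (by positivity)
  rw [Real.exp_le_one_iff]
  apply div_nonpos_of_nonpos_of_nonneg <;> nlinarith [sq_nonneg x]

theorem growth {p ℓ : ℝ} (hp : 1 < p) (hℓ : 0 < ℓ) {u : ℝ → ℝ → ℝ} (h : IsWeakSolDelta p ℓ u)
    (hn : ∀ t x : ℝ, 0 < t → 0 ≤ x → 0 ≤ u t x)
    (hc : ContinuousOn (fun q : ℝ × ℝ => u q.1 q.2) (Ioi 0 ×ˢ Ici 0)) {T' ε : ℝ} (hT' : 0 < T') (hε : 0 < ε) :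
    IntegrableOn (fun q : ℝ × ℝ => Real.exp (-ε * q.2 ^ 2) * u q.1 q.2) (Ioo 0 T' ×ˢ Ioi 0) := by
  have hQ : MeasurableSet (Ioi (0:ℝ) ×ˢ Ioi (0:ℝ)) := measurableSet_Ioi.prod measurableSet_Ioi
  set T := T' + 1 / (4 * ε) with hT
  have hε4 : 0 < 1 / (4 * ε) := by positivity
  have hT0 : 0 < T := by linarith
  obtain ⟨M, hM⟩ := ((isCompact_Icc (a := T/2) (b := T)).prod (isCompact_Icc (a := (0:ℝ)) (b := 1))).exists_bound_of_continuousOn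
    (hc.mono (by
      rintro q ⟨h1, h2⟩
      exact ⟨by have := h1.1; simp only [mem_Ioi]; linarith, h2.1⟩))
  have hM0 : 0 ≤ M := (norm_nonneg _).trans (hM (T, 0) ⟨⟨by simp only; linarith, le_rfl⟩, ⟨le_rfl, zero_le_one⟩⟩)
  set g := fun t => |u t 0| ^ (p - 1) * u t 0 with hg
  have g0 : ∀ t, 0 < t → 0 ≤ g t := fun t ht => mul_nonneg (by positivity) (hn t 0 ht le_rfl)
  have hk := gk_int hp h hn hc hT0
  set Bd := ∫ t in Ioc 0 T, 2 * (1 + T) * (g t * (T - t) ^ (-(1/2):ℝ)) with hBd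
  have hcT : 0 < T ^ (-(1/2):ℝ) := by positivity
  have main : ∀ R : ℝ, 0 < R → IntegrableOn (fun q : ℝ × ℝ => Real.exp (-ε * q.2 ^ 2) * u q.1 q.2) (Ioo 0 T' ×ˢ Ioc 0 R) ∧
      ∫ q in Ioo 0 T' ×ˢ Ioc 0 R, Real.exp (-ε * q.2 ^ 2) * u q.1 q.2 ≤ (T ^ (-(1/2):ℝ))⁻¹ * (Bd + (1 + T) * M * c0) := by
    intro R hR
    have hbox : MeasurableSet (Ioo 0 T' ×ˢ Ioc 0 R) := measurableSet_Ioo.prod measurableSet_Ioc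
    have ib : IntegrableOn (fun q : ℝ × ℝ => Real.exp (-ε * q.2 ^ 2) * u q.1 q.2) (Ioo 0 T' ×ˢ Ioc 0 R) := by
      have hK : IsCompact (Icc 0 T' ×ˢ Icc 0 R) := isCompact_Icc.prod isCompact_Icc
      have := h.1.integrableOn_compact_subset (prod_mono Icc_subset_Ici_self Icc_subset_Ici_self : Icc 0 T' ×ˢ Icc 0 R ⊆ _) hK
      refine (this.continuousOn_mul (g := fun q : ℝ × ℝ => Real.exp (-ε * q.2 ^ 2)) (by fun_prop) hK).mono_set ?_
      exact prod_mono Ioo_subset_Icc_self Ioc_subset_Icc_self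
    refine ⟨ib, ?_⟩
    set d := T ^ (-(1/2):ℝ) * Real.exp (-ε * R ^ 2) / 2 with hd
    have hd0 : 0 < d := by positivity
    obtain ⟨σ, hσ, s1, s2, s3⟩ : ∃ σ : ℝ, 0 < σ ∧ σ ≤ T / 8 ∧ σ ≤ 1 / (4 * ε) / 2 ∧ σ ≤ d ^ 2 / 128 := by
      refine ⟨min (T / 8) (min (1 / (4 * ε) / 2) (d ^ 2 / 128)), by positivity, min_le_left _ _, ?_, ?_⟩
      · exact (min_le_right _ _).trans (min_le_left _ _)
      · exact (min_le_right _ _).trans (min_le_right _ _)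
    obtain ⟨iW, eW⟩ := weak_id2 h (T := T) (κ := σ) 0 hd0 hσ (B := fun t => 1 + t) (B1 := fun _ => 1)
      (by fun_prop) (fun t => (hasDerivAt_id t).const_add 1)
    obtain ⟨iG, eG⟩ := thN (T := T) hσ (by linarith) 0
    have iG' := iG.const_mul ((1 + T) * M)
    -- pointwise bound
    have pw : ∀ q ∈ Ioi (0:ℝ) ×ˢ Ioi (0:ℝ), th T σ q.1 * FF 0 d T q.1 q.2 * u q.1 q.2 ≤
        ((1 * th T σ q.1 - (1 + q.1) * th1 T σ q.1) * FF 0 d T q.1 q.2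
      + (1 + q.1) * th T σ q.1 * FD 0 d T q.1 q.2) * u q.1 q.2 + (1 + T) * M * (th1 T σ q.1 * NN 0 (T - q.1) q.2) := by
      rintro ⟨t, x⟩ ⟨ht, hx⟩
      have ht0 : (0:ℝ) < t := ht
      have hx0 : (0:ℝ) < x := hx
      have hu0 := hn t x ht0 hx0.le
      simp only
      have k1 : 0 ≤ (1 + t) * th T σ t * FD 0 d T t x * u t x :=
        mul_nonneg (mul_nonneg (mul_nonneg (by linarith) (th_nonneg _ _ _)) (FD_nonneg hd0)) hu0
      have k2 : (1 + t) * th1 T σ t * FF 0 d T t x * u t x ≤ (1 + T) * M * (th1 T σ t * NN 0 (T - t) x) := by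
        by_cases c1 : T - σ ≤ t ∨ t ≤ T - 2 * σ
        · rw [th1_zero hσ c1]; simp
        push Not at c1
        have hτ : 0 < T - t := by linarith
        have nn := (NN_pos (x0 := 0) (x := x) hτ).le
        have t1 := th1_nonneg (T := T) hσ t
        by_cases c2 : x ≤ 1
        · have b1 : u t x ≤ M := (le_abs_self _).trans (hM (t, x) ⟨⟨by simp only; linarith, by simp only; linarith⟩, ⟨hx0.le, c2⟩⟩)
          have b2 := FF_le (x0 := 0) (x := x) hd0 (show t < T by linarith)
          have b3 := FF_nonneg (x0 := 0) (T := T) (t := t) (x := x) hd0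
          calc (1 + t) * th1 T σ t * FF 0 d T t x * u t x ≤ (1 + T) * th1 T σ t * NN 0 (T - t) x * M := by
                gcongr
                linarith
            _ = _ := by ring
        · have : FF 0 d T t x = 0 := by
            apply FF_eq_zero hd0
            rw [NN0]
            have f1 := Gam_far hτ (show 1 ≤ x by linarith)
            have f2 : √(T - t) ≤ d / 8 := by
              rw [Real.sqrt_le_left (by positivity)]
              nlinarith
            linarith
          rw [this]
          simp only [mul_zero, zero_mul]
          positivity
      linarith
    have nnq : ∀ q ∈ Ioi (0:ℝ) ×ˢ Ioi (0:ℝ), 0 ≤ th T σ q.1 * FF 0 d T q.1 q.2 * u q.1 q.2 := by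
      rintro ⟨t, x⟩ ⟨ht, hx⟩
      exact mul_nonneg (mul_nonneg (th_nonneg _ _ _) (FF_nonneg hd0)) (hn t x ht (le_of_lt hx))
    have sub : Ioo 0 T' ×ˢ Ioc 0 R ⊆ Ioi (0:ℝ) ×ˢ Ioi (0:ℝ) := prod_mono Ioo_subset_Ioi_self Ioc_subset_Ioi_self
    have c1 : ∫ q in Ioo 0 T' ×ˢ Ioc 0 R, T ^ (-(1/2):ℝ) * (Real.exp (-ε * q.2 ^ 2) * u q.1 q.2) ≤
      ∫ q in Ioo 0 T' ×ˢ Ioc 0 R, (((1 * th T σ q.1 - (1 + q.1) * th1 T σ q.1) * FF 0 d T q.1 q.2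
      + (1 + q.1) * th T σ q.1 * FD 0 d T q.1 q.2) * u q.1 q.2 + (1 + T) * M * (th1 T σ q.1 * NN 0 (T - q.1) q.2)) := by
      apply setIntegral_mono_on (ib.const_mul _) ((iW.add iG').mono_set sub) hbox
      intro q hq
      refine le_trans ?_ (pw q (sub hq))
      obtain ⟨⟨q1, q2⟩, q3, q4⟩ := hq
      rw [th_one hσ (by linarith), one_mul, ← mul_assoc]
      refine mul_le_mul_of_nonneg_right ?_ (hn _ _ q1 q3.le)
      refine le_trans ?_ (FF_ge hd0)
      rw [NN0]
      have hτ : 0 < T - q.1 := by linarith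
      have g1 : T ^ (-(1/2):ℝ) * Real.exp (-ε * q.2 ^ 2) ≤ Gam (T - q.1) q.2 := by
        unfold Gam
        refine mul_le_mul (Real.rpow_le_rpow_of_nonpos hτ (by linarith) (by norm_num)) ?_ (by positivity) (by positivity)
        rw [Real.exp_le_exp, neg_div, neg_mul, neg_le_neg_iff, div_le_iff₀ (by positivity)]
        have : 1 ≤ ε * (4 * (T - q.1)) := by
          have : 1 / (4 * ε) ≤ T - q.1 := by linarith
          rw [div_le_iff₀ (by positivity)] at this
          linarith
        nlinarith [sq_nonneg q.2]
      have g2 : d * 2 ≤ T ^ (-(1/2):ℝ) * Real.exp (-ε * q.2 ^ 2) := by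
        rw [hd, div_mul_cancel₀ _ two_ne_zero]
        gcongr ?_ * Real.exp ?_
        have : q.2 ^ 2 ≤ R ^ 2 := by gcongr
        nlinarith
      linarith
    have c2 := setIntegral_mono_set (iW.add iG') (by
        rw [EventuallyLE, ae_restrict_iff' hQ]
        exact ae_of_all _ (fun q hq => (nnq q hq).trans (pw q hq))) (LE.le.eventuallyLE (l := ae volume) sub)
    have c3 := c1.trans c2
    have c4 := integral_add iW iG'
    simp only [Pi.add_apply] at c3
    rw [c4, eW, integral_const_mul, integral_const_mul, eG] at c3
    have c5 : ∫ t in Ioi (0:ℝ), |u t 0| ^ (p - 1) * u t 0 * ((1 + t) * th T σ t * FF 0 d T t 0) ≤ Bd := by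
      have e : ∫ t in Ioi (0:ℝ), |u t 0| ^ (p - 1) * u t 0 * ((1 + t) * th T σ t * FF 0 d T t 0)
        = ∫ t in Ioc 0 T, |u t 0| ^ (p - 1) * u t 0 * ((1 + t) * th T σ t * FF 0 d T t 0) := by
        apply setIntegral_eq_of_subset_of_forall_sdiff_eq_zero measurableSet_Ioi Ioc_subset_Ioi_self
        intro t ht
        have : T - σ ≤ t := by
          by_contra hc
          exact ht.2 ⟨ht.1, by linarith⟩
        rw [th_zero hσ this]; simp
      rw [e, hBd]
      apply integral_mono_of_nonneg
      · rw [EventuallyLE, ae_restrict_iff' measurableSet_Ioc]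
        refine ae_of_all _ (fun t ht => ?_)
        exact mul_nonneg (g0 t ht.1) (mul_nonneg (mul_nonneg (by linarith [ht.1]) (th_nonneg _ _ _)) (FF_nonneg hd0))
      · exact hk.const_mul _
      · rw [EventuallyLE, ae_restrict_iff' measurableSet_Ioc]
        refine ae_of_all _ (fun t ht => ?_)
        have ht1 := ht.1
        have ht2 := ht.2
        have gg := g0 t ht1
        by_cases c : T - σ ≤ t
        · rw [th_zero hσ c]
          have : 0 ≤ (T - t) ^ (-(1/2):ℝ) := Real.rpow_nonneg (by linarith) _
          simp only [mul_zero, zero_mul]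
          positivity
        · have hτ : 0 < T - t := by linarith
          have b2 := FF_le (x0 := 0) (x := 0) hd0 (show t < T by linarith)
          rw [NN0] at b2
          have b4 := Gam_le_rpow hτ 0
          have b3 := FF_nonneg (x0 := 0) (T := T) (t := t) (x := 0) hd0
          calc g t * ((1 + t) * th T σ t * FF 0 d T t 0) ≤ g t * ((1 + T) * 1 * (2 * (T - t) ^ (-(1/2):ℝ))) := by
                gcongr
                · exact th_nonneg _ _ _
                · exact th_le _ _ _
                · linarith
            _ = _ := by ring
    have c6 : 0 ≤ ℓ * ((1 + 0) * th T σ 0 * FF 0 d T 0 0) :=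
      mul_nonneg hℓ.le (mul_nonneg (mul_nonneg (by norm_num) (th_nonneg _ _ _)) (FF_nonneg hd0))
    rw [← div_eq_inv_mul, le_div_iff₀ hcT]
    linarith
  have cov : AECover (volume.restrict (Ioo 0 T' ×ˢ Ioi (0:ℝ))) atTop (fun n : ℕ => {q : ℝ × ℝ | q.2 ≤ (n:ℝ) + 1}) := by
    constructor
    · refine ae_of_all _ (fun q => ?_)
      obtain ⟨n, hn⟩ := exists_nat_ge q.2
      filter_upwards [eventually_ge_atTop n] with m hm
      have : (n:ℝ) ≤ m := by exact_mod_cast hm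
      change q.2 ≤ (m:ℝ) + 1
      linarith
    · intro n
      exact measurableSet_le measurable_snd measurable_const
  have hset : ∀ n : ℕ, (volume.restrict (Ioo 0 T' ×ˢ Ioi (0:ℝ))).restrict {q : ℝ × ℝ | q.2 ≤ (n:ℝ) + 1}
      = volume.restrict (Ioo 0 T' ×ˢ Ioc 0 ((n:ℝ) + 1)) := by
    intro n
    rw [Measure.restrict_restrict (cov.measurableSet n)]
    congr 1
    ext q
    simp only [mem_inter_iff, mem_ofPred_eq, mem_prod, mem_Ioo, mem_Ioi, mem_Ioc]
    tauto
  refine cov.integrable_of_integral_bounded_of_nonneg_ae ((T ^ (-(1/2):ℝ))⁻¹ * (Bd + (1 + T) * M * c0)) ?_ ?_ ?_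
  · intro n
    rw [IntegrableOn, hset]
    exact (main _ (by positivity)).1
  · rw [ae_restrict_iff' (measurableSet_Ioo.prod measurableSet_Ioi)]
    refine ae_of_all _ (fun q hq => ?_)
    exact mul_nonneg (Real.exp_pos _).le (hn _ _ hq.1.1 (le_of_lt hq.2))
  · refine Eventually.of_forall (fun n => ?_)
    rw [hset]
    exact (main _ (by positivity)).2


lemma NN_env {x0 κ T τ x : ℝ} (hκ : 0 < κ) (h1 : κ ≤ τ) (h2 : τ ≤ T) :
    NN x0 τ x ≤ 2 * κ ^ (-(1/2):ℝ) * Real.exp (x0 ^ 2 / (8 * T)) * Real.exp (-(1 / (16 * T)) * x ^ 2) := by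
  have hT : 0 < T := by linarith
  have a := NN_bd (x0 := x0) (x := x) hκ h1 h2
  have b := exp_env hT x0 x
  have c := exp_env hT (-x0) x
  rw [show (x0 - x) ^ 2 = (x - x0) ^ 2 by ring] at b
  rw [show (-x0 - x) ^ 2 = (x + x0) ^ 2 by ring, neg_sq] at c
  have hk : 0 ≤ κ ^ (-(1/2):ℝ) := by positivity
  calc _ ≤ _ := a
    _ ≤ κ ^ (-(1/2):ℝ) * (Real.exp (x0 ^ 2 / (8 * T)) * Real.exp (-(1 / (16 * T)) * x ^ 2) + Real.exp (x0 ^ 2 / (8 * T)) * Real.exp (-(1 / (16 * T)) * x ^ 2)) := by gcongr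
    _ = _ := by ring

lemma NNx_bd {x0 κ τ x : ℝ} (hκ : 0 < κ) (h1 : κ ≤ τ) (hx : 0 ≤ x) (hx0 : 0 ≤ x0) :
    NNx x0 τ x ^ 2 ≤ ((x + x0) / (2 * κ)) ^ 2 * NN x0 τ x ^ 2 := by
  have hτ : 0 < τ := by linarith
  have G1 := (Gam_pos hτ (x - x0)).le
  have G2 := (Gam_pos hτ (x + x0)).le
  rw [← mul_pow, ← sq_abs]
  have : |NNx x0 τ x| ≤ (x + x0) / (2 * κ) * NN x0 τ x := by
    unfold NNx NN
    have e : ∀ z : ℝ, |z| ≤ x + x0 → 0 ≤ Gam τ z → |-z / (2 * τ) * Gam τ z| ≤ (x + x0) / (2 * κ) * Gam τ z := by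
      intro z hz hG
      rw [abs_mul, abs_of_nonneg hG, abs_div, abs_neg, abs_of_pos (by positivity : 0 < 2 * τ)]
      gcongr
    refine (abs_add_le _ _).trans ?_
    rw [mul_add]
    refine add_le_add (e _ ?_ G1) (e _ ?_ G2)
    · rw [abs_le]; constructor <;> linarith
    · rw [abs_of_nonneg (by linarith)]
  gcongr

lemma FD_bd {C x0 δ T t κ x : ℝ} (hC : ∀ y, deriv Real.smoothTransition y ≤ C) (hC0 : 0 ≤ C) (hδ : 0 < δ) (hκ : 0 < κ)
    (h1 : κ ≤ T - t) (hx : 0 ≤ x) (hx0 : 0 ≤ x0) :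
    FD x0 δ T t x ≤ 2 * C * (((x + x0) / (2 * κ)) ^ 2 * NN x0 (T - t) x) := by
  have hN := NN_pos (x0 := x0) (x := x) (show 0 < T - t by linarith)
  unfold FD
  by_cases h : 2 * δ ≤ NN x0 (T - t) x
  · rw [ST_deriv_zero (Or.inr (by rw [le_sub_iff_add_le, le_div_iff₀ hδ]; linarith))]
    simp only [zero_div, zero_mul]
    positivity
  · push Not at h
    have b := NNx_bd hκ h1 hx hx0
    have a : deriv Real.smoothTransition (NN x0 (T - t) x / δ - 1) / δ ≤ C * (2 / NN x0 (T - t) x) := by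
      rw [div_eq_mul_inv]
      refine mul_le_mul (hC _) ?_ (by positivity) hC0
      rw [inv_eq_one_div, div_le_div_iff₀ hδ hN]; linarith
    calc _ ≤ C * (2 / NN x0 (T - t) x) * (((x + x0) / (2 * κ)) ^ 2 * NN x0 (T - t) x ^ 2) := by gcongr
      _ = _ := by field_simp

lemma env_sq {T x x0 : ℝ} (hT : 0 < T) :
    (x + x0) ^ 2 * Real.exp (-(1 / (16 * T)) * x ^ 2) ≤ (64 * T + 2 * x0 ^ 2) * Real.exp (-(1 / (32 * T)) * x ^ 2) := by
  have e : Real.exp (-(1 / (16 * T)) * x ^ 2) = Real.exp (-(1 / (32 * T)) * x ^ 2) * Real.exp (-(1 / (32 * T)) * x ^ 2) := by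
    rw [← Real.exp_add]; congr 1; field_simp; ring
  rw [e, ← mul_assoc]
  refine mul_le_mul_of_nonneg_right ?_ (Real.exp_pos _).le
  set y := 1 / (32 * T) * x ^ 2 with hy
  have hy0 : 0 ≤ y := by positivity
  have hx2 : x ^ 2 = 32 * T * y := by rw [hy]; field_simp
  have h1 : y * Real.exp (-y) ≤ 1 := by
    rw [Real.exp_neg, ← div_eq_mul_inv, div_le_one (Real.exp_pos _)]
    linarith [Real.add_one_le_exp y]
  have h2 : Real.exp (-y) ≤ 1 := by rw [Real.exp_le_one_iff]; linarith
  have h3 : 0 < Real.exp (-y) := Real.exp_pos _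
  rw [neg_mul, ← hy]
  calc (x + x0) ^ 2 * Real.exp (-y) ≤ (2 * x ^ 2 + 2 * x0 ^ 2) * Real.exp (-y) := by
        gcongr; nlinarith [sq_nonneg (x - x0)]
    _ = 64 * T * (y * Real.exp (-y)) + 2 * x0 ^ 2 * Real.exp (-y) := by rw [hx2]; ring
    _ ≤ 64 * T * 1 + 2 * x0 ^ 2 * 1 := by gcongr
    _ = _ := by ring

lemma env_le {T x : ℝ} (hT : 0 < T) : Real.exp (-(1 / (16 * T)) * x ^ 2) ≤ Real.exp (-(1 / (32 * T)) * x ^ 2) := by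
  rw [Real.exp_le_exp]
  have : 1 / (32 * T) ≤ 1 / (16 * T) := by gcongr; norm_num
  nlinarith [sq_nonneg x]

lemma FF_tendsto {x0 T t x : ℝ} (h : t < T) :
    Tendsto (fun n : ℕ => FF x0 (1 / ((n:ℝ) + 1)) T t x) atTop (𝓝 (NN x0 (T - t) x)) := by
  have l := tendsto_one_div_add_atTop_nhds_zero_nat (𝕜 := ℝ)
  have l2 : Tendsto (fun n : ℕ => NN x0 (T - t) x - 2 * (1 / ((n:ℝ) + 1))) atTop (𝓝 (NN x0 (T - t) x)) := by
    simpa using (l.const_mul 2).const_sub (NN x0 (T - t) x)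
  exact tendsto_of_tendsto_of_tendsto_of_le_of_le l2 tendsto_const_nhds
    (fun n => FF_ge (by positivity)) (fun n => FF_le (by positivity) h)

lemma FD_tendsto {x0 T t x : ℝ} (h : t < T) :
    Tendsto (fun n : ℕ => FD x0 (1 / ((n:ℝ) + 1)) T t x) atTop (𝓝 0) := by
  have l := tendsto_one_div_add_atTop_nhds_zero_nat (𝕜 := ℝ)
  have hN := NN_pos (x0 := x0) (x := x) (show 0 < T - t by linarith)
  refine tendsto_const_nhds.congr' ?_
  filter_upwards [l.eventually (gt_mem_nhds (show 0 < NN x0 (T - t) x / 2 by positivity))] with n hn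
  have hδ : 0 < 1 / ((n:ℝ) + 1) := by positivity
  unfold FD
  rw [ST_deriv_zero (Or.inr (by rw [le_sub_iff_add_le, le_div_iff₀ hδ]; linarith))]
  simp

theorem step2 {p ℓ : ℝ} (hp : 1 < p) (hℓ : 0 < ℓ) {u : ℝ → ℝ → ℝ} (h : IsWeakSolDelta p ℓ u)
    (hn : ∀ t x : ℝ, 0 < t → 0 ≤ x → 0 ≤ u t x)
    (hc : ContinuousOn (fun q : ℝ × ℝ => u q.1 q.2) (Ioi 0 ×ˢ Ici 0)) {T κ x0 : ℝ} (hx0 : 0 ≤ x0)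
    (hκ : 0 < κ) (hT : 2 * κ ≤ T) :
    IntegrableOn (fun q : ℝ × ℝ => th1 T κ q.1 * NN x0 (T - q.1) q.2 * u q.1 q.2) (Ioi 0 ×ˢ Ioi 0) ∧
    (∫ q in Ioi (0:ℝ) ×ˢ Ioi (0:ℝ), th1 T κ q.1 * NN x0 (T - q.1) q.2 * u q.1 q.2)
      = ℓ * NN x0 T 0 - ∫ t in Ioc 0 T, |u t 0| ^ (p - 1) * u t 0 * (th T κ t * NN x0 (T - t) 0) := by
  have hQ : MeasurableSet (Ioi (0:ℝ) ×ˢ Ioi (0:ℝ)) := measurableSet_Ioi.prod measurableSet_Ioi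
  have hT0 : 0 < T := by linarith
  obtain ⟨C, hC0, hC⟩ := ST_deriv_bdd
  set g := fun t => |u t 0| ^ (p - 1) * u t 0 with hg
  have gc : ContinuousOn g (Ioi 0) := g_cont hp hc
  have g0 : ∀ t, 0 < t → 0 ≤ g t := fun t ht => mul_nonneg (by positivity) (hn t 0 ht le_rfl)
  have uc : AEStronglyMeasurable (fun q : ℝ × ℝ => u q.1 q.2) (volume.restrict (Ioi 0 ×ˢ Ioi 0)) :=
    (hc.mono (prod_mono le_rfl Ioi_subset_Ici_self)).aestronglyMeasurable hQ
  set K1 := 2 * κ ^ (-(1/2):ℝ) * Real.exp (x0 ^ 2 / (8 * T)) with hK1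
  have hK10 : 0 ≤ K1 := by positivity
  set K2 := C / κ * K1 + 2 * C * (1 / (2 * κ) ^ 2 * (K1 * (64 * T + 2 * x0 ^ 2))) with hK2
  have hS : MeasurableSet (Ioo 0 T ×ˢ Ioi (0:ℝ)) := measurableSet_Ioo.prod measurableSet_Ioi
  have gr := (growth hp hℓ h hn hc hT0 (show 0 < 1 / (32 * T) by positivity)).const_mul K2
  set bd := (Ioo 0 T ×ˢ Ioi (0:ℝ)).indicator (fun q : ℝ × ℝ => K2 * (Real.exp (-(1 / (32 * T)) * q.2 ^ 2) * u q.1 q.2)) with hbd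
  have ibd : IntegrableOn bd (Ioi 0 ×ˢ Ioi 0) := ((integrable_indicator_iff hS).2 gr).integrableOn
  have mem : ∀ t x, 0 < t → 0 < x → ¬ (T - κ ≤ t) → bd (t, x) = K2 * (Real.exp (-(1 / (32 * T)) * x ^ 2) * u t x) := by
    intro t x h1 h2 h3
    exact indicator_of_mem (s := Ioo 0 T ×ˢ Ioi (0:ℝ)) (a := (t, x)) ⟨⟨h1, by simp only; linarith⟩, h2⟩ _
  have nnb : ∀ t x, 0 < t → 0 < x → 0 ≤ bd (t, x) := by
    intro t x h1 h2
    apply indicator_nonneg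
    rintro q ⟨q1, q2⟩
    have := hn q.1 q.2 q1.1 (le_of_lt q2)
    positivity
  have e1 : ∀ t x, 0 < t → 0 < x → ¬ (T - κ ≤ t) →
      th1 T κ t * NN x0 (T - t) x ≤ C / κ * K1 * Real.exp (-(1 / (32 * T)) * x ^ 2) := by
    intro t x h1 h2 h3
    have a := NN_env (x0 := x0) (x := x) (T := T) (τ := T - t) hκ (by linarith) (by linarith)
    have b : th1 T κ t ≤ C / κ := by unfold th1; gcongr; exact hC _
    have hN := NN_pos (x0 := x0) (x := x) (show 0 < T - t by linarith)
    calc th1 T κ t * NN x0 (T - t) x ≤ C / κ * (K1 * Real.exp (-(1 / (32 * T)) * x ^ 2)) := by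
          refine mul_le_mul b (a.trans ?_) hN.le (by positivity)
          exact mul_le_mul_of_nonneg_left (env_le hT0) hK10
      _ = _ := by ring
  have e2 : ∀ δ t x, 0 < δ → 0 < t → 0 < x → ¬ (T - κ ≤ t) →
      FD x0 δ T t x ≤ 2 * C * (1 / (2 * κ) ^ 2 * (K1 * (64 * T + 2 * x0 ^ 2))) * Real.exp (-(1 / (32 * T)) * x ^ 2) := by
    intro δ t x hδ h1 h2 h3
    have a := NN_env (x0 := x0) (x := x) (T := T) (τ := T - t) hκ (by linarith) (by linarith)
    refine (FD_bd hC hC0 hδ hκ (by linarith) h2.le hx0).trans ?_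
    rw [mul_assoc (2 * C)]
    refine mul_le_mul_of_nonneg_left ?_ (by positivity)
    calc ((x + x0) / (2 * κ)) ^ 2 * NN x0 (T - t) x ≤ ((x + x0) / (2 * κ)) ^ 2 * (K1 * Real.exp (-(1 / (16 * T)) * x ^ 2)) := by gcongr
      _ = 1 / (2 * κ) ^ 2 * (K1 * ((x + x0) ^ 2 * Real.exp (-(1 / (16 * T)) * x ^ 2))) := by rw [div_pow]; ring
      _ ≤ 1 / (2 * κ) ^ 2 * (K1 * ((64 * T + 2 * x0 ^ 2) * Real.exp (-(1 / (32 * T)) * x ^ 2))) := by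
          gcongr ?_ * (?_ * ?_)
          exact env_sq hT0
      _ = _ := by ring
  have iN : IntegrableOn (fun q : ℝ × ℝ => th1 T κ q.1 * NN x0 (T - q.1) q.2 * u q.1 q.2) (Ioi 0 ×ˢ Ioi 0) := by
    refine Integrable.mono' ibd ((((th1_cont T κ).measurable.comp measurable_fst).mul (NN_meas x0 T)).aestronglyMeasurable.mul uc) ?_
    rw [ae_restrict_iff' hQ]
    refine ae_of_all _ ?_
    rintro ⟨t, x⟩ ⟨ht, hx⟩
    simp only [mem_Ioi] at ht hx
    by_cases h3 : T - κ ≤ t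
    · simp only [th1_zero hκ (Or.inl h3), zero_mul, norm_zero]; exact nnb t x ht hx
    · have hN := NN_pos (x0 := x0) (x := x) (show 0 < T - t by linarith)
      have hu := hn t x ht hx.le
      have ht1 := th1_nonneg (T := T) hκ t
      simp only
      rw [Real.norm_of_nonneg (by positivity), mem t x ht hx h3, ← mul_assoc]
      refine mul_le_mul_of_nonneg_right ((e1 t x ht hx h3).trans ?_) hu
      refine mul_le_mul_of_nonneg_right ?_ (Real.exp_pos _).le
      rw [hK2, le_add_iff_nonneg_right]
      positivity
  refine ⟨iN, ?_⟩
  -- interior limit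
  have L1 : Tendsto (fun n : ℕ => ∫ q in Ioi (0:ℝ) ×ˢ Ioi (0:ℝ), ((0 * th T κ q.1 - 1 * th1 T κ q.1) * FF x0 (1 / ((n:ℝ) + 1)) T q.1 q.2
      + 1 * th T κ q.1 * FD x0 (1 / ((n:ℝ) + 1)) T q.1 q.2) * u q.1 q.2) atTop
      (𝓝 (∫ q in Ioi (0:ℝ) ×ˢ Ioi (0:ℝ), -(th1 T κ q.1 * NN x0 (T - q.1) q.2 * u q.1 q.2))) := by
    refine tendsto_integral_of_dominated_convergence bd (fun n => (weak_id2 h (T := T) (κ := κ) x0 (show 0 < 1 / ((n:ℝ) + 1) by positivity) hκ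
      (B := fun _ => 1) (B1 := fun _ => 0) contDiff_const (fun t => hasDerivAt_const t _)).1.aestronglyMeasurable) ibd ?_ ?_
    · intro n
      rw [ae_restrict_iff' hQ]
      refine ae_of_all _ ?_
      rintro ⟨t, x⟩ ⟨ht, hx⟩
      simp only [mem_Ioi] at ht hx
      have hδ : 0 < 1 / ((n:ℝ) + 1) := by positivity
      set δ := 1 / ((n:ℝ) + 1) with hδe
      by_cases h3 : T - κ ≤ t
      · simp only [th1_zero hκ (Or.inl h3), th_zero hκ h3, zero_mul, mul_zero, sub_zero, add_zero, norm_zero]; exact nnb t x ht hx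
      · have hN := NN_pos (x0 := x0) (x := x) (show 0 < T - t by linarith)
        have hu := hn t x ht hx.le
        have ht1 := th1_nonneg (T := T) hκ t
        simp only
        rw [norm_mul, Real.norm_of_nonneg hu, mem t x ht hx h3, ← mul_assoc]
        refine mul_le_mul_of_nonneg_right ?_ hu
        have a1 := e1 t x ht hx h3
        have a2 := e2 δ t x hδ ht hx h3
        have f0 := FF_nonneg (x0 := x0) (T := T) (t := t) (x := x) hδ
        have f1 := FF_le (x0 := x0) (T := T) (t := t) (x := x) hδ (by linarith)
        have d0 := FD_nonneg (x0 := x0) (T := T) (t := t) (x := x) hδ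
        have b1 : th1 T κ t * FF x0 δ T t x ≤ th1 T κ t * NN x0 (T - t) x := by gcongr
        have b2 : th T κ t * FD x0 δ T t x ≤ FD x0 δ T t x := mul_le_of_le_one_left d0 (th_le T κ t)
        have b3 : 0 ≤ th1 T κ t * FF x0 δ T t x := by positivity
        have b4 : 0 ≤ th T κ t * FD x0 δ T t x := mul_nonneg (th_nonneg T κ t) d0
        rw [hK2, add_mul, Real.norm_eq_abs, abs_le]
        constructor <;> linarith
    · rw [ae_restrict_iff' hQ]
      refine ae_of_all _ ?_
      rintro ⟨t, x⟩ ⟨ht, hx⟩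
      simp only [mem_Ioi] at ht hx
      by_cases h3 : T - κ ≤ t
      · simp only [th1_zero hκ (Or.inl h3), th_zero hκ h3, zero_mul, mul_zero, sub_zero, add_zero, neg_zero]
        exact tendsto_const_nhds
      · have l1 := (FF_tendsto (x0 := x0) (x := x) (show t < T by linarith)).const_mul (0 * th T κ t - 1 * th1 T κ t)
        have l2 := (FD_tendsto (x0 := x0) (x := x) (show t < T by linarith)).const_mul (1 * th T κ t)
        have l := (l1.add l2).mul_const (u t x)
        convert l using 2
        ring
  have L2 : Tendsto (fun n : ℕ => ∫ t in Ioi (0:ℝ), g t * (1 * th T κ t * FF x0 (1 / ((n:ℝ) + 1)) T t 0)) atTop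
      (𝓝 (∫ t in Ioi (0:ℝ), g t * (th T κ t * NN x0 (T - t) 0))) := by
    have mg : AEStronglyMeasurable g (volume.restrict (Ioi 0)) := gc.aestronglyMeasurable measurableSet_Ioi
    have ik := (gk_int hp h hn hc hT0).const_mul 2
    set b2 := (Ioc 0 T).indicator (fun t => 2 * (g t * (T - t) ^ (-(1/2):ℝ))) with hb2
    have ib : IntegrableOn b2 (Ioi 0) := ((integrable_indicator_iff measurableSet_Ioc).2 ik).integrableOn
    refine tendsto_integral_of_dominated_convergence b2 (fun n => ?_) ib ?_ ?_
    · refine mg.mul ?_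
      refine Measurable.aestronglyMeasurable ?_
      have m1 : Measurable (fun t : ℝ => NN x0 (T - t) 0) :=
        (NN_meas x0 T).comp (f := fun t : ℝ => (t, (0:ℝ))) (by fun_prop)
      have m2 : Measurable PP := PP_contDiff.continuous.measurable
      have m3 : Measurable (th T κ) := (th_cd T κ).continuous.measurable
      unfold FF
      exact (measurable_const.mul m3).mul (measurable_const.mul (m2.comp ((m1.div_const _).sub_const _)))
    · intro n
      rw [ae_restrict_iff' measurableSet_Ioi]
      refine ae_of_all _ (fun t ht => ?_)
      simp only [mem_Ioi] at ht
      have hδ : 0 < 1 / ((n:ℝ) + 1) := by positivity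
      set δ := 1 / ((n:ℝ) + 1) with hδe
      have gt0 := g0 t ht
      by_cases h3 : T - κ ≤ t
      · simp only [th_zero hκ h3, zero_mul, mul_zero, norm_zero]
        apply indicator_nonneg
        intro s hs
        have := g0 s hs.1
        have : 0 ≤ T - s := by linarith [hs.2]
        positivity
      · have hm : b2 t = 2 * (g t * (T - t) ^ (-(1/2):ℝ)) := indicator_of_mem (s := Ioc 0 T) ⟨ht, by linarith⟩ _
        have f0 := FF_nonneg (x0 := x0) (T := T) (t := t) (x := 0) hδ
        have f1 := FF_le (x0 := x0) (T := T) (t := t) (x := 0) hδ (by linarith)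
        rw [NNat0] at f1
        have f2 := Gam_le_rpow (show 0 < T - t by linarith) x0
        have t0 := th_nonneg T κ t
        rw [hm, Real.norm_of_nonneg (by positivity), one_mul]
        calc g t * (th T κ t * FF x0 δ T t 0) ≤ g t * (1 * (2 * (T - t) ^ (-(1/2):ℝ))) := by
              gcongr
              · exact th_le T κ t
              · linarith
          _ = _ := by ring
    · rw [ae_restrict_iff' measurableSet_Ioi]
      refine ae_of_all _ (fun t ht => ?_)
      by_cases h3 : T - κ ≤ t
      · simp only [th_zero hκ h3, zero_mul, mul_zero]
        exact tendsto_const_nhds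
      · have l1 := (FF_tendsto (x0 := x0) (x := 0) (show t < T by linarith)).const_mul (1 * th T κ t)
        have l := l1.const_mul (g t)
        convert l using 2
        ring
  have L3 : Tendsto (fun n : ℕ => ℓ * (1 * th T κ 0 * FF x0 (1 / ((n:ℝ) + 1)) T 0 0)) atTop (𝓝 (ℓ * NN x0 T 0)) := by
    rw [th_one hκ (by linarith)]
    have := (FF_tendsto (x0 := x0) (x := 0) hT0).const_mul ℓ
    simpa using this
  have L := tendsto_nhds_unique (L1.congr (fun n : ℕ => (weak_id2 h (T := T) (κ := κ) x0 (show 0 < 1 / ((n:ℝ) + 1) by positivity) hκ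
    (B := fun _ => 1) (B1 := fun _ => 0) contDiff_const (fun t => hasDerivAt_const t _)).2)) (L2.sub L3)
  rw [integral_neg] at L
  have e : ∫ t in Ioi (0:ℝ), g t * (th T κ t * NN x0 (T - t) 0) = ∫ t in Ioc 0 T, g t * (th T κ t * NN x0 (T - t) 0) := by
    apply setIntegral_eq_of_subset_of_forall_sdiff_eq_zero measurableSet_Ioi Ioc_subset_Ioi_self
    intro t ht
    have : T - κ ≤ t := by
      by_contra hc
      exact ht.2 ⟨ht.1, by linarith⟩
    rw [th_zero hκ this]; simp
  rw [e] at L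
  linarith


lemma far_bd {C x0 x T t κ ρ : ℝ} (hC : ∀ y, deriv Real.smoothTransition y ≤ C) (hC0 : 0 ≤ C) (hκ : 0 < κ) (hT : 2 * κ ≤ T)
    (hx : 0 ≤ x) (hx0 : 0 ≤ x0) (hρ : 0 < ρ) (hr : ρ ≤ |x - x0|) (h1 : κ ≤ T - t) (h2 : T - t ≤ 2 * κ) :
    th1 T κ t * NN x0 (T - t) x ≤ (4096 * C / ρ ^ 4 * Real.exp (x0 ^ 2 / (16 * T)) * √κ) * Real.exp (-(1 / (32 * T)) * x ^ 2) := by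
  have hT0 : 0 < T := by linarith
  have a := NN_bd (x0 := x0) (x := x) hκ h1 h2
  have hN := NN_pos (x0 := x0) (x := x) (show 0 < T - t by linarith)
  have b : th1 T κ t ≤ C / κ := by unfold th1; gcongr; exact hC _
  have hr2 : ρ ^ 2 ≤ (x - x0) ^ 2 := by rw [← sq_abs (x - x0)]; gcongr
  have c1 : Real.exp (-(x + x0) ^ 2 / (8 * (2 * κ))) ≤ Real.exp (-(x - x0) ^ 2 / (8 * (2 * κ))) := by
    rw [Real.exp_le_exp]; gcongr ?_ / _; nlinarith [mul_nonneg hx hx0]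
  have c2 : Real.exp (-(x - x0) ^ 2 / (8 * (2 * κ))) = Real.exp (-(x - x0) ^ 2 / (32 * κ)) * Real.exp (-(x - x0) ^ 2 / (32 * κ)) := by
    rw [← Real.exp_add]; congr 1; field_simp; ring
  have c3 : Real.exp (-(x - x0) ^ 2 / (32 * κ)) ≤ 2048 * κ ^ 2 / ρ ^ 4 := by
    have hy : 0 < ρ ^ 2 / (32 * κ) := by positivity
    have q := Real.quadratic_le_exp_of_nonneg hy.le
    have q2 : (ρ ^ 2 / (32 * κ)) ^ 2 / 2 ≤ Real.exp (ρ ^ 2 / (32 * κ)) := by linarith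
    calc Real.exp (-(x - x0) ^ 2 / (32 * κ)) ≤ Real.exp (-(ρ ^ 2 / (32 * κ))) := by
          rw [Real.exp_le_exp, ← neg_div]; gcongr
      _ = 1 / Real.exp (ρ ^ 2 / (32 * κ)) := by rw [Real.exp_neg, one_div]
      _ ≤ 1 / ((ρ ^ 2 / (32 * κ)) ^ 2 / 2) := by gcongr
      _ = _ := by field_simp; norm_num
  have c4 : Real.exp (-(x - x0) ^ 2 / (32 * κ)) ≤ Real.exp (x0 ^ 2 / (16 * T)) * Real.exp (-(1 / (32 * T)) * x ^ 2) := by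
    have := exp_env (show 0 < 2 * T by linarith) x0 x
    rw [show 8 * (2 * T) = 16 * T by ring, show 16 * (2 * T) = 32 * T by ring, show (x0 - x) ^ 2 = (x - x0) ^ 2 by ring] at this
    refine le_trans ?_ this
    rw [Real.exp_le_exp, neg_div, neg_div, neg_le_neg_iff]
    exact div_le_div_of_nonneg_left (sq_nonneg _) (by positivity) (by linarith)
  have hk : κ ^ (-(1/2):ℝ) = (√κ)⁻¹ := by rw [Real.rpow_neg hκ.le, Real.sqrt_eq_rpow]
  have hs : √κ * √κ = κ := Real.mul_self_sqrt hκ.le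
  have hs0 : 0 < √κ := Real.sqrt_pos.2 hκ
  calc th1 T κ t * NN x0 (T - t) x ≤ C / κ * (κ ^ (-(1/2):ℝ) * (2 * (2048 * κ ^ 2 / ρ ^ 4 * (Real.exp (x0 ^ 2 / (16 * T)) * Real.exp (-(1 / (32 * T)) * x ^ 2))))) := by
        refine mul_le_mul b (a.trans ?_) hN.le (by positivity)
        gcongr
        have : Real.exp (-(x - x0) ^ 2 / (8 * (2 * κ))) ≤ 2048 * κ ^ 2 / ρ ^ 4 * (Real.exp (x0 ^ 2 / (16 * T)) * Real.exp (-(1 / (32 * T)) * x ^ 2)) := by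
          rw [c2]; gcongr
        linarith
    _ = _ := by
        rw [hk]; field_simp
        rw [sq, hs]; ring

theorem step3a {p ℓ : ℝ} (hp : 1 < p) (hℓ : 0 < ℓ) {u : ℝ → ℝ → ℝ} (h : IsWeakSolDelta p ℓ u)
    (hn : ∀ t x : ℝ, 0 < t → 0 ≤ x → 0 ≤ u t x)
    (hc : ContinuousOn (fun q : ℝ × ℝ => u q.1 q.2) (Ioi 0 ×ˢ Ici 0)) {T x0 : ℝ} (hx0 : 0 ≤ x0)
    (hT : 0 < T) :
    Tendsto (fun κ => ∫ q in Ioi (0:ℝ) ×ˢ Ioi (0:ℝ), th1 T κ q.1 * NN x0 (T - q.1) q.2 * u q.1 q.2) (𝓝[>] 0)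
      (𝓝 (c0 * u T x0)) := by
  have hQ : MeasurableSet (Ioi (0:ℝ) ×ˢ Ioi (0:ℝ)) := measurableSet_Ioi.prod measurableSet_Ioi
  obtain ⟨C, hC0, hC⟩ := ST_deriv_bdd
  have hS : MeasurableSet (Ioo 0 T ×ˢ Ioi (0:ℝ)) := measurableSet_Ioo.prod measurableSet_Ioi
  set u0 := u T x0 with hu0
  have u00 : 0 ≤ u0 := hn T x0 hT hx0
  have hb : (0:ℝ) < 1 / (32 * T) := by positivity
  have gr := growth hp hℓ h hn hc hT hb
  have gr2 : IntegrableOn (fun q : ℝ × ℝ => u0 * Real.exp (-(1 / (32 * T)) * q.2 ^ 2)) (Ioo 0 T ×ˢ Ioi 0) := by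
    have i1 : Integrable (fun _ : ℝ => u0) (volume.restrict (Ioo 0 T)) := integrable_const _
    have := i1.mul_prod ((integrable_exp_neg_mul_sq hb).restrict (s := Ioi 0))
    rw [Measure.prod_restrict, ← Measure.volume_eq_prod] at this
    exact this
  set bd := (Ioo 0 T ×ˢ Ioi (0:ℝ)).indicator (fun q : ℝ × ℝ => Real.exp (-(1 / (32 * T)) * q.2 ^ 2) * u q.1 q.2 + u0 * Real.exp (-(1 / (32 * T)) * q.2 ^ 2)) with hbd
  have ibd : IntegrableOn bd (Ioi 0 ×ˢ Ioi 0) := ((integrable_indicator_iff hS).2 (gr.add gr2)).integrableOn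
  have nnb : ∀ t x, 0 ≤ bd (t, x) := by
    intro t x
    apply indicator_nonneg
    rintro q ⟨q1, q2⟩
    have := hn q.1 q.2 q1.1 (le_of_lt q2)
    positivity
  set I := ∫ q in Ioi (0:ℝ) ×ˢ Ioi (0:ℝ), bd q with hI
  have hc0 : 0 < c0 := by rw [c0_eq]; positivity
  rw [Metric.tendsto_nhds]
  intro ε hε
  set e := ε / (2 * c0) with he
  have he0 : 0 < e := by positivity
  have cc := hc (T, x0) ⟨hT, hx0⟩
  rw [Metric.continuousWithinAt_iff] at cc
  obtain ⟨ρ, hρ, cc⟩ := cc e he0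
  set M := 4096 * C / ρ ^ 4 * Real.exp (x0 ^ 2 / (16 * T)) with hM
  have lim : Tendsto (fun κ : ℝ => M * √κ * I) (𝓝[>] 0) (𝓝 0) := by
    have : Tendsto (fun κ : ℝ => M * √κ * I) (𝓝 0) (𝓝 (M * √0 * I)) := by
      apply Continuous.tendsto; fun_prop
    simp only [Real.sqrt_zero, mul_zero, zero_mul] at this
    exact this.mono_left nhdsWithin_le_nhds
  have ev1 : ∀ᶠ κ : ℝ in 𝓝[>] 0, 2 * κ < T := nhdsWithin_le_nhds (by
    filter_upwards [gt_mem_nhds (show 0 < T / 2 by positivity)] with κ hκ; linarith)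
  have ev2 : ∀ᶠ κ : ℝ in 𝓝[>] 0, 2 * κ < ρ := nhdsWithin_le_nhds (by
    filter_upwards [gt_mem_nhds (show 0 < ρ / 2 by positivity)] with κ hκ; linarith)
  filter_upwards [ev1, ev2, lim.eventually (gt_mem_nhds (show 0 < ε / 2 by positivity)), self_mem_nhdsWithin] with κ h1 h2 h3 hκ
  simp only [mem_Ioi] at hκ
  obtain ⟨iN, eN⟩ := thN hκ h1.le x0
  have iU := (step2 hp hℓ h hn hc hx0 hκ h1.le).1
  have eq1 : (∫ q in Ioi (0:ℝ) ×ˢ Ioi (0:ℝ), th1 T κ q.1 * NN x0 (T - q.1) q.2 * u q.1 q.2) - c0 * u0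
      = ∫ q in Ioi (0:ℝ) ×ˢ Ioi (0:ℝ), (th1 T κ q.1 * NN x0 (T - q.1) q.2 * u q.1 q.2 - th1 T κ q.1 * NN x0 (T - q.1) q.2 * u0) := by
    rw [integral_sub iU (iN.mul_const u0), integral_mul_const, eN]
  rw [Real.dist_eq, eq1, ← Real.norm_eq_abs]
  have key : ‖∫ q in Ioi (0:ℝ) ×ˢ Ioi (0:ℝ), (th1 T κ q.1 * NN x0 (T - q.1) q.2 * u q.1 q.2 - th1 T κ q.1 * NN x0 (T - q.1) q.2 * u0)‖
      ≤ ∫ q in Ioi (0:ℝ) ×ˢ Ioi (0:ℝ), (e * (th1 T κ q.1 * NN x0 (T - q.1) q.2) + M * √κ * bd q) := by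
    refine norm_integral_le_of_norm_le ((iN.const_mul e).add (ibd.const_mul (M * √κ))) ?_
    rw [ae_restrict_iff' hQ]
    refine ae_of_all _ ?_
    rintro ⟨t, x⟩ ⟨ht, hx⟩
    simp only [mem_Ioi] at ht hx
    simp only
    have hb0 := nnb t x
    have hM0 : 0 ≤ M * √κ := by positivity
    by_cases h4 : T - κ ≤ t ∨ t ≤ T - 2 * κ
    · rw [th1_zero hκ h4]; simp only [zero_mul, sub_zero, norm_zero, mul_zero, zero_add]; positivity
    push Not at h4
    have hu := hn t x ht hx.le
    have hN := NN_pos (x0 := x0) (x := x) (show 0 < T - t by linarith)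
    have ht1 := th1_nonneg (T := T) hκ t
    have hA : 0 ≤ th1 T κ t * NN x0 (T - t) x := by positivity
    rw [← mul_sub, norm_mul, Real.norm_of_nonneg hA]
    by_cases h5 : |x - x0| < ρ
    · have := cc (x := (t, x)) ⟨ht, hx.le⟩ (by
        rw [Prod.dist_eq, max_lt_iff, Real.dist_eq, Real.dist_eq]
        refine ⟨?_, h5⟩
        simp only
        rw [abs_lt]; constructor <;> linarith)
      rw [Real.dist_eq] at this
      have : th1 T κ t * NN x0 (T - t) x * ‖u t x - u0‖ ≤ th1 T κ t * NN x0 (T - t) x * e :=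
        mul_le_mul_of_nonneg_left this.le hA
      have : 0 ≤ M * √κ * bd (t, x) := by positivity
      linarith
    · push Not at h5
      have fb := far_bd (C := C) (T := T) (t := t) hC hC0 hκ h1.le hx.le hx0 hρ h5 (by linarith) (by linarith)
      have hm : bd (t, x) = Real.exp (-(1 / (32 * T)) * x ^ 2) * u t x + u0 * Real.exp (-(1 / (32 * T)) * x ^ 2) :=
        indicator_of_mem (s := Ioo 0 T ×ˢ Ioi (0:ℝ)) (a := (t, x)) ⟨⟨ht, by simp only; linarith⟩, hx⟩ _
      have nb : ‖u t x - u0‖ ≤ u t x + u0 := by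
        rw [Real.norm_eq_abs, abs_le]; constructor <;> linarith
      have : th1 T κ t * NN x0 (T - t) x * ‖u t x - u0‖ ≤ M * √κ * Real.exp (-(1 / (32 * T)) * x ^ 2) * (u t x + u0) :=
        mul_le_mul fb nb (norm_nonneg _) (by positivity)
      have h0 : 0 ≤ e * (th1 T κ t * NN x0 (T - t) x) := by positivity
      rw [hm]
      linarith
  rw [integral_add (iN.const_mul e) (ibd.const_mul (M * √κ)), integral_const_mul, integral_const_mul, eN] at key
  have : e * c0 = ε / 2 := by rw [he]; field_simp
  linarith

theorem step3 {p ℓ : ℝ} (hp : 1 < p) (hℓ : 0 < ℓ) {u : ℝ → ℝ → ℝ} (h : IsWeakSolDelta p ℓ u)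
    (hn : ∀ t x : ℝ, 0 < t → 0 ≤ x → 0 ≤ u t x)
    (hc : ContinuousOn (fun q : ℝ × ℝ => u q.1 q.2) (Ioi 0 ×ˢ Ici 0)) {T x0 : ℝ} (hx0 : 0 ≤ x0)
    (hT : 0 < T) :
    IntegrableOn (fun t => |u t 0| ^ (p - 1) * u t 0 * NN x0 (T - t) 0) (Ioc 0 T) ∧
    c0 * u T x0 = ℓ * NN x0 T 0 - ∫ t in Ioc 0 T, |u t 0| ^ (p - 1) * u t 0 * NN x0 (T - t) 0 := by
  set g := fun t => |u t 0| ^ (p - 1) * u t 0 with hg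
  have gc : ContinuousOn g (Ioi 0) := g_cont hp hc
  have g0 : ∀ t, 0 < t → 0 ≤ g t := fun t ht => mul_nonneg (by positivity) (hn t 0 ht le_rfl)
  have mg : AEStronglyMeasurable g (volume.restrict (Ioc 0 T)) := (gc.mono Ioc_subset_Ioi_self).aestronglyMeasurable measurableSet_Ioc
  have ik : IntegrableOn (fun t => 2 * (g t * (T - t) ^ (-(1/2):ℝ))) (Ioc 0 T) := (gk_int hp h hn hc hT).const_mul 2
  have m1 : Measurable (fun t : ℝ => NN x0 (T - t) 0) :=
    (NN_meas x0 T).comp (f := fun t : ℝ => (t, (0:ℝ))) (by fun_prop)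
  have neT : ∀ᵐ t ∂(volume.restrict (Ioc 0 T)), t ≠ T := ae_restrict_of_ae (by
    have : ({T} : Set ℝ)ᶜ ∈ ae (volume : Measure ℝ) := compl_mem_ae_iff.2 (by simp)
    exact this)
  have bnd : ∀ t, 0 < t → t < T → g t * NN x0 (T - t) 0 ≤ 2 * (g t * (T - t) ^ (-(1/2):ℝ)) := by
    intro t h1 h2
    rw [NNat0]
    have f2 := Gam_le_rpow (show 0 < T - t by linarith) x0
    have := mul_le_mul_of_nonneg_left f2 (g0 t h1)
    linarith
  have i1 : IntegrableOn (fun t => g t * NN x0 (T - t) 0) (Ioc 0 T) := by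
    refine Integrable.mono' ik (mg.mul m1.aestronglyMeasurable) ?_
    filter_upwards [neT, ae_restrict_mem measurableSet_Ioc] with t h1 h2
    have h3 : t < T := lt_of_le_of_ne h2.2 h1
    rw [Real.norm_of_nonneg (mul_nonneg (g0 t h2.1) (NN_pos (by linarith)).le)]
    exact bnd t h2.1 h3
  refine ⟨i1, ?_⟩
  have L2 : Tendsto (fun κ => ∫ t in Ioc 0 T, g t * (th T κ t * NN x0 (T - t) 0)) (𝓝[>] 0)
      (𝓝 (∫ t in Ioc 0 T, g t * NN x0 (T - t) 0)) := by
    refine tendsto_integral_filter_of_dominated_convergence _ (Eventually.of_forall (fun κ => mg.mul ((th_cd T κ).continuous.measurable.mul m1).aestronglyMeasurable))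
      (Eventually.of_forall (fun κ => ?_)) ik ?_
    · filter_upwards [neT, ae_restrict_mem measurableSet_Ioc] with t h1 h2
      have h3 : t < T := lt_of_le_of_ne h2.2 h1
      have hN := (NN_pos (x0 := x0) (x := 0) (show 0 < T - t by linarith)).le
      rw [Real.norm_of_nonneg (mul_nonneg (g0 t h2.1) (mul_nonneg (th_nonneg _ _ _) hN))]
      refine le_trans ?_ (bnd t h2.1 h3)
      exact mul_le_mul_of_nonneg_left (mul_le_of_le_one_left hN (th_le _ _ _)) (g0 t h2.1)
    · filter_upwards [neT, ae_restrict_mem measurableSet_Ioc] with t h1 h2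
      have h3 : t < T := lt_of_le_of_ne h2.2 h1
      refine tendsto_const_nhds.congr' ?_
      have ev1 : ∀ᶠ κ : ℝ in 𝓝[>] 0, κ < (T - t) / 2 := nhdsWithin_le_nhds (gt_mem_nhds (by linarith))
      filter_upwards [ev1, self_mem_nhdsWithin] with κ h4 h5
      rw [th_one h5 (by linarith), one_mul]
  have ev : ∀ᶠ κ : ℝ in 𝓝[>] 0, κ < T / 2 := nhdsWithin_le_nhds (gt_mem_nhds (by linarith))
  have L1 := step3a hp hℓ h hn hc hx0 hT
  refine tendsto_nhds_unique L1 ((L2.const_sub (ℓ * NN x0 T 0)).congr' ?_)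
  filter_upwards [ev, self_mem_nhdsWithin] with κ h4 h5
  exact (step2 hp hℓ h hn hc hx0 h5 (by linarith)).2.symm

theorem sol_rep {p ℓ : ℝ} (hp : 1 < p) (hℓ : 0 < ℓ) {u : ℝ → ℝ → ℝ} (h : IsWeakSolDelta p ℓ u)
    (hn : ∀ t x : ℝ, 0 < t → 0 ≤ x → 0 ≤ u t x)
    (hc : ContinuousOn (fun q : ℝ × ℝ => u q.1 q.2) (Ioi 0 ×ˢ Ici 0)) : RepP p u (fun _ => ℓ) := by
  intro t x ht hx
  obtain ⟨i, e⟩ := step3 hp hℓ h hn hc hx ht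
  have hpi : 0 < √π := Real.sqrt_pos.2 Real.pi_pos
  have eqf : EqOn (fun r => (c0)⁻¹ * (|u r 0| ^ (p - 1) * u r 0 * NN x (t - r) 0)) (fun r => EE (t - r) x * (u r 0) ^ p) (Ioc 0 t) := by
    intro r hr
    have h0 := hn r 0 hr.1 le_rfl
    have : |u r 0| ^ (p - 1) * u r 0 = u r 0 ^ p := by
      rw [abs_of_nonneg h0]
      rcases h0.eq_or_lt with h1 | h1
      · rw [← h1, mul_zero, Real.zero_rpow (by linarith)]
      · rw [← Real.rpow_add_one h1.ne', sub_add_cancel]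
    simp only
    rw [this, NNat0, EE_Gam, c0_eq]
    field_simp
  have ii : IntervalIntegrable (fun r => EE (t - r) x * (u r 0) ^ p) volume 0 t := by
    rw [intervalIntegrable_iff_integrableOn_Ioc_of_le ht.le]
    exact IntegrableOn.congr_fun (i.const_mul _) eqf measurableSet_Ioc
  have lim := (adm_tendsto ht ii).const_sub (ℓ * EE t x)
  convert lim using 2
  rw [intervalIntegral.integral_of_le ht.le, ← setIntegral_congr_fun measurableSet_Ioc eqf, integral_const_mul]
  have : u t x = c0⁻¹ * (c0 * u t x) := by rw [c0_eq]; field_simp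
  rw [this, e, NNat0, EE_Gam, mul_sub]
  congr 1
  rw [c0_eq]; field_simp

theorem delta_solutions_converge_to_self_similar (p : ℝ)
    (hp1 : 3 / 2 < p) (hp2 : p < 2)
    (u : ℝ → ℝ → ℝ → ℝ)
    (hsol : ∀ ℓ : ℝ, 0 < ℓ → IsWeakSolDelta p ℓ (u ℓ))
    (hnn : ∀ ℓ : ℝ, 0 < ℓ → ∀ t x : ℝ, 0 < t → 0 ≤ x → 0 ≤ u ℓ t x)
    (hcont : ∀ ℓ : ℝ, 0 < ℓ →
      ContinuousOn (fun q : ℝ × ℝ => u ℓ q.1 q.2) (Ioi 0 ×ˢ Ici 0))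
    (ωs : H1K) (hωs : IsWeakProfile p ωs)
    (hωspos : ∀ η : ℝ, 0 ≤ η → 0 < ωs.toFun η) :
    ∀ t x : ℝ, 0 < t → 0 ≤ x →
      Tendsto (fun ℓ => u ℓ t x) atTop
        (𝓝 (t ^ (-(1 / (2 * (p - 1)))) * ωs.toFun (x / Real.sqrt t))) := by
  obtain ⟨U, L, hU, eU⟩ := profile_rep hp1 ωs hωs (hωspos 0 le_rfl)
  have hq : 0 < p - 1 := by linarith
  have key := assemble (p := p) (a := 1 / (2 * (p - 1))) (c := ωs.toFun 0) (u := u) (U := U) (L := L)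
    (by linarith) hp2 (by field_simp; ring)
    (by rw [div_lt_div_iff₀ (by norm_num) (by positivity)]; linarith)
    (by rw [div_lt_one (by positivity)]; linarith) (hωspos 0 le_rfl)
    (fun ℓ hℓ => sol_rep (by linarith) hℓ (hsol ℓ hℓ) (hnn ℓ hℓ) (hcont ℓ hℓ))
    (fun ℓ hℓ => (hcont ℓ hℓ).comp (f := fun t : ℝ => (t, (0:ℝ))) (s := Ioi 0) (by fun_prop) (fun t ht => ⟨ht, self_mem_Ici⟩))
    (fun ℓ hℓ t ht => hnn ℓ hℓ t 0 ht le_rfl) hU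
    (fun t ht => by rw [eU t 0 ht le_rfl, zero_div, mul_comm])
  intro t x ht hx
  rw [← eU t x ht hx]
  exact key t x ht hx
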